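/- Let Ω ⊂ ℂⁿ, n ≥ 2, be a bounded pseudoconvex domain with C^∞ boundary, and let p ∈ ∂Ω be a strongly pseudoconvex boundary point. Let F be an automorphism of Ω with F(z) = z + o(‖z−p‖) as z → p within Ω. If Ω is not biholomorphic to the open unit ball Bⁿ ⊂ ℂⁿ, then F(z) = z for all z ∈ Ω. -/

import Mathlib

open Complex Topology Filter Metric Set Function

noncomputable section

/-- `ℂⁿ` as a normed space. -/
abbrev En (n : ℕ) : Type := EuclideanSpace ℂ (Fin n)

/-- A domain: a nonempty open connected set. -/
def IsDomain' {n : ℕ} (Ω : Set (En n)) : Prop :=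
  IsOpen Ω ∧ IsConnected Ω

/-- The Levi form of `ρ` at `q` in direction `ξ`:
`(1/4)(H_q(ξ,ξ) + H_q(iξ,iξ))` with `H_q` the second real Fréchet derivative. -/
def LeviForm {n : ℕ} (ρ : En n → ℝ) (q ξ : En n) : ℝ :=
  (1 / 4) * (iteratedFDeriv ℝ 2 ρ q ![ξ, ξ] + iteratedFDeriv ℝ 2 ρ q ![I • ξ, I • ξ])

/-- `ξ` lies in the complex tangent space of `{ρ = 0}` at `q`. -/
def InCplxTangent {n : ℕ} (ρ : En n → ℝ) (q ξ : En n) : Prop :=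
  fderiv ℝ ρ q ξ = 0 ∧ fderiv ℝ ρ q (I • ξ) = 0

/-- `ρ` is a `C^m` defining function for `Ω`. -/
def IsDefiningFunction {n : ℕ} (Ω : Set (En n)) (m : ℕ∞) (ρ : En n → ℝ) : Prop :=
  ContDiff ℝ m ρ ∧ Ω = {z | ρ z < 0} ∧ frontier Ω = {z | ρ z = 0} ∧
    ∀ q ∈ frontier Ω, fderiv ℝ ρ q ≠ 0

/-- `q` is a strongly pseudoconvex point with respect to `ρ`. -/
def StronglyPcxAt {n : ℕ} (ρ : En n → ℝ) (q : En n) : Prop :=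
  ∀ ξ : En n, ξ ≠ 0 → InCplxTangent ρ q ξ → 0 < LeviForm ρ q ξ

/-- `Ω` is pseudoconvex with `C^∞` boundary, witnessed by the defining function `ρ`. -/
def IsPcxCinfBoundary {n : ℕ} (Ω : Set (En n)) (ρ : En n → ℝ) : Prop :=
  IsDefiningFunction Ω ⊤ ρ ∧
    ∀ q ∈ frontier Ω, ∀ ξ : En n, InCplxTangent ρ q ξ → 0 ≤ LeviForm ρ q ξ

/-- `F z = z + o(‖z - p‖^k)` as `z → p` within `Ω`. -/
def LittleOh {n : ℕ} (Ω : Set (En n)) (F : En n → En n) (p : En n) (k : ℕ) : Prop :=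
  Tendsto (fun z => ‖F z - z‖ / ‖z - p‖ ^ k) (𝓝[Ω] p) (𝓝 0)

/-- `F` is an automorphism of `Ω`: a holomorphic bijection with holomorphic inverse. -/
def IsAutomorphismOf {n : ℕ} (F : En n → En n) (Ω : Set (En n)) : Prop :=
  DifferentiableOn ℂ F Ω ∧ MapsTo F Ω Ω ∧
    ∃ G : En n → En n, DifferentiableOn ℂ G Ω ∧ MapsTo G Ω Ω ∧
      (∀ z ∈ Ω, G (F z) = z) ∧ (∀ z ∈ Ω, F (G z) = z)

section SeveralVariables

variable {E F : Type*} [NormedAddCommGroup E] [NormedSpace ℂ E]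
  [NormedAddCommGroup F] [NormedSpace ℂ F]

/-- Cauchy estimate for the derivative. -/
theorem norm_fderiv_le_of_bound {f : E → F} {z : E} {R M : ℝ} (hR : 0 < R)
    (hf : DifferentiableOn ℂ f (ball z R)) (hM : ∀ w ∈ ball z R, ‖f w‖ ≤ M) :
    ‖fderiv ℂ f z‖ ≤ 2 * M / R := by
  refine Complex.norm_fderiv_le_div_of_mapsTo_ball hf (fun w hw => ?_) hR
  rw [mem_closedBall, dist_eq_norm]
  have := hM w hw
  have := hM z (mem_ball_self hR)
  have := norm_sub_le (f w) (f z)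
  linarith

/-- Cauchy estimate for the second-order remainder. -/
theorem norm_remainder_le_of_bound {f : E → F} {z w : E} {R M : ℝ} (hR : 0 < R)
    (hf : DifferentiableOn ℂ f (ball z R)) (hM : ∀ w ∈ ball z R, ‖f w‖ ≤ M) (hw : w ∈ ball z R) :
    ‖f w - f z - fderiv ℂ f z (w - z)‖ ≤ 4 * M * (‖w - z‖ / R) ^ 2 := by
  set L := fderiv ℂ f z with hL
  have hz : z ∈ ball z R := mem_ball_self hR
  have hdz : HasFDerivAt f L z := (hf.differentiableAt (isOpen_ball.mem_nhds hz)).hasFDerivAt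
  have hg : DifferentiableOn ℂ (fun x => f x - L (x - z)) (ball z R) :=
    hf.sub ((L.differentiable.comp (differentiable_id.sub_const z)).differentiableOn)
  have hLn := norm_fderiv_le_of_bound hR hf hM
  have key := Complex.dist_le_mul_div_pow_of_mapsTo_ball_of_isLittleO (n := 1) (R₂ := 4 * M) hg
    (fun x hx => ?_) ?_ hw
  · simpa [dist_eq_norm, sub_right_comm] using key
  · rw [mem_closedBall, dist_eq_norm]
    have h1 := hM x hx
    have h2 := hM z hz
    have h3 : ‖L (x - z)‖ ≤ 2 * M := by
      have h4 : ‖x - z‖ ≤ R := by rw [← dist_eq_norm]; exact (mem_ball.1 hx).le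
      calc ‖L (x - z)‖ ≤ ‖L‖ * ‖x - z‖ := L.le_opNorm _
        _ ≤ (2 * M / R) * R := by gcongr; exact (norm_nonneg _).trans hLn
        _ = 2 * M := by field_simp
    have h5 : f x - L (x - z) - (f z - L (z - z)) = f x - f z - L (x - z) := by simp; abel
    rw [h5]
    have := norm_sub_le (f x - f z) (L (x - z))
    have := norm_sub_le (f x) (f z)
    linarith
  · have := hdz.isLittleO
    simp only [pow_one]
    refine this.norm_right.congr_left (fun x => ?_)
    simp; abel

/-- A family is eventually holomorphic and bounded, locally on `U`. -/
def LocBdd {ι : Type*} (l : Filter ι) (f : ι → E → F) (U : Set E) : Prop :=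
  ∀ z ∈ U, ∃ ε > 0, ∃ M, ∀ᶠ j in l, DifferentiableOn ℂ (f j) (ball z ε) ∧
    ∀ w ∈ ball z ε, ‖f j w‖ ≤ M

theorem LocBdd.of_bound {ι : Type*} {l : Filter ι} {f : ι → E → F} {U : Set E} (hU : IsOpen U)
    (M : ℝ) (hf : ∀ j, DifferentiableOn ℂ (f j) U) (hM : ∀ j, ∀ w ∈ U, ‖f j w‖ ≤ M) :
    LocBdd l f U := by
  intro z hz
  obtain ⟨ε, hε, hb⟩ := Metric.isOpen_iff.1 hU z hz
  exact ⟨ε, hε, M, Eventually.of_forall fun j => ⟨(hf j).mono hb, fun w hw => hM j w (hb hw)⟩⟩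

variable {ι : Type*} {l : Ultrafilter ι} {f : ι → E → F} {g : E → F} {U : Set E}

theorem exists_tendsto_of_bounded {F : Type*} [NormedAddCommGroup F] [ProperSpace F] {x : ι → F} {M : ℝ}
    (h : ∀ᶠ j in (l : Filter ι), ‖x j‖ ≤ M) : ∃ y, Tendsto x l (𝓝 y) := by
  obtain ⟨y, -, hy⟩ := (isCompact_closedBall (0 : F) M).ultrafilter_le_nhds (l.map x) (by
    rw [le_principal_iff]
    exact h.mono fun j hj => by simpa using hj)
  exact ⟨y, hy⟩

theorem LocBdd.exists_limit [ProperSpace F] (hf : LocBdd (l : Filter ι) f U) :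
    ∃ g : E → F, ∀ z ∈ U, Tendsto (fun j => f j z) l (𝓝 (g z)) := by
  have : ∀ z, ∃ y, z ∈ U → Tendsto (fun j => f j z) l (𝓝 y) := by
    intro z
    by_cases hz : z ∈ U
    · obtain ⟨ε, hε, M, h⟩ := hf z hz
      obtain ⟨y, hy⟩ := exists_tendsto_of_bounded (l := l) (x := fun j => f j z) (M := M)
        (h.mono fun j hj => hj.2 z (mem_ball_self hε))
      exact ⟨y, fun _ => hy⟩
    · exact ⟨0, fun h => absurd h hz⟩
  choose g hg using this
  exact ⟨g, hg⟩

/-- Locally bounded pointwise convergent families converge continuously. -/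
theorem LocBdd.tendsto_comp {l : Filter ι} (hf : LocBdd l f U) {z : E} (hz : z ∈ U)
    (h : Tendsto (fun j => f j z) l (𝓝 (g z))) {x : ι → E} (hx : Tendsto x l (𝓝 z)) :
    Tendsto (fun j => f j (x j)) l (𝓝 (g z)) := by
  obtain ⟨ε, hε, M, hM⟩ := hf z hz
  have h0 : Tendsto (fun j => (2 * M / ε) * dist (x j) z) l (𝓝 0) := by
    simpa using (tendsto_iff_dist_tendsto_zero.1 hx).const_mul (2 * M / ε)
  have h1 : Tendsto (fun j => f j (x j) - f j z) l (𝓝 0) := by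
    refine squeeze_zero_norm' ?_ h0
    filter_upwards [hM, hx.eventually (ball_mem_nhds z hε)] with j hj hxj
    rw [← dist_eq_norm]
    refine Complex.dist_le_div_mul_dist_of_mapsTo_ball hj.1 (fun w hw => ?_) hxj
    rw [mem_closedBall, dist_eq_norm]
    have := hj.2 w hw
    have := hj.2 z (mem_ball_self hε)
    have := norm_sub_le (f j w) (f j z)
    linarith
  simpa using h1.add h

/-- Pointwise limits of locally bounded holomorphic families are holomorphic, with convergence of
the derivatives. -/
theorem LocBdd.hasFDerivAt_limit [FiniteDimensional ℂ E] [FiniteDimensional ℂ F]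
    (hf : LocBdd (l : Filter ι) f U) (hU : IsOpen U)
    (h : ∀ z ∈ U, Tendsto (fun j => f j z) l (𝓝 (g z))) {z : E} (hz : z ∈ U) :
    ∃ L : E →L[ℂ] F, HasFDerivAt g L z ∧ Tendsto (fun j => fderiv ℂ (f j) z) l (𝓝 L) := by
  have : ProperSpace (E →L[ℂ] F) := FiniteDimensional.proper ℂ _
  obtain ⟨ε₀, hε₀, M, hM₀⟩ := hf z hz
  obtain ⟨ε₁, hε₁, hb⟩ := Metric.isOpen_iff.1 hU z hz
  obtain ⟨ε, hε, h0, h1⟩ : ∃ ε > 0, ε ≤ ε₀ ∧ ε ≤ ε₁ :=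
    ⟨min ε₀ ε₁, lt_min hε₀ hε₁, min_le_left _ _, min_le_right _ _⟩
  have hM : ∀ᶠ j in (l : Filter ι), DifferentiableOn ℂ (f j) (ball z ε) ∧
      ∀ w ∈ ball z ε, ‖f j w‖ ≤ M :=
    hM₀.mono fun j hj => ⟨hj.1.mono (ball_subset_ball h0), fun w hw => hj.2 w (ball_subset_ball h0 hw)⟩
  obtain ⟨L, hL⟩ := exists_tendsto_of_bounded (l := l) (x := fun j => fderiv ℂ (f j) z)
    (M := 2 * M / ε) (hM.mono fun j hj => norm_fderiv_le_of_bound hε hj.1 hj.2)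
  refine ⟨L, ?_, hL⟩
  have hrem : ∀ w ∈ ball z ε, ‖g w - g z - L (w - z)‖ ≤ 4 * M * (‖w - z‖ / ε) ^ 2 := by
    intro w hw
    have hwU : w ∈ U := hb (ball_subset_ball h1 hw)
    have ht : Tendsto (fun j => ‖f j w - f j z - fderiv ℂ (f j) z (w - z)‖) l
        (𝓝 ‖g w - g z - L (w - z)‖) :=
      (((h w hwU).sub (h z hz)).sub
        (((ContinuousLinearMap.apply ℂ F (w - z)).continuous.tendsto L).comp hL)).norm
    exact le_of_tendsto ht (hM.mono fun j hj => norm_remainder_le_of_bound hε hj.1 hj.2 hw)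
  rw [hasFDerivAt_iff_isLittleO]
  have hO : (fun w => g w - g z - L (w - z)) =O[𝓝 z] fun w => ‖w - z‖ ^ 2 := by
    refine Asymptotics.IsBigO.of_bound (4 * M / ε ^ 2) ?_
    filter_upwards [ball_mem_nhds z hε] with w hw
    refine (hrem w hw).trans (le_of_eq ?_)
    simp; ring
  refine hO.trans_isLittleO ?_
  have : (fun w => ‖w - z‖ ^ 2) =o[𝓝 z] fun w => ‖w - z‖ ^ 1 := by
    have h2 := (Asymptotics.isLittleO_pow_pow (𝕜 := ℝ) (show 1 < 2 by norm_num))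
    refine h2.comp_tendsto (k := fun w => ‖w - z‖) ?_
    have : Tendsto (fun w => ‖w - z‖) (𝓝 z) (𝓝 ‖z - z‖) := by
      exact (continuous_id.sub continuous_const).norm.tendsto z
    simpa using this
  simpa using this

theorem LocBdd.differentiableOn_limit [FiniteDimensional ℂ E] [FiniteDimensional ℂ F]
    (hf : LocBdd (l : Filter ι) f U) (hU : IsOpen U)
    (h : ∀ z ∈ U, Tendsto (fun j => f j z) l (𝓝 (g z))) : DifferentiableOn ℂ g U := fun _ hz =>
  (hf.hasFDerivAt_limit hU h hz).choose_spec.1.differentiableAt.differentiableWithinAt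

theorem LocBdd.tendsto_fderiv [FiniteDimensional ℂ E] [FiniteDimensional ℂ F]
    (hf : LocBdd (l : Filter ι) f U) (hU : IsOpen U)
    (h : ∀ z ∈ U, Tendsto (fun j => f j z) l (𝓝 (g z))) {z : E} (hz : z ∈ U) :
    Tendsto (fun j => fderiv ℂ (f j) z) l (𝓝 (fderiv ℂ g z)) := by
  obtain ⟨L, h1, h2⟩ := hf.hasFDerivAt_limit hU h hz
  rwa [h1.fderiv]

/-- Holomorphic functions are locally bounded together with their difference quotients; the
directional derivatives of a holomorphic map are holomorphic. -/
theorem differentiableOn_fderiv_apply [FiniteDimensional ℂ E] [FiniteDimensional ℂ F]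
    (hU : IsOpen U) (hg : DifferentiableOn ℂ g U) (v : E) :
    DifferentiableOn ℂ (fun z => fderiv ℂ g z v) U := by
  set q : ℕ → E → F := fun j z => ((j : ℂ) + 1) • (g (z + ((j : ℂ) + 1)⁻¹ • v) - g z) with hq
  have hv : Tendsto (fun j : ℕ => ((j : ℂ) + 1)⁻¹ • v) atTop (𝓝 0) := by
    have := (tendsto_one_div_add_atTop_nhds_zero_nat (𝕜 := ℂ)).smul_const v
    simpa using this
  have hq1 : ∀ z ∈ U, Tendsto (fun j => q j z) atTop (𝓝 (fderiv ℂ g z v)) := by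
    intro z hz
    have hd := (hg.differentiableAt (hU.mem_nhds hz)).hasFDerivAt
    refine hd.lim v (l := atTop) (c := fun j : ℕ => (j : ℂ) + 1) ?_
    have : Tendsto (fun j : ℕ => (j : ℝ) + 1) atTop atTop :=
      tendsto_atTop_add_const_right _ _ tendsto_natCast_atTop_atTop
    refine this.congr fun j => ?_
    have : ((j : ℂ) + 1) = (((j : ℝ) + 1 : ℝ) : ℂ) := by push_cast; rfl
    rw [this, Complex.norm_real, Real.norm_of_nonneg (by positivity)]
  have hlb : LocBdd atTop q U := by
    intro z hz
    have hd := (hg.differentiableAt (hU.mem_nhds hz)).continuousAt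
    obtain ⟨ε, hε, hb⟩ : ∃ ε > 0, ball z ε ⊆ {w | w ∈ U ∧ ‖g w‖ ≤ ‖g z‖ + 1} := by
      refine Metric.mem_nhds_iff.1 ?_
      filter_upwards [hU.mem_nhds hz, hd.norm.eventually_lt_const
        (show ‖g z‖ < ‖g z‖ + 1 by linarith)] with w h1 h2 using ⟨h1, h2.le⟩
    refine ⟨ε / 4, by positivity, (2 * (‖g z‖ + 1)) / (ε / 2) * ‖v‖, ?_⟩
    have he : ∀ᶠ j : ℕ in atTop, ‖((j : ℂ) + 1)⁻¹ • v‖ < ε / 4 := by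
      have := hv.norm
      rw [norm_zero] at this
      exact this.eventually_lt_const (by positivity)
    filter_upwards [he] with j hj
    have hmem : ∀ w ∈ ball z (ε / 4), w + ((j : ℂ) + 1)⁻¹ • v ∈ ball z ε := by
      intro w hw
      rw [mem_ball, dist_eq_norm] at hw ⊢
      have := norm_add_le (w - z) (((j : ℂ) + 1)⁻¹ • v)
      rw [show w + ((j : ℂ) + 1)⁻¹ • v - z = w - z + ((j : ℂ) + 1)⁻¹ • v by abel]
      linarith
    have hgb : DifferentiableOn ℂ g (ball z ε) := hg.mono fun w hw => (hb hw).1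
    constructor
    · refine ((hgb.comp (differentiableOn_id.add_const _) hmem).sub
        (hgb.mono (ball_subset_ball (by linarith)))).const_smul _
    · intro w hw
      have hsub : ball w (ε / 2) ⊆ ball z ε := by
        refine ball_subset_ball' ?_
        have := mem_ball.1 hw
        linarith
      have := Complex.dist_le_div_mul_dist_of_mapsTo_ball (f := g) (c := w)
        (z := w + ((j : ℂ) + 1)⁻¹ • v) (R₁ := ε / 2) (R₂ := 2 * (‖g z‖ + 1)) (hgb.mono hsub) ?_ ?_
      · have hne : ((j : ℂ) + 1) ≠ 0 := Nat.cast_add_one_ne_zero j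
        rw [dist_eq_norm, dist_eq_norm, add_sub_cancel_left] at this
        simp only [hq, norm_smul] at this ⊢
        calc _ ≤ ‖(j : ℂ) + 1‖ * (2 * (‖g z‖ + 1) / (ε / 2) * (‖((j : ℂ) + 1)⁻¹‖ * ‖v‖)) := by
              gcongr
          _ = _ := by
              rw [norm_inv]
              have : ‖(j : ℂ) + 1‖ ≠ 0 := norm_ne_zero_iff.2 hne
              field_simp
      · intro x hx
        rw [mem_closedBall, dist_eq_norm]
        have h1 := (hb (hsub hx)).2
        have h2 := (hb (hsub (mem_ball_self (by positivity)))).2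
        have := norm_sub_le (g x) (g w)
        linarith
      · rw [mem_ball, dist_eq_norm, add_sub_cancel_left]
        linarith
  have hle : (hyperfilter ℕ : Filter ℕ) ≤ atTop := Nat.hyperfilter_le_atTop
  refine LocBdd.differentiableOn_limit (l := hyperfilter ℕ) (f := q) ?_ hU
    fun z hz => (hq1 z hz).mono_left hle
  intro z hz
  obtain ⟨ε, hε, M, h⟩ := hlb z hz
  exact ⟨ε, hε, M, hle h⟩

theorem continuousOn_fderiv [FiniteDimensional ℂ E] [FiniteDimensional ℂ F]
    (hU : IsOpen U) (hg : DifferentiableOn ℂ g U) :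
    ContinuousOn (fun z => fderiv ℂ g z) U :=
  continuousOn_clm_apply.2 fun v => (differentiableOn_fderiv_apply hU hg v).continuousOn

theorem hasStrictFDerivAt_of_differentiableOn [FiniteDimensional ℂ E] [FiniteDimensional ℂ F]
    (hU : IsOpen U) (hg : DifferentiableOn ℂ g U) {z : E} (hz : z ∈ U) :
    HasStrictFDerivAt g (fderiv ℂ g z) z := by
  refine hasStrictFDerivAt_of_hasFDerivAt_of_continuousAt (f' := fderiv ℂ g) ?_
    ((continuousOn_fderiv hU hg).continuousAt (hU.mem_nhds hz))
  filter_upwards [hU.mem_nhds hz] with w hw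
  exact (hg.differentiableAt (hU.mem_nhds hw)).hasFDerivAt

theorem differentiableOn_det_fderiv [FiniteDimensional ℂ E] {g : E → E}
    (hU : IsOpen U) (hg : DifferentiableOn ℂ g U) :
    DifferentiableOn ℂ (fun z => LinearMap.det (fderiv ℂ g z : E →ₗ[ℂ] E)) U := by
  set b := Module.finBasis ℂ E
  have : ∀ z, LinearMap.det (fderiv ℂ g z : E →ₗ[ℂ] E) =
      ∑ σ : Equiv.Perm (Fin (Module.finrank ℂ E)), ((Equiv.Perm.sign σ : ℤ) : ℂ) *
        ∏ i, b.coord (σ i) (fderiv ℂ g z (b i)) := by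
    intro z
    rw [← LinearMap.det_toMatrix b, Matrix.det_apply']
    simp [LinearMap.toMatrix_apply]
  simp_rw [this]
  refine DifferentiableOn.fun_sum fun σ _ => DifferentiableOn.const_mul ?_ _
  have hfac : ∀ i, DifferentiableOn ℂ (fun z => b.coord (σ i) (fderiv ℂ g z (b i))) U := fun i =>
    ((b.coord (σ i)).toContinuousLinearMap.differentiable.comp_differentiableOn
    (differentiableOn_fderiv_apply hU hg (b i)))
  intro z hz
  exact (HasFDerivWithinAt.finsetProd fun i _ => (hfac i z hz).hasFDerivWithinAt).differentiableWithinAt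

/-- Identity theorem on connected open sets. -/
theorem eqOn_of_eventuallyEq {f g : E → F} [CompleteSpace F] (hU : IsOpen U)
    (hc : IsPreconnected U)
    (hf : DifferentiableOn ℂ f U) (hg : DifferentiableOn ℂ g U) {z₀ : E} (hz₀ : z₀ ∈ U)
    (h : f =ᶠ[𝓝 z₀] g) : EqOn f g U := by
  set W : Set E := {z | f =ᶠ[𝓝 z] g}
  have hWo : IsOpen W := isOpen_setOfPred_eventually_nhds
  suffices U ⊆ W from fun z hz => (this hz).self_of_nhds
  refine hc.subset_of_closure_inter_subset hWo ⟨z₀, hz₀, h⟩ ?_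
  rintro z ⟨hzc, hzU⟩
  obtain ⟨ε, hε, hb⟩ := Metric.isOpen_iff.1 hU z hzU
  obtain ⟨w, hwW, hw⟩ := Metric.mem_closure_iff.1 hzc (ε / 3) (by positivity)
  have hwb : ball w (2 * ε / 3) ⊆ U := (ball_subset_ball' (by rw [dist_comm] at hw; linarith)).trans hb
  have key : EqOn f g (ball w (2 * ε / 3)) := by
    intro x hx
    set γ : ℂ → E := fun ξ => w + ξ • (x - w)
    have hγ : Differentiable ℂ γ := (differentiable_id.smul_const (x - w)).const_add w
    have hxw : ‖x - w‖ < 2 * ε / 3 := by rw [← dist_eq_norm]; exact hx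
    obtain ⟨ρ, hρ1, hρ⟩ : ∃ ρ : ℝ, 1 < ρ ∧ ρ * ‖x - w‖ < 2 * ε / 3 := by
      have : Tendsto (fun ρ : ℝ => ρ * ‖x - w‖) (𝓝[>] 1) (𝓝 (1 * ‖x - w‖)) :=
        ((continuous_id.mul continuous_const).tendsto 1).mono_left nhdsWithin_le_nhds
      rw [one_mul] at this
      obtain ⟨ρ, h1, h2⟩ := ((this.eventually_lt_const hxw).and self_mem_nhdsWithin).exists
      exact ⟨ρ, h2, h1⟩
    have hmaps : MapsTo γ (ball 0 ρ) U := by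
      intro ξ hξ
      apply hwb
      simp only [γ, mem_ball, dist_self_add_left, norm_smul]
      have : ‖ξ‖ ≤ ρ := by simpa using (mem_ball.1 hξ).le
      calc _ ≤ ρ * ‖x - w‖ := by gcongr
        _ < _ := hρ
    have hfa : AnalyticOnNhd ℂ (f ∘ γ) (ball 0 ρ) :=
      (hf.comp hγ.differentiableOn hmaps).analyticOnNhd isOpen_ball
    have hga : AnalyticOnNhd ℂ (g ∘ γ) (ball 0 ρ) :=
      (hg.comp hγ.differentiableOn hmaps).analyticOnNhd isOpen_ball
    have he : f ∘ γ =ᶠ[𝓝 0] g ∘ γ := by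
      have : Tendsto γ (𝓝 0) (𝓝 w) := by simpa [γ] using hγ.continuous.tendsto 0
      exact this.eventually hwW
    have := hfa.eqOn_of_preconnected_of_eventuallyEq hga (convex_ball _ _).isPreconnected
      (mem_ball_self (by linarith)) he (show (1 : ℂ) ∈ ball 0 ρ by simpa using hρ1)
    simpa [γ] using this
  exact (key.eventuallyEq_of_mem (isOpen_ball.mem_nhds (by rw [mem_ball]; linarith)))

end SeveralVariables

section SeveralVariablesHurwitz

variable {E : Type*} [NormedAddCommGroup E] [NormedSpace ℂ E]
variable {ι : Type*} {l : Ultrafilter ι} {U : Set E}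

theorem eventually_forall_of_isCompact {X ι : Type*} [PseudoMetricSpace X] {l : Filter ι} {K : Set X}
    (hK : IsCompact K) {P : ι → X → Prop}
    (h : ∀ x ∈ K, ∃ ε > 0, ∀ᶠ j in l, ∀ w ∈ ball x ε, P j w) : ∀ᶠ j in l, ∀ w ∈ K, P j w := by
  choose! ε hε h' using h
  obtain ⟨t, ht, htU⟩ := hK.elim_nhds_subcover (fun x => ball x (ε x))
    (fun x hx => ball_mem_nhds x (hε x hx))
  have := (Filter.eventually_all_finset t).2 (fun x hx => h' x (ht x hx))
  filter_upwards [this] with j hj w hw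
  obtain ⟨y, hy, hyb⟩ := mem_iUnion₂.1 (htU hw)
  exact hj y hy w hyb

/-- Hurwitz in one variable. -/
theorem hurwitz_disc {h : ι → ℂ → ℂ} {k : ℂ → ℂ} {ρ : ℝ} (hρ : 0 < ρ)
    (hb : LocBdd (l : Filter ι) h (ball 0 ρ))
    (hlim : ∀ ξ ∈ ball (0 : ℂ) ρ, Tendsto (fun j => h j ξ) l (𝓝 (k ξ)))
    (hz : ∀ ξ ∈ ball (0 : ℂ) ρ, ∃ ε > 0, ∀ᶠ j in (l : Filter ι), ∀ w ∈ ball ξ ε, h j w ≠ 0)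
    {ξ₁ : ℂ} (hξ₁ : ξ₁ ∈ ball (0 : ℂ) ρ) (hk : k ξ₁ ≠ 0) : k 0 ≠ 0 := by
  have hkd : DifferentiableOn ℂ k (ball 0 ρ) := hb.differentiableOn_limit isOpen_ball hlim
  have hka := hkd.analyticOnNhd isOpen_ball
  have h0 : (0 : ℂ) ∈ ball (0 : ℂ) ρ := mem_ball_self hρ
  rcases (hka 0 h0).eventually_eq_zero_or_eventually_ne_zero with he | he
  · exact absurd (hka.eqOn_of_preconnected_of_eventuallyEq
      (analyticOnNhd_const (v := (0 : ℂ))) (convex_ball _ _).isPreconnected h0 he hξ₁) hk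
  obtain ⟨ε, hε, hεb⟩ := Metric.mem_nhdsWithin_iff.1 he
  obtain ⟨r, hr, hrε, hrρ⟩ : ∃ r > 0, r < ε ∧ r < ρ :=
    ⟨min ε ρ / 2, by positivity, by have := min_le_left ε ρ; have := lt_min hε hρ; linarith,
      by have := min_le_right ε ρ; have := lt_min hε hρ; linarith⟩
  have hsub : closedBall (0 : ℂ) r ⊆ ball 0 ρ := closedBall_subset_ball hrρ
  have hsph : IsCompact (sphere (0 : ℂ) r) := isCompact_sphere _ _
  have hne : (sphere (0 : ℂ) r).Nonempty := NormedSpace.sphere_nonempty.2 hr.le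
  obtain ⟨ξ₀, hξ₀, hmin⟩ := hsph.exists_isMinOn hne
    (hkd.continuousOn.norm.mono (sphere_subset_closedBall.trans hsub))
  have hc : 0 < ‖k ξ₀‖ := by
    refine norm_pos_iff.2 (hεb ⟨?_, ?_⟩)
    · rw [mem_sphere] at hξ₀; rw [mem_ball]; linarith
    · rintro rfl; simp at hξ₀; linarith
  -- eventually bounded below on the sphere
  have hlow : ∀ᶠ j in (l : Filter ι), ∀ ξ ∈ sphere (0 : ℂ) r, ‖k ξ₀‖ / 2 ≤ ‖h j ξ‖ := by
    by_contra hcon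
    rw [← Ultrafilter.eventually_not] at hcon
    have hch : ∀ j, ∃ ξ, ξ ∈ sphere (0 : ℂ) r ∧ ((¬ ∀ ξ ∈ sphere (0 : ℂ) r, ‖k ξ₀‖ / 2 ≤ ‖h j ξ‖) →
        ‖h j ξ‖ < ‖k ξ₀‖ / 2) := by
      intro j
      by_cases hj : ∀ ξ ∈ sphere (0 : ℂ) r, ‖k ξ₀‖ / 2 ≤ ‖h j ξ‖
      · exact ⟨ξ₀, hξ₀, fun h => absurd hj h⟩
      · have hj' := hj
        push Not at hj'
        obtain ⟨ξ, h1, h2⟩ := hj'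
        exact ⟨ξ, h1, fun _ => h2⟩
    choose x hx hx2 using hch
    obtain ⟨y, hy, hxy⟩ := hsph.ultrafilter_le_nhds (l.map x) (by
      rw [le_principal_iff]
      exact mem_map.2 (Eventually.of_forall hx))
    have hyρ := hsub (sphere_subset_closedBall hy)
    have ht := (hb.tendsto_comp (g := k) hyρ (hlim y hyρ) hxy).norm
    have := le_of_tendsto ht (hcon.mono fun j hj => (hx2 j hj).le)
    have := hmin hy
    simp only [mem_ofPred_eq] at this
    linarith
  have hcl : IsCompact (closedBall (0 : ℂ) r) := isCompact_closedBall _ _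
  -- eventually zero free and holomorphic near the closed ball
  have hev : ∀ᶠ j in (l : Filter ι), ∀ ξ ∈ closedBall (0 : ℂ) r, DifferentiableAt ℂ (h j) ξ ∧ h j ξ ≠ 0 := by
    have : ∀ ξ ∈ closedBall (0 : ℂ) r, ∃ ε > 0, ∀ᶠ j in (l : Filter ι), ∀ w ∈ ball ξ ε,
        DifferentiableAt ℂ (h j) w ∧ h j w ≠ 0 := by
      intro ξ hξ
      obtain ⟨ε₁, hε₁, M, h1⟩ := hb ξ (hsub hξ)
      obtain ⟨ε₂, hε₂, h2⟩ := hz ξ (hsub hξ)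
      refine ⟨min ε₁ ε₂, lt_min hε₁ hε₂, ?_⟩
      filter_upwards [h1, h2] with j hj1 hj2 w hw
      exact ⟨hj1.1.differentiableAt (isOpen_ball.mem_nhds (ball_subset_ball (min_le_left _ _) hw)),
        hj2 w (ball_subset_ball (min_le_right _ _) hw)⟩
    exact eventually_forall_of_isCompact hcl this
  have hfin : ∀ᶠ j in (l : Filter ι), ‖k ξ₀‖ / 2 ≤ ‖h j 0‖ := by
    filter_upwards [hlow, hev] with j hj1 hj2
    have hd : DiffContOnCl ℂ (fun ξ => (h j ξ)⁻¹) (ball 0 r) := by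
      refine DifferentiableOn.diffContOnCl ?_
      rw [closure_ball _ hr.ne']
      exact fun ξ hξ => ((hj2 ξ hξ).1.inv (hj2 ξ hξ).2).differentiableWithinAt
    have := Complex.norm_le_of_forall_mem_frontier_norm_le isBounded_ball hd (C := (‖k ξ₀‖ / 2)⁻¹)
      (fun ξ hξ => ?_) (subset_closure (mem_ball_self hr))
    · rw [norm_inv] at this
      exact (inv_le_inv₀ (norm_pos_iff.2 (hj2 0 (mem_closedBall_self hr.le)).2) (by positivity)).1 this
    · rw [frontier_ball _ hr.ne'] at hξ
      rw [norm_inv]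
      exact inv_anti₀ (by positivity) (hj1 ξ hξ)
  have := ge_of_tendsto (hlim 0 h0).norm hfin
  exact norm_pos_iff.1 (by linarith)

/-- Hurwitz on a connected open set. -/
theorem hurwitz {h : ι → E → ℂ} {k : E → ℂ} [FiniteDimensional ℂ E]
    (hU : IsOpen U) (hc : IsPreconnected U)
    (hb : LocBdd (l : Filter ι) h U)
    (hlim : ∀ ξ ∈ U, Tendsto (fun j => h j ξ) l (𝓝 (k ξ)))
    (hz : ∀ ξ ∈ U, ∃ ε > 0, ∀ᶠ j in (l : Filter ι), ∀ w ∈ ball ξ ε, h j w ≠ 0)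
    {z₁ : E} (hz₁ : z₁ ∈ U) (hk : k z₁ ≠ 0) : ∀ z ∈ U, k z ≠ 0 := by
  have hkd : DifferentiableOn ℂ k U := hb.differentiableOn_limit hU hlim
  obtain ⟨W, hWo, hW⟩ : ∃ W, IsOpen W ∧ U ∩ {z | k z ≠ 0} = W :=
    ⟨_, hkd.continuousOn.isOpen_inter_preimage hU (isOpen_ne (x := (0 : ℂ))), rfl⟩
  suffices U ⊆ W from fun z hzU => by have := this hzU; rw [← hW] at this; exact this.2
  refine hc.subset_of_closure_inter_subset hWo ⟨z₁, hz₁, by rw [← hW]; exact ⟨hz₁, hk⟩⟩ ?_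
  rintro z ⟨hzc, hzU⟩
  rw [← hW]
  refine ⟨hzU, ?_⟩
  obtain ⟨ε, hε, hεb⟩ := Metric.isOpen_iff.1 hU z hzU
  obtain ⟨w, hwW, hw⟩ := Metric.mem_closure_iff.1 hzc (ε / 2) (by positivity)
  rw [← hW] at hwW
  set γ : ℂ → E := fun ξ => z + ξ • (w - z) with hγdef
  have hγ : Differentiable ℂ γ := (differentiable_id.smul_const (w - z)).const_add z
  have hmaps : MapsTo γ (ball 0 2) U := by
    intro ξ hξ
    apply hεb
    simp only [γ, mem_ball, dist_self_add_left, norm_smul]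
    have h1 : ‖ξ‖ < 2 := by simpa using hξ
    have h2 : ‖w - z‖ < ε / 2 := by rw [← dist_eq_norm, dist_comm]; exact hw
    nlinarith [norm_nonneg ξ, norm_nonneg (w - z)]
  have hball : ∀ ξ ∈ ball (0 : ℂ) 2, ∀ δ > 0, ∃ δ' > 0, ∀ x ∈ ball ξ δ', γ x ∈ ball (γ ξ) δ := by
    intro ξ _ δ hδ
    obtain ⟨δ', h1, h2⟩ := Metric.continuous_iff.1 hγ.continuous ξ δ hδ
    exact ⟨δ', h1, fun x hx => h2 x hx⟩
  have := hurwitz_disc (l := l) (h := fun j => h j ∘ γ) (k := k ∘ γ) (ρ := 2) (by norm_num) ?_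
    (fun ξ hξ => hlim _ (hmaps hξ)) ?_ (ξ₁ := 1) (by simp) (by simpa [γ] using hwW.2)
  · simpa [γ] using this
  · intro ξ hξ
    obtain ⟨δ, hδ, M, hM⟩ := hb _ (hmaps hξ)
    obtain ⟨δ', hδ', h'⟩ := hball ξ hξ δ hδ
    exact ⟨δ', hδ', M, hM.mono fun j hj => ⟨hj.1.comp hγ.differentiableOn h', fun x hx => hj.2 _ (h' x hx)⟩⟩
  · intro ξ hξ
    obtain ⟨δ, hδ, hM⟩ := hz _ (hmaps hξ)
    obtain ⟨δ', hδ', h'⟩ := hball ξ hξ δ hδ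
    exact ⟨δ', hδ', hM.mono fun j hj x hx => hj _ (h' x hx)⟩

theorem LocBdd.det_fderiv [FiniteDimensional ℂ E] {g : ι → E → E} (hg : LocBdd (l : Filter ι) g U) :
    LocBdd (l : Filter ι) (fun j z => LinearMap.det (fderiv ℂ (g j) z : E →ₗ[ℂ] E)) U := by
  have : ProperSpace (E →L[ℂ] E) := FiniteDimensional.proper ℂ _
  intro z hz
  obtain ⟨ε, hε, M, hM⟩ := hg z hz
  obtain ⟨C, hC⟩ := (isCompact_closedBall (0 : E →L[ℂ] E) (2 * M / (ε / 2))).exists_bound_of_continuousOn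
    (f := fun A : E →L[ℂ] E => LinearMap.det (A : E →ₗ[ℂ] E))
    (ContinuousLinearMap.continuous_det).continuousOn
  refine ⟨ε / 2, by positivity, C, hM.mono fun j hj => ⟨?_, fun w hw => ?_⟩⟩
  · exact (differentiableOn_det_fderiv isOpen_ball hj.1).mono (ball_subset_ball (by linarith))
  · apply hC
    rw [mem_closedBall_zero_iff]
    have hs : ball w (ε / 2) ⊆ ball z ε := ball_subset_ball' (by have := mem_ball.1 hw; linarith)
    exact norm_fderiv_le_of_bound (by positivity) (hj.1.mono hs) fun x hx => hj.2 x (hs hx)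

/-- Cartan's theorem on limits: `g` is a limit of locally invertible maps and is
invertible somewhere, so it is open. -/
theorem limit_mapsTo_interior [FiniteDimensional ℂ E] {g : ι → E → E} {k : E → E} {V : Set E}
    (hU : IsOpen U) (hc : IsPreconnected U)
    (hb : LocBdd (l : Filter ι) g U)
    (hlim : ∀ ξ ∈ U, Tendsto (fun j => g j ξ) l (𝓝 (k ξ)))
    (hinv : ∀ ξ ∈ U, ∃ ε > 0, ∀ᶠ j in (l : Filter ι), ∀ w ∈ ball ξ ε,
      ∃ f : E → E, DifferentiableAt ℂ f (g j w) ∧ f ∘ g j =ᶠ[𝓝 w] id)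
    {z₁ : E} (hz₁ : z₁ ∈ U) (hk : ∃ f : E → E, DifferentiableAt ℂ f (k z₁) ∧ f ∘ k =ᶠ[𝓝 z₁] id)
    (hV : ∀ z ∈ U, k z ∈ closure V) : ∀ z ∈ U, k z ∈ interior (closure V) := by
  have hkd : DifferentiableOn ℂ k U := hb.differentiableOn_limit hU hlim
  have hdet : ∀ (g f : E → E) (w : E), DifferentiableAt ℂ g w → DifferentiableAt ℂ f (g w) →
      f ∘ g =ᶠ[𝓝 w] id → LinearMap.det (fderiv ℂ g w : E →ₗ[ℂ] E) ≠ 0 := by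
    intro g f w hg hf he
    have h1 := he.fderiv_eq (𝕜 := ℂ)
    rw [fderiv_comp w hf hg, fderiv_id] at h1
    have h2 : LinearMap.det ((fderiv ℂ f (g w) : E →ₗ[ℂ] E) ∘ₗ (fderiv ℂ g w : E →ₗ[ℂ] E)) = 1 := by
      rw [← ContinuousLinearMap.toLinearMap_comp, h1]; simp
    rw [LinearMap.det_comp] at h2
    exact right_ne_zero_of_mul_eq_one h2
  have hne : ∀ z ∈ U, LinearMap.det (fderiv ℂ k z : E →ₗ[ℂ] E) ≠ 0 := by
    refine hurwitz hU hc hb.det_fderiv (fun ξ hξ => ?_) ?_ hz₁ ?_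
    · exact (ContinuousLinearMap.continuous_det.tendsto _).comp (hb.tendsto_fderiv hU hlim hξ)
    · intro ξ hξ
      obtain ⟨ε₁, hε₁, h1⟩ := hinv ξ hξ
      obtain ⟨ε₂, hε₂, M, h2⟩ := hb ξ hξ
      refine ⟨min ε₁ ε₂, lt_min hε₁ hε₂, ?_⟩
      filter_upwards [h1, h2] with j hj1 hj2 w hw
      obtain ⟨f, hf1, hf2⟩ := hj1 w (ball_subset_ball (min_le_left _ _) hw)
      exact hdet _ f w (hj2.1.differentiableAt
        (isOpen_ball.mem_nhds (ball_subset_ball (min_le_right _ _) hw))) hf1 hf2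
    · obtain ⟨f, hf1, hf2⟩ := hk
      exact hdet _ f _ (hkd.differentiableAt (hU.mem_nhds hz₁)) hf1 hf2
  intro z hz
  have : CompleteSpace E := FiniteDimensional.complete ℂ E
  have hsurj : ((fderiv ℂ k z : E →L[ℂ] E) : E →ₗ[ℂ] E).range = ⊤ :=
    LinearMap.range_eq_top.2
      (LinearEquiv.ofIsUnitDet (v := Module.finBasis ℂ E) (v' := Module.finBasis ℂ E)
        (f := (fderiv ℂ k z : E →ₗ[ℂ] E)) (by
          rw [LinearMap.det_toMatrix]; exact (hne z hz).isUnit)).surjective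
  have hmap := (hasStrictFDerivAt_of_differentiableOn hU hkd hz).map_nhds_eq_of_surj hsurj
  rw [mem_interior_iff_mem_nhds, ← hmap]
  exact mem_map.2 (Filter.mem_of_superset (hU.mem_nhds hz) hV)

end SeveralVariablesHurwitz

section CartanLimits

variable {E : Type*} [NormedAddCommGroup E] [NormedSpace ℂ E]
variable {ι : Type*} {l : Ultrafilter ι} {Ω₁ Ω₂ : Set E}

theorem limit_leftInverse {f g : ι → E → E} {φ γ : E → E}
    (hg : LocBdd (l : Filter ι) g Ω₂)
    (hφ : ∀ z ∈ Ω₁, Tendsto (fun j => f j z) l (𝓝 (φ z)))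
    (hγ : ∀ z ∈ Ω₂, Tendsto (fun j => g j z) l (𝓝 (γ z)))
    (hgf : ∀ z ∈ Ω₁, ∃ ε > 0, ∀ᶠ j in (l : Filter ι), ∀ w ∈ ball z ε,
      DifferentiableAt ℂ (g j) (f j w) ∧ g j (f j w) = w)
    {z : E} (hz : z ∈ Ω₁) (hz2 : φ z ∈ Ω₂) : γ (φ z) = z := by
  have h1 := hg.tendsto_comp (g := γ) hz2 (hγ _ hz2) (hφ z hz)
  obtain ⟨ε, hε, h⟩ := hgf z hz
  refine tendsto_nhds_unique h1 (tendsto_const_nhds.congr' ?_)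
  filter_upwards [h] with j hj using ((hj z (mem_ball_self hε)).2).symm

variable [FiniteDimensional ℂ E]

theorem limit_mapsTo {f g : ι → E → E} {φ γ : E → E}
    (h1o : IsOpen Ω₁) (h1c : IsPreconnected Ω₁) (h2o : IsOpen Ω₂)
    (h2i : interior (closure Ω₂) ⊆ Ω₂)
    (hf : LocBdd (l : Filter ι) f Ω₁) (hg : LocBdd (l : Filter ι) g Ω₂)
    (hφ : ∀ z ∈ Ω₁, Tendsto (fun j => f j z) l (𝓝 (φ z)))
    (hγ : ∀ z ∈ Ω₂, Tendsto (fun j => g j z) l (𝓝 (γ z)))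
    (hφc : ∀ z ∈ Ω₁, φ z ∈ closure Ω₂)
    (hgf : ∀ z ∈ Ω₁, ∃ ε > 0, ∀ᶠ j in (l : Filter ι), ∀ w ∈ ball z ε,
      DifferentiableAt ℂ (g j) (f j w) ∧ g j (f j w) = w)
    {o : E} (ho : o ∈ Ω₁) (ho2 : φ o ∈ Ω₂) : MapsTo φ Ω₁ Ω₂ := by
  intro z hz
  apply h2i
  refine limit_mapsTo_interior h1o h1c hf hφ ?_ ho ⟨γ, ?_, ?_⟩ hφc z hz
  · intro ξ hξ
    obtain ⟨ε, hε, h⟩ := hgf ξ hξ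
    refine ⟨ε, hε, h.mono fun j hj w hw => ⟨g j, (hj w hw).1, ?_⟩⟩
    filter_upwards [isOpen_ball.mem_nhds hw] with x hx using (hj x hx).2
  · exact (hg.differentiableOn_limit h2o hγ).differentiableAt (h2o.mem_nhds ho2)
  · have hc := ((hf.differentiableOn_limit h1o hφ).differentiableAt (h1o.mem_nhds ho)).continuousAt
    filter_upwards [h1o.mem_nhds ho, hc (h2o.mem_nhds ho2)] with x hx1 hx2
    exact limit_leftInverse hg hφ hγ hgf hx1 hx2

/-- Cartan's theorem on limits of biholomorphisms. -/
theorem cartan_limit {f g : ι → E → E} {φ γ : E → E}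
    (h1o : IsOpen Ω₁) (h1c : IsPreconnected Ω₁) (h1i : interior (closure Ω₁) ⊆ Ω₁)
    (h2o : IsOpen Ω₂) (h2c : IsPreconnected Ω₂) (h2i : interior (closure Ω₂) ⊆ Ω₂)
    (hf : LocBdd (l : Filter ι) f Ω₁) (hg : LocBdd (l : Filter ι) g Ω₂)
    (hφ : ∀ z ∈ Ω₁, Tendsto (fun j => f j z) l (𝓝 (φ z)))
    (hγ : ∀ z ∈ Ω₂, Tendsto (fun j => g j z) l (𝓝 (γ z)))
    (hφc : ∀ z ∈ Ω₁, φ z ∈ closure Ω₂) (hγc : ∀ z ∈ Ω₂, γ z ∈ closure Ω₁)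
    (hgf : ∀ z ∈ Ω₁, ∃ ε > 0, ∀ᶠ j in (l : Filter ι), ∀ w ∈ ball z ε,
      DifferentiableAt ℂ (g j) (f j w) ∧ g j (f j w) = w)
    (hfg : ∀ z ∈ Ω₂, ∃ ε > 0, ∀ᶠ j in (l : Filter ι), ∀ w ∈ ball z ε,
      DifferentiableAt ℂ (f j) (g j w) ∧ f j (g j w) = w)
    {o : E} (ho : o ∈ Ω₁) (ho2 : φ o ∈ Ω₂) :
    DifferentiableOn ℂ φ Ω₁ ∧ DifferentiableOn ℂ γ Ω₂ ∧ MapsTo φ Ω₁ Ω₂ ∧ MapsTo γ Ω₂ Ω₁ ∧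
      (∀ z ∈ Ω₁, γ (φ z) = z) ∧ ∀ z ∈ Ω₂, φ (γ z) = z := by
  have hm1 := limit_mapsTo h1o h1c h2o h2i hf hg hφ hγ hφc hgf ho ho2
  have hoo := limit_leftInverse hg hφ hγ hgf ho ho2
  have hm2 := limit_mapsTo h2o h2c h1o h1i hg hf hγ hφ hγc hfg ho2 (by rwa [hoo])
  exact ⟨hf.differentiableOn_limit h1o hφ, hg.differentiableOn_limit h2o hγ, hm1, hm2,
    fun z hz => limit_leftInverse hg hφ hγ hgf hz (hm1 hz),
    fun z hz => limit_leftInverse hf hγ hφ hfg hz (hm2 hz)⟩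

end CartanLimits

/-- Cartan: automorphisms of the ball fixing the origin are linear isometries. -/
theorem exists_linearIsometry_of_ball_automorphism {E : Type*} [NormedAddCommGroup E]
    [NormedSpace ℂ E] [StrictConvexSpace ℝ E] {g h : E → E}
    (hg : DifferentiableOn ℂ g (ball 0 1)) (hgm : MapsTo g (ball 0 1) (ball 0 1))
    (hh : DifferentiableOn ℂ h (ball 0 1)) (hhm : MapsTo h (ball 0 1) (ball 0 1))
    (hhg : ∀ u ∈ ball (0 : E) 1, h (g u) = u) (h0 : g 0 = 0) :
    ∃ U : E →ₗᵢ[ℂ] E, ∀ u ∈ ball (0 : E) 1, g u = U u := by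
  have hh0 : h 0 = 0 := by
    have := hhg 0 (mem_ball_self one_pos)
    rwa [h0] at this
  have hnorm : ∀ u ∈ ball (0 : E) 1, ‖g u‖ = ‖u‖ := by
    intro u hu
    refine le_antisymm ?_ ?_
    · exact Complex.norm_le_norm_of_mapsTo_ball hg (hgm.mono_right ball_subset_closedBall) h0
        (by simpa using hu)
    · have := Complex.norm_le_norm_of_mapsTo_ball hh (hhm.mono_right ball_subset_closedBall) hh0
        (z := g u) (by simpa using hgm hu)
      rwa [hhg u hu] at this
  set L := fderiv ℂ g 0 with hL
  have hgd : HasFDerivAt g L 0 :=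
    (hg.differentiableAt (isOpen_ball.mem_nhds (mem_ball_self one_pos))).hasFDerivAt
  have hlin : ∀ u ∈ ball (0 : E) 1, g u = L u := by
    intro u hu
    by_cases hu0 : u = 0
    · simp [hu0, h0]
    have hun : 0 < ‖u‖ := norm_pos_iff.2 hu0
    have hu1 : ‖u‖ < 1 := by simpa using hu
    set γ : ℂ → E := fun ξ => ξ • u with hγ
    have hγd : ∀ ξ, HasDerivAt γ u ξ := fun ξ => by simpa using (hasDerivAt_id ξ).smul_const u
    have hmem : MapsTo γ (ball 0 (1 / ‖u‖)) (ball 0 1) := by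
      intro ξ hξ
      simp only [γ, mem_ball, dist_zero_right, norm_smul] at hξ ⊢
      rwa [lt_div_iff₀ hun] at hξ
    have hd : DifferentiableOn ℂ (g ∘ γ) (ball 0 (1 / ‖u‖)) :=
      hg.comp (fun ξ _ => (hγd ξ).differentiableAt.differentiableWithinAt) hmem
    have h1m : (1 : ℂ) ∈ ball (0 : ℂ) (1 / ‖u‖) := by
      simp only [mem_ball, dist_zero_right, norm_one]
      rw [lt_div_iff₀ hun]; linarith
    have hds : dslope (g ∘ γ) 0 1 = g u := by
      rw [dslope_of_ne _ one_ne_zero, slope_def_module]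
      simp [γ, h0]
    have haff := Complex.affine_of_mapsTo_ball_of_norm_dslope_eq_div (f := g ∘ γ) (c := 0) (R₂ := 1)
      (z₀ := 1) hd (fun ξ hξ => ?_) h1m ?_
    · have he : g ∘ γ =ᶠ[𝓝 0] fun ξ => ξ • g u := by
        filter_upwards [isOpen_ball.mem_nhds (mem_ball_self (x := (0 : ℂ)) (ε := 1 / ‖u‖)
          (by positivity))] with ξ hξ
        rw [haff hξ, hds]
        simp [γ, h0]
      have hd1 : HasDerivAt (g ∘ γ) (L u) 0 := by
        have : HasFDerivAt g L (γ 0) := by simpa [γ] using hgd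
        exact this.comp_hasDerivAt 0 (hγd 0)
      have hd2 : HasDerivAt (fun ξ : ℂ => ξ • g u) (g u) 0 := by
        simpa using (hasDerivAt_id (0 : ℂ)).smul_const (g u)
      exact ((hd2.congr_of_eventuallyEq he).unique hd1)
    · have := hgm (hmem hξ)
      have h00 : (g ∘ γ) 0 = 0 := by simp [γ, h0]
      rw [h00]
      exact ball_subset_closedBall this
    · rw [hds, hnorm u hu]; field_simp
  have hLn : ∀ u, ‖L u‖ = ‖u‖ := by
    intro u
    have hpos : 0 < ‖u‖ + 1 := by positivity
    set c : ℂ := ((‖u‖ + 1 : ℝ) : ℂ)⁻¹ with hc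
    have hcn : ‖c‖ = (‖u‖ + 1)⁻¹ := by
      rw [hc, norm_inv, Complex.norm_real, Real.norm_of_nonneg hpos.le]
    have hmem : c • u ∈ ball (0 : E) 1 := by
      rw [mem_ball_zero_iff, norm_smul, hcn, inv_mul_lt_one₀ hpos]; linarith
    have := hnorm _ hmem
    rw [hlin _ hmem, map_smul, norm_smul, norm_smul] at this
    exact mul_left_cancel₀ (by rw [hcn]; positivity) this
  exact ⟨⟨L, hLn⟩, fun u hu => hlin u hu⟩

theorem normSq_add_conj_eq (a b : ℂ) :
    normSq (a + (starRingEnd ℂ) b) = normSq (a - b) + 4 * (a.re * b.re) := by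
  simp [normSq_apply]; ring

/-- Schwarz–Pick inequality for the right half plane. -/
theorem halfPlane_schwarz_pick {h : ℂ → ℂ} (hd : DifferentiableOn ℂ h {ξ | 0 < ξ.re})
    (hm : ∀ ξ : ℂ, 0 < ξ.re → 0 < (h ξ).re) {a b : ℂ} (ha : 0 < a.re) (hb : 0 < b.re) :
    normSq (h a - h b) * (a.re * b.re) ≤ normSq (a - b) * ((h a).re * (h b).re) := by
  set ψ : ℂ → ℂ := fun ξ => (b + ξ * (starRingEnd ℂ) b) / (1 - ξ) with hψ
  set k : ℂ → ℂ := fun ξ => (h (ψ ξ) - h b) / (h (ψ ξ) + (starRingEnd ℂ) (h b)) with hk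
  have hne1 : ∀ ξ ∈ ball (0 : ℂ) 1, 1 - ξ ≠ 0 := by
    intro ξ hξ h0
    rw [sub_eq_zero] at h0
    rw [← h0] at hξ
    simp at hξ
  have hψre : ∀ ξ ∈ ball (0 : ℂ) 1, 0 < (ψ ξ).re := by
    intro ξ hξ
    have h1 : normSq ξ < 1 := by
      rw [normSq_eq_norm_sq]
      have : ‖ξ‖ < 1 := by simpa using hξ
      nlinarith [norm_nonneg ξ]
    have h2 : 0 < normSq (1 - ξ) := normSq_pos.2 (hne1 ξ hξ)
    have : (ψ ξ).re = b.re * (1 - normSq ξ) / normSq (1 - ξ) := by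
      rw [hψ]
      simp only [div_re]
      field_simp
      simp [normSq_apply]; ring
    rw [this]
    have : 0 < 1 - normSq ξ := by linarith
    positivity
  have hden : ∀ w : ℂ, 0 < w.re → w + (starRingEnd ℂ) (h b) ≠ 0 := by
    intro w hw h0
    have := congrArg Complex.re h0
    simp at this
    linarith [hm b hb]
  have hkd : DifferentiableOn ℂ k (ball 0 1) := by
    have hψd : DifferentiableOn ℂ ψ (ball 0 1) := by
      intro ξ hξ
      refine (DifferentiableAt.div ?_ ?_ (hne1 ξ hξ)).differentiableWithinAt <;> fun_prop
    have hc : DifferentiableOn ℂ (fun ξ => h (ψ ξ)) (ball 0 1) := hd.comp hψd hψre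
    exact (hc.sub_const _).div (hc.add_const _) fun ξ hξ => hden _ (hm _ (hψre ξ hξ))
  have hψ0 : ψ 0 = b := by simp [hψ]
  have hk0 : k 0 = 0 := by simp [hk, hψ0]
  have hkm : MapsTo k (ball 0 1) (closedBall 0 1) := by
    intro ξ hξ
    rw [mem_closedBall_zero_iff, hk]
    simp only [norm_div]
    have hp : 0 < (h (ψ ξ)).re * (h b).re := mul_pos (hm _ (hψre ξ hξ)) (hm b hb)
    refine div_le_one_of_le₀ ?_ (norm_nonneg _)
    refine le_of_sq_le_sq ?_ (norm_nonneg _)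
    rw [← normSq_eq_norm_sq, ← normSq_eq_norm_sq, normSq_add_conj_eq]
    linarith
  have hab : a + (starRingEnd ℂ) b ≠ 0 := by
    intro h0
    have := congrArg Complex.re h0
    simp at this
    linarith
  set ξ₀ : ℂ := (a - b) / (a + (starRingEnd ℂ) b) with hξ₀
  have hQ : 0 < a.re * b.re := mul_pos ha hb
  have hP : 0 < (h a).re * (h b).re := mul_pos (hm a ha) (hm b hb)
  have hξ₀m : ξ₀ ∈ ball (0 : ℂ) 1 := by
    rw [mem_ball_zero_iff, hξ₀, norm_div, div_lt_one (norm_pos_iff.2 hab)]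
    refine lt_of_pow_lt_pow_left₀ 2 (norm_nonneg _) ?_
    rw [← normSq_eq_norm_sq, ← normSq_eq_norm_sq, normSq_add_conj_eq]
    linarith
  have hψa : ψ ξ₀ = a := by
    have := hne1 _ hξ₀m
    rw [hψ]
    simp only
    rw [div_eq_iff this, hξ₀]
    field_simp
    ring
  have key := Complex.norm_le_norm_of_mapsTo_ball hkd hkm hk0 (z := ξ₀) (by simpa using hξ₀m)
  have hkey : ‖h a - h b‖ * ‖a + (starRingEnd ℂ) b‖ ≤ ‖a - b‖ * ‖h a + (starRingEnd ℂ) (h b)‖ := by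
    rw [hk] at key
    simp only [hψa, norm_div] at key
    rw [hξ₀, norm_div] at key
    rwa [div_le_div_iff₀ (norm_pos_iff.2 (hden _ (hm a ha))) (norm_pos_iff.2 hab)] at key
  have hsq := pow_le_pow_left₀ (by positivity) hkey 2
  rw [mul_pow, mul_pow, ← normSq_eq_norm_sq, ← normSq_eq_norm_sq, ← normSq_eq_norm_sq,
    ← normSq_eq_norm_sq, normSq_add_conj_eq, normSq_add_conj_eq] at hsq
  linarith

/-- A form of Julia's lemma at infinity. -/
theorem halfPlane_julia {h : ℂ → ℂ} (hd : DifferentiableOn ℂ h {ξ | 0 < ξ.re})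
    (hm : ∀ ξ : ℂ, 0 < ξ.re → 0 < (h ξ).re)
    (hlim : Tendsto (fun x : ℝ => h x / x) atTop (𝓝 1)) {a : ℂ} (ha : 0 < a.re) :
    a.re ≤ (h a).re := by
  have hinv : Tendsto (fun x : ℝ => ((x : ℂ))⁻¹) atTop (𝓝 0) := by
    have := tendsto_inv_atTop_zero (𝕜 := ℝ)
    have h2 := (continuous_ofReal.tendsto 0).comp this
    simpa [Function.comp_def] using h2
  have h1 : Tendsto (fun x : ℝ => normSq (h a * (x : ℂ)⁻¹ - h x / x) * a.re) atTop
      (𝓝 (normSq (h a * 0 - 1) * a.re)) :=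
    ((continuous_normSq.tendsto _).comp ((hinv.const_mul _).sub hlim)).mul_const _
  have h2 : Tendsto (fun x : ℝ => normSq (a * (x : ℂ)⁻¹ - 1) * ((h a).re * (h x / x).re)) atTop
      (𝓝 (normSq (a * 0 - 1) * ((h a).re * (1 : ℂ).re))) :=
    ((continuous_normSq.tendsto _).comp ((hinv.const_mul _).sub_const _)).mul
      (((continuous_re.tendsto _).comp hlim).const_mul _)
  have := le_of_tendsto_of_tendsto h1 h2 ?_
  · simpa using this
  · filter_upwards [eventually_gt_atTop (0 : ℝ)] with x hx
    have hxc : (x : ℂ) ≠ 0 := by exact_mod_cast hx.ne'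
    have key := halfPlane_schwarz_pick hd hm ha (b := x) (by simpa using hx)
    have e1 : h a * (x : ℂ)⁻¹ - h x / x = (h a - h x) * (x : ℂ)⁻¹ := by ring
    have e2 : a * (x : ℂ)⁻¹ - 1 = (a - x) * (x : ℂ)⁻¹ := by field_simp
    have e3 : (h x / x).re = (h x).re / x := by simp
    rw [e1, e2, e3, map_mul, map_mul, normSq_inv, normSq_ofReal]
    simp only [ofReal_re] at key
    have : 0 < x * x * x := by positivity
    calc normSq (h a - h x) * (x * x)⁻¹ * a.re = (normSq (h a - h x) * (a.re * x)) / (x * x * x) := by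
          field_simp
      _ ≤ (normSq (a - x) * ((h a).re * (h x).re)) / (x * x * x) := by gcongr
      _ = _ := by field_simp

/-- Growth bound along the positive reals. -/
theorem halfPlane_growth {h : ℂ → ℂ} (hd : DifferentiableOn ℂ h {ξ | 0 < ξ.re})
    (hm : ∀ ξ : ℂ, 0 < ξ.re → 0 ≤ (h ξ).re) {x y : ℝ} (hy : 0 < y) (hxy : y < x) :
    ‖h x - h y‖ ≤ (x / y - 1) * (h y).re := by
  have hx : 0 < x := hy.trans hxy
  have key : ∀ ε > 0, ‖h x - h y‖ ≤ (x / y - 1) * ((h y).re + ε) := by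
    intro ε hε
    have h1 := halfPlane_schwarz_pick (h := fun ξ => h ξ + ε) (hd.add_const _)
      (fun ξ hξ => by have := hm ξ hξ; simp; linarith) (a := x) (b := y) (by simpa) (by simpa)
    simp only [add_sub_add_right_eq_sub, add_re, ofReal_re, ← ofReal_sub, normSq_ofReal] at h1
    rw [normSq_eq_norm_sq] at h1
    set D := ‖h x - h y‖
    have hD : 0 ≤ D := norm_nonneg _
    set B := (h y).re + ε
    have hB : 0 < B := by have := hm y (by simpa); simp only [B]; linarith
    have hAB : (h x).re + ε ≤ B + D := by
      have := Complex.re_le_norm (h x - h y)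
      simp at this
      simp only [B, D]; linarith
    set τ := x / y - 1 with hτ
    have hτ0 : 0 < τ := by rw [hτ, sub_pos, lt_div_iff₀ hy]; linarith
    have hxτ : x = y * (1 + τ) := by rw [hτ]; field_simp; ring
    rw [hxτ] at h1
    have h2 : D ^ 2 * (1 + τ) ≤ τ ^ 2 * ((B + D) * B) := by
      have h3 : D ^ 2 * (y * (1 + τ) * y) ≤ (y * (1 + τ) - y) * (y * (1 + τ) - y) * ((B + D) * B) := by
        refine h1.trans ?_
        rw [← hxτ]
        have : 0 ≤ (x - y) * (x - y) := mul_self_nonneg _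
        gcongr
      have h4 : 0 < y * y := by positivity
      refine le_of_mul_le_mul_left ?_ h4
      nlinarith
    by_contra hcon
    push Not at hcon
    have h5 : 0 < (D - τ * B) * (D + τ * B + τ * D) := by
      apply mul_pos (by linarith)
      have : 0 < τ * B := by positivity
      have : 0 ≤ τ * D := by positivity
      linarith
    nlinarith
  have ht : Tendsto (fun ε : ℝ => (x / y - 1) * ((h y).re + ε)) (𝓝[>] 0)
      (𝓝 ((x / y - 1) * ((h y).re + 0))) :=
    ((continuous_const.mul (continuous_const.add continuous_id)).tendsto 0).mono_left
      nhdsWithin_le_nhds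
  rw [add_zero] at ht
  exact ge_of_tendsto ht (by filter_upwards [self_mem_nhdsWithin] with ε hε using key ε hε)

section Coordinates

variable {m : ℕ}

/-- The first unit vector. -/
def e0 : En (m + 1) := EuclideanSpace.single 0 1

/-- The first coordinate. -/
def c0 : En (m + 1) →L[ℂ] ℂ := EuclideanSpace.proj 0

/-- The projection killing the first coordinate. -/
def tl : En (m + 1) →L[ℂ] En (m + 1) :=
  ContinuousLinearMap.id ℂ _ - (c0 : En (m + 1) →L[ℂ] ℂ).smulRight e0

theorem tl_apply (v : En (m + 1)) : tl v = v - c0 v • e0 := rfl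

@[simp] theorem c0_e0 : c0 (e0 : En (m + 1)) = 1 := by simp [c0, e0]

@[simp] theorem c0_tl (v : En (m + 1)) : c0 (tl v) = 0 := by simp [tl_apply]

@[simp] theorem tl_e0 : tl (e0 : En (m + 1)) = 0 := by simp [tl_apply]

@[simp] theorem tl_tl (v : En (m + 1)) : tl (tl v) = tl v := by rw [tl_apply (tl v)]; simp

theorem c0_smul_add_tl (v : En (m + 1)) : c0 v • e0 + tl v = v := by simp [tl_apply]

@[simp] theorem norm_e0 : ‖(e0 : En (m + 1))‖ = 1 := by simp [e0]

theorem norm_smul_e0_add_sq (c : ℂ) (v : En (m + 1)) :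
    ‖c • e0 + tl v‖ ^ 2 = ‖c‖ ^ 2 + ‖tl v‖ ^ 2 := by
  have h : inner ℂ (c • (e0 : En (m + 1))) (tl v) = 0 := by
    have : inner ℂ (e0 : En (m + 1)) (tl v) = c0 (tl v) := by
      simp [e0, c0, EuclideanSpace.inner_single_left]
    rw [inner_smul_left, this]; simp
  have := norm_add_sq_eq_norm_sq_add_norm_sq_of_inner_eq_zero _ _ h
  rw [norm_smul, norm_e0, mul_one] at this
  nlinarith

theorem norm_sq_eq (v : En (m + 1)) : ‖v‖ ^ 2 = ‖c0 v‖ ^ 2 + ‖tl v‖ ^ 2 := by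
  conv_lhs => rw [← c0_smul_add_tl v]
  exact norm_smul_e0_add_sq _ _

theorem norm_tl_le (v : En (m + 1)) : ‖tl v‖ ≤ ‖v‖ := by
  refine le_of_sq_le_sq ?_ (norm_nonneg _)
  rw [norm_sq_eq v]; nlinarith [sq_nonneg ‖c0 v‖]

theorem norm_c0_le (v : En (m + 1)) : ‖c0 v‖ ≤ ‖v‖ := by
  refine le_of_sq_le_sq ?_ (norm_nonneg _)
  rw [norm_sq_eq v]; nlinarith [sq_nonneg ‖tl v‖]

theorem ext_c0_tl {v w : En (m + 1)} (h : c0 v = c0 w) (h' : tl v = tl w) : v = w := by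
  rw [← c0_smul_add_tl v, ← c0_smul_add_tl w, h, h']

/-- The Cayley transform from the Siegel domain to the ball. -/
def cay (w : En (m + 1)) : En (m + 1) :=
  ((c0 w - 1) / (c0 w + 1)) • e0 + (2 / (c0 w + 1)) • tl w

/-- The inverse Cayley transform. -/
def cayInv (u : En (m + 1)) : En (m + 1) :=
  ((1 + c0 u) / (1 - c0 u)) • e0 + (1 / (1 - c0 u)) • tl u

@[simp] theorem c0_cay (w : En (m + 1)) : c0 (cay w) = (c0 w - 1) / (c0 w + 1) := by simp [cay]

@[simp] theorem tl_cay (w : En (m + 1)) : tl (cay w) = (2 / (c0 w + 1)) • tl w := by simp [cay]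

@[simp] theorem c0_cayInv (u : En (m + 1)) : c0 (cayInv u) = (1 + c0 u) / (1 - c0 u) := by
  simp [cayInv]

@[simp] theorem tl_cayInv (u : En (m + 1)) : tl (cayInv u) = (1 / (1 - c0 u)) • tl u := by
  simp [cayInv]

theorem cayInv_cay {w : En (m + 1)} (h : c0 w + 1 ≠ 0) : cayInv (cay w) = w := by
  have h1 : 1 - (c0 w - 1) / (c0 w + 1) = 2 / (c0 w + 1) := by field_simp; ring
  refine ext_c0_tl ?_ ?_
  · rw [c0_cayInv, c0_cay, h1]; field_simp; ring
  · rw [tl_cayInv, c0_cay, h1, tl_cay, smul_smul]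
    field_simp; simp

theorem cay_cayInv {u : En (m + 1)} (h : 1 - c0 u ≠ 0) : cay (cayInv u) = u := by
  have h1 : (1 + c0 u) / (1 - c0 u) + 1 = 2 / (1 - c0 u) := by field_simp; ring
  refine ext_c0_tl ?_ ?_
  · rw [c0_cay, c0_cayInv, h1]; field_simp; ring
  · rw [tl_cay, c0_cayInv, h1, tl_cayInv, smul_smul]
    field_simp; simp

theorem one_sub_norm_cay_sq {w : En (m + 1)} (h : c0 w + 1 ≠ 0) :
    1 - ‖cay w‖ ^ 2 = 4 * ((c0 w).re - ‖tl w‖ ^ 2) / ‖c0 w + 1‖ ^ 2 := by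
  have hn : ‖c0 w + 1‖ ^ 2 ≠ 0 := by positivity
  rw [norm_sq_eq, c0_cay, tl_cay, norm_smul, norm_div, norm_div, mul_pow, div_pow, div_pow]
  have : ‖c0 w + 1‖ ^ 2 - ‖c0 w - 1‖ ^ 2 = 4 * (c0 w).re := by
    rw [← normSq_eq_norm_sq, ← normSq_eq_norm_sq]; simp [normSq_apply]; ring
  have h2 : ‖(2 : ℂ)‖ = 2 := by simp
  rw [h2]
  field_simp
  linarith

theorem siegel_cayInv {u : En (m + 1)} (h : 1 - c0 u ≠ 0) :
    (c0 (cayInv u)).re - ‖tl (cayInv u)‖ ^ 2 = (1 - ‖u‖ ^ 2) / ‖1 - c0 u‖ ^ 2 := by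
  have hn : ‖1 - c0 u‖ ^ 2 ≠ 0 := by positivity
  have h1 : ((1 + c0 u) / (1 - c0 u)).re = (1 - ‖c0 u‖ ^ 2) / ‖1 - c0 u‖ ^ 2 := by
    rw [← normSq_eq_norm_sq, ← normSq_eq_norm_sq, div_re]
    have : normSq (1 - c0 u) ≠ 0 := by rwa [normSq_eq_norm_sq]
    field_simp
    simp [normSq_apply]; ring
  rw [c0_cayInv, tl_cayInv, h1, norm_smul, norm_sq_eq u, norm_div, norm_one, mul_pow, div_pow]
  field_simp
  ring

theorem one_sub_c0_ne {u : En (m + 1)} {R : ℝ} (hR : R < 1) (hu : ‖u‖ ≤ R) : 1 - c0 u ≠ 0 := by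
  intro h
  have h1 := norm_c0_le u
  rw [← sub_eq_zero.1 h, norm_one] at h1
  linarith

theorem differentiableAt_cay {w : En (m + 1)} (h : c0 w + 1 ≠ 0) : DifferentiableAt ℂ cay w := by
  have h0 : DifferentiableAt ℂ (fun w : En (m + 1) => c0 w) w := c0.differentiableAt
  have h1 : DifferentiableAt ℂ (fun w : En (m + 1) => tl w) w := tl.differentiableAt
  unfold cay
  fun_prop (disch := assumption)

theorem differentiableAt_cayInv {u : En (m + 1)} (h : 1 - c0 u ≠ 0) :
    DifferentiableAt ℂ cayInv u := by
  have h0 : DifferentiableAt ℂ (fun w : En (m + 1) => c0 w) u := c0.differentiableAt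
  have h1 : DifferentiableAt ℂ (fun w : En (m + 1) => tl w) u := tl.differentiableAt
  unfold cayInv
  fun_prop (disch := assumption)

end Coordinates

section PerturbationOfIdentity

theorem injOn_of_close_to_id {E : Type*} [NormedAddCommGroup E] {N : E → E} {S : Set E}
    (h : ∀ v ∈ S, ∀ w ∈ S, ‖N v - N w - (v - w)‖ ≤ 1 / 2 * ‖v - w‖) : InjOn N S := by
  intro v hv w hw hvw
  have := h v hv w hw
  rw [hvw, sub_self, zero_sub, norm_neg] at this
  have h0 : ‖v - w‖ = 0 := by linarith [norm_nonneg (v - w)]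
  exact sub_eq_zero.1 (norm_eq_zero.1 h0)

variable {E : Type*} [NormedAddCommGroup E] [NormedSpace ℂ E] [FiniteDimensional ℂ E]

/-- Quantitative inverse function theorem for small perturbations of the identity. -/
theorem invFunOn_of_close_to_id {N : E → E} {η : ℝ} (hη : 0 < η) (hN0 : N 0 = 0)
    (hd : DifferentiableOn ℂ N (ball 0 η))
    (h : ∀ v ∈ ball (0 : E) η, ∀ w ∈ ball (0 : E) η, ‖N v - N w - (v - w)‖ ≤ 1 / 2 * ‖v - w‖) :
    DifferentiableOn ℂ (invFunOn N (ball 0 η)) (ball 0 (η / 4)) ∧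
    ∀ y ∈ ball (0 : E) (η / 4), invFunOn N (ball 0 η) y ∈ ball (0 : E) η ∧
      N (invFunOn N (ball 0 η) y) = y ∧ ‖invFunOn N (ball 0 η) y‖ ≤ 2 * ‖y‖ := by
  have : CompleteSpace E := FiniteDimensional.complete ℂ E
  have happ : ApproximatesLinearOn N ((ContinuousLinearEquiv.refl ℂ E : E ≃L[ℂ] E) : E →L[ℂ] E)
      (ball 0 η) (1 / 2) := by
    intro v hv w hw
    simpa using h v hv w hw
  have hlow : ∀ v ∈ ball (0 : E) η, ∀ w ∈ ball (0 : E) η, ‖v - w‖ ≤ 2 * ‖N v - N w‖ := by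
    intro v hv w hw
    have h1 := h v hv w hw
    have h2 := norm_sub_norm_le (v - w) (N v - N w)
    rw [norm_sub_rev (v - w)] at h2
    linarith
  have h0m : (0 : E) ∈ ball (0 : E) η := mem_ball_self hη
  have hsurj : ∀ y ∈ ball (0 : E) (η / 4), ∃ v ∈ ball (0 : E) η, N v = y := by
    intro y hy
    rcases subsingleton_or_nontrivial E with hE | hE
    · exact ⟨0, h0m, Subsingleton.elim _ _⟩
    have hcb : closedBall (0 : E) (η / 2) ⊆ ball 0 η := closedBall_subset_ball (by linarith)
    have hs := happ.surjOn_closedBall_of_nonlinearRightInverse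
      (ContinuousLinearEquiv.refl ℂ E).toNonlinearRightInverse (ε := η / 2) (b := 0)
      (by positivity) hcb
    have hy' : y ∈ closedBall (N 0) ((((ContinuousLinearEquiv.refl ℂ E).toNonlinearRightInverse.nnnorm :
        ℝ)⁻¹ - ((1 / 2 : NNReal) : ℝ)) * (η / 2)) := by
      rw [hN0, mem_closedBall_zero_iff]
      have hy1 : ‖y‖ < η / 4 := by simpa using hy
      have hn : ((ContinuousLinearEquiv.refl ℂ E).toNonlinearRightInverse.nnnorm : ℝ) ≤ 1 := by
        change ‖(ContinuousLinearEquiv.refl ℂ E).symm.toContinuousLinearMap‖ ≤ 1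
        exact ContinuousLinearMap.norm_id_le
      have hz : (0 : ℝ) < (ContinuousLinearEquiv.refl ℂ E).toNonlinearRightInverse.nnnorm := by
        change 0 < ‖ContinuousLinearMap.id ℂ E‖
        rw [ContinuousLinearMap.norm_id]
        exact one_pos
      have := (one_le_inv₀ hz).2 hn
      push_cast
      nlinarith
    obtain ⟨v, hv, hvy⟩ := hs hy'
    exact ⟨v, hcb hv, hvy⟩
  have hprop : ∀ y ∈ ball (0 : E) (η / 4), invFunOn N (ball 0 η) y ∈ ball (0 : E) η ∧
      N (invFunOn N (ball 0 η) y) = y ∧ ‖invFunOn N (ball 0 η) y‖ ≤ 2 * ‖y‖ := by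
    intro y hy
    obtain ⟨h1, h2⟩ := invFunOn_pos (hsurj y hy)
    refine ⟨h1, h2, ?_⟩
    have := hlow _ h1 0 h0m
    rwa [h2, hN0, sub_zero, sub_zero] at this
  refine ⟨fun y hy => ?_, hprop⟩
  set g := invFunOn N (ball 0 η) with hg
  obtain ⟨h1, h2, -⟩ := hprop y hy
  have hda : HasFDerivAt N (fderiv ℂ N (g y)) (g y) :=
    (hd.differentiableAt (isOpen_ball.mem_nhds h1)).hasFDerivAt
  have hcont : ContinuousAt g y := by
    rw [Metric.continuousAt_iff]
    intro ε hε
    obtain ⟨δ, hδ, hδb⟩ := Metric.isOpen_iff.1 isOpen_ball y hy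
    refine ⟨min δ (ε / 2), by positivity, fun {x} hx => ?_⟩
    have hxm := hδb (mem_ball.2 (lt_of_lt_of_le hx (min_le_left _ _)))
    obtain ⟨hx1, hx2, -⟩ := hprop x hxm
    have := hlow _ hx1 _ h1
    rw [hx2, h2, ← dist_eq_norm, ← dist_eq_norm] at this
    have := lt_of_lt_of_le hx (min_le_right _ _)
    linarith
  have hinj : Injective (fderiv ℂ N (g y)) := by
    rw [injective_iff_map_eq_zero]
    intro x hx
    have hle : ‖fderiv ℂ N (g y) - ContinuousLinearMap.id ℂ E‖ ≤ 1 / 2 := by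
      have hd2 : HasFDerivAt (fun v => N v - v) (fderiv ℂ N (g y) - ContinuousLinearMap.id ℂ E) (g y) :=
        hda.sub (hasFDerivAt_id _)
      have := hd2.le_of_lipschitzOn (C := 1 / 2) (isOpen_ball.mem_nhds h1)
        (LipschitzOnWith.of_dist_le_mul fun v hv w hw => by
          have := h v hv w hw
          rw [dist_eq_norm, dist_eq_norm]
          simpa [sub_sub_sub_comm] using this)
      simpa using this
    have := (fderiv ℂ N (g y) - ContinuousLinearMap.id ℂ E).le_of_opNorm_le hle x
    simp [hx] at this
    have h0 : ‖x‖ = 0 := by linarith [norm_nonneg x]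
    exact norm_eq_zero.1 h0
  set e : E ≃L[ℂ] E := (LinearEquiv.ofInjectiveEndo (fderiv ℂ N (g y) : E →ₗ[ℂ] E)
    hinj).toContinuousLinearEquiv with he
  have hee : (e : E →L[ℂ] E) = fderiv ℂ N (g y) := by ext x; rfl
  rw [← hee] at hda
  refine (HasFDerivAt.of_local_left_inverse hcont hda ?_).differentiableAt.differentiableWithinAt
  filter_upwards [isOpen_ball.mem_nhds hy] with x hx using (hprop x hx).2.1

end PerturbationOfIdentity

/-- Local data at the origin of a strongly pseudoconvex boundary point in normalized coordinates:
the second order expansion of a defining function `r` has Levi form `‖v‖ ^ 2`. -/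
structure NormData {m : ℕ} (Ω : Set (En (m + 1))) where
  r : En (m + 1) → ℝ
  a : En (m + 1) → (En (m + 1) →L[ℂ] ℂ)
  B : En (m + 1) →L[ℂ] En (m + 1) →L[ℂ] ℂ
  η₀ : ℝ
  η₀_pos : 0 < η₀
  r_zero : r 0 = 0
  mem_iff : ∀ z, ‖z‖ < η₀ → (z ∈ Ω ↔ r z < 0)
  a_zero : a 0 = c0
  taylor : ∀ ε > 0, ∃ η > 0, ∀ q v, ‖q‖ < η → ‖v‖ < η →
    |r (q + v) - r q + (a q v + B v v).re - ‖v‖ ^ 2| ≤ ε * ‖v‖ ^ 2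
  a_near : ∀ ε > 0, ∃ η > 0, ∀ q, ‖q‖ < η → ∀ v, ‖a q v - c0 v‖ ≤ ε * ‖v‖

namespace NormData

variable {m : ℕ} {Ω : Set (En (m + 1))} (D : NormData Ω)

/-- The polynomial change of coordinates at `q` removing the pluriharmonic quadratic terms. -/
def N (q v : En (m + 1)) : En (m + 1) := (D.a q v + D.B v v) • e0 + tl v

theorem c0_N (q v : En (m + 1)) : c0 (D.N q v) = D.a q v + D.B v v := by simp [N]

theorem tl_N (q v : En (m + 1)) : tl (D.N q v) = tl v := by simp [N]

theorem N_zero (q : En (m + 1)) : D.N q 0 = 0 := by simp [N]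

theorem norm_B_le (v w : En (m + 1)) : ‖D.B v w‖ ≤ ‖D.B‖ * ‖v‖ * ‖w‖ := D.B.le_opNorm₂ v w

theorem differentiable_N (q : En (m + 1)) : Differentiable ℂ (D.N q) := by
  have h1 : Differentiable ℂ (fun v : En (m + 1) => tl v) := tl.differentiable
  have h2 : Differentiable ℂ (fun v : En (m + 1) => D.a q v) := (D.a q).differentiable
  have h3 : Differentiable ℂ (fun v : En (m + 1) => D.B v v) := by fun_prop
  unfold N
  fun_prop

theorem N_sub_N (q v w : En (m + 1)) : D.N q v - D.N q w - (v - w) =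
    ((D.a q (v - w) - c0 (v - w)) + D.B v (v - w) + D.B (v - w) w) • e0 := by
  refine ext_c0_tl ?_ ?_
  · simp only [map_sub, c0_N, map_smul, c0_e0, smul_eq_mul, mul_one, sub_apply]
    ring
  · simp [tl_N]

theorem exists_radius : ∃ η > 0, 3 * η ≤ D.η₀ ∧ ∀ q, ‖q‖ < η →
    (∀ v ∈ ball (0 : En (m + 1)) (2 * η), ∀ w ∈ ball (0 : En (m + 1)) (2 * η),
      ‖D.N q v - D.N q w - (v - w)‖ ≤ 1 / 2 * ‖v - w‖) ∧
    ∀ v, ‖v‖ < 2 * η →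
      |D.r (q + v) - D.r q + (c0 (D.N q v)).re - ‖v‖ ^ 2| ≤ 1 / 2 * ‖v‖ ^ 2 := by
  obtain ⟨η1, hη1, h1⟩ := D.taylor (1 / 2) (by norm_num)
  obtain ⟨η2, hη2, h2⟩ := D.a_near (1 / 4) (by norm_num)
  have hB := norm_nonneg D.B
  refine ⟨min (min (η1 / 2) η2) (min (D.η₀ / 3) (1 / (16 * (‖D.B‖ + 1)))), ?_, ?_, ?_⟩
  · have := D.η₀_pos
    positivity
  · have := (min_le_right (min (η1 / 2) η2) _).trans
      (min_le_left (D.η₀ / 3) (1 / (16 * (‖D.B‖ + 1))))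
    linarith
  · set η := min (min (η1 / 2) η2) (min (D.η₀ / 3) (1 / (16 * (‖D.B‖ + 1)))) with hη
    have e1 : η ≤ η1 / 2 := (min_le_left _ _).trans (min_le_left _ _)
    have e2 : η ≤ η2 := (min_le_left _ _).trans (min_le_right _ _)
    have e3 : η ≤ 1 / (16 * (‖D.B‖ + 1)) := (min_le_right _ _).trans (min_le_right _ _)
    intro q hq
    refine ⟨fun v hv w hw => ?_, fun v hv => ?_⟩
    · rw [N_sub_N, norm_smul, norm_e0, mul_one]
      have hv' : ‖v‖ < 2 * η := by simpa using hv
      have hw' : ‖w‖ < 2 * η := by simpa using hw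
      have hη0 : η * (16 * (‖D.B‖ + 1)) ≤ 1 := by
        rwa [le_div_iff₀ (by positivity)] at e3
      have hx := norm_nonneg (v - w)
      have i1 : ‖D.B v (v - w)‖ ≤ 1 / 8 * ‖v - w‖ := by
        refine (D.norm_B_le _ _).trans (mul_le_mul_of_nonneg_right ?_ hx)
        linarith [mul_le_mul_of_nonneg_left hv'.le hB, norm_nonneg q]
      have i2 : ‖D.B (v - w) w‖ ≤ 1 / 8 * ‖v - w‖ := by
        refine (D.norm_B_le _ _).trans ?_
        rw [mul_right_comm]
        refine mul_le_mul_of_nonneg_right ?_ hx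
        linarith [mul_le_mul_of_nonneg_left hw'.le hB, norm_nonneg q]
      have i3 := h2 q (hq.trans_le e2) (v - w)
      have := norm_add₃_le (a := D.a q (v - w) - c0 (v - w)) (b := D.B v (v - w)) (c := D.B (v - w) w)
      linarith
    · rw [c0_N]
      exact h1 q v (by linarith [norm_nonneg q]) (by linarith)

/-- A radius on which the normalizing coordinates are under control. -/
def η : ℝ := D.exists_radius.choose

theorem η_pos : 0 < D.η := D.exists_radius.choose_spec.1

theorem three_η_le : 3 * D.η ≤ D.η₀ := D.exists_radius.choose_spec.2.1

theorem N_close {q : En (m + 1)} (hq : ‖q‖ < D.η) :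
    ∀ v ∈ ball (0 : En (m + 1)) (2 * D.η), ∀ w ∈ ball (0 : En (m + 1)) (2 * D.η),
      ‖D.N q v - D.N q w - (v - w)‖ ≤ 1 / 2 * ‖v - w‖ :=
  (D.exists_radius.choose_spec.2.2 q hq).1

theorem taylor_half {q v : En (m + 1)} (hq : ‖q‖ < D.η) (hv : ‖v‖ < 2 * D.η) :
    |D.r (q + v) - D.r q + (c0 (D.N q v)).re - ‖v‖ ^ 2| ≤ 1 / 2 * ‖v‖ ^ 2 :=
  (D.exists_radius.choose_spec.2.2 q hq).2 v hv

theorem mem_iff' {z : En (m + 1)} (hz : ‖z‖ < 3 * D.η) : z ∈ Ω ↔ D.r z < 0 :=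
  D.mem_iff z (hz.trans_le D.three_η_le)

/-- Anisotropic dilation. -/
def scale (q : En (m + 1)) (s : ℝ) (y : En (m + 1)) : En (m + 1) :=
  ((c0 y - (D.r q : ℂ)) / (s : ℂ)) • e0 + ((1 : ℂ) / ((√s : ℝ) : ℂ)) • tl y

/-- Inverse of the anisotropic dilation. -/
def unscale (q : En (m + 1)) (s : ℝ) (w : En (m + 1)) : En (m + 1) :=
  ((s : ℂ) * c0 w + (D.r q : ℂ)) • e0 + ((√s : ℝ) : ℂ) • tl w

theorem c0_scale (q : En (m + 1)) (s : ℝ) (y : En (m + 1)) :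
    c0 (D.scale q s y) = (c0 y - (D.r q : ℂ)) / (s : ℂ) := by simp [scale]

theorem tl_scale (q : En (m + 1)) (s : ℝ) (y : En (m + 1)) :
    tl (D.scale q s y) = ((1 : ℂ) / ((√s : ℝ) : ℂ)) • tl y := by simp [scale]

theorem c0_unscale (q : En (m + 1)) (s : ℝ) (y : En (m + 1)) :
    c0 (D.unscale q s y) = (s : ℂ) * c0 y + (D.r q : ℂ) := by simp [unscale]

theorem tl_unscale (q : En (m + 1)) (s : ℝ) (y : En (m + 1)) :
    tl (D.unscale q s y) = ((√s : ℝ) : ℂ) • tl y := by simp [unscale]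

theorem unscale_scale (q : En (m + 1)) {s : ℝ} (hs : 0 < s) (y : En (m + 1)) :
    D.unscale q s (D.scale q s y) = y := by
  have h1 : (s : ℂ) ≠ 0 := by exact_mod_cast hs.ne'
  have h2 : ((√s : ℝ) : ℂ) ≠ 0 := by exact_mod_cast (Real.sqrt_pos.2 hs).ne'
  refine ext_c0_tl ?_ ?_
  · rw [c0_unscale, c0_scale]; field_simp; ring
  · rw [tl_unscale, tl_scale, smul_smul, mul_one_div_cancel h2, one_smul]

theorem scale_unscale (q : En (m + 1)) {s : ℝ} (hs : 0 < s) (y : En (m + 1)) :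
    D.scale q s (D.unscale q s y) = y := by
  have h1 : (s : ℂ) ≠ 0 := by exact_mod_cast hs.ne'
  have h2 : ((√s : ℝ) : ℂ) ≠ 0 := by exact_mod_cast (Real.sqrt_pos.2 hs).ne'
  refine ext_c0_tl ?_ ?_
  · rw [c0_scale, c0_unscale]; field_simp; ring
  · rw [tl_scale, tl_unscale, smul_smul, one_div_mul_cancel h2, one_smul]

theorem differentiable_scale (q : En (m + 1)) (s : ℝ) : Differentiable ℂ (D.scale q s) := by
  have h1 : Differentiable ℂ (fun v : En (m + 1) => tl v) := tl.differentiable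
  have h2 : Differentiable ℂ (fun v : En (m + 1) => c0 v) := c0.differentiable
  unfold scale
  simp only [div_eq_mul_inv]
  fun_prop

theorem differentiable_unscale (q : En (m + 1)) (s : ℝ) : Differentiable ℂ (D.unscale q s) := by
  have h1 : Differentiable ℂ (fun v : En (m + 1) => tl v) := tl.differentiable
  have h2 : Differentiable ℂ (fun v : En (m + 1) => c0 v) := c0.differentiable
  unfold unscale
  fun_prop

/-- The local coordinates before the Cayley transform. -/
def W (q : En (m + 1)) (s : ℝ) (z : En (m + 1)) : En (m + 1) := D.scale q s (D.N q (z - q))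

/-- The scaling map. -/
def Θ (q : En (m + 1)) (s : ℝ) (z : En (m + 1)) : En (m + 1) := cay (D.W q s z)

/-- The inverse of `N q` near the origin. -/
def Ninv (q : En (m + 1)) : En (m + 1) → En (m + 1) := invFunOn (D.N q) (ball 0 (2 * D.η))

/-- The inverse of the scaling map. -/
def Ξ (q : En (m + 1)) (s : ℝ) (u : En (m + 1)) : En (m + 1) :=
  q + D.Ninv q (D.unscale q s (cayInv u))

theorem differentiableOn_Ninv {q : En (m + 1)} (hq : ‖q‖ < D.η) :
    DifferentiableOn ℂ (D.Ninv q) (ball 0 (D.η / 2)) := by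
  have := (invFunOn_of_close_to_id (mul_pos two_pos D.η_pos) (D.N_zero q)
    (D.differentiable_N q).differentiableOn (D.N_close hq)).1
  rwa [show 2 * D.η / 4 = D.η / 2 by ring] at this

theorem Ninv_spec {q : En (m + 1)} (hq : ‖q‖ < D.η) {y : En (m + 1)} (hy : ‖y‖ < D.η / 2) :
    D.N q (D.Ninv q y) = y ∧ ‖D.Ninv q y‖ ≤ 2 * ‖y‖ := by
  have := (invFunOn_of_close_to_id (mul_pos two_pos D.η_pos) (D.N_zero q)
    (D.differentiable_N q).differentiableOn (D.N_close hq)).2 y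
  rw [show 2 * D.η / 4 = D.η / 2 by ring] at this
  exact (this (by simpa using hy)).2

theorem Ninv_N {q : En (m + 1)} (hq : ‖q‖ < D.η) {v : En (m + 1)} (hv : ‖v‖ < 2 * D.η) :
    D.Ninv q (D.N q v) = v :=
  (injOn_of_close_to_id (D.N_close hq)).leftInvOn_invFunOn (by simpa using hv)

theorem c0_W (q : En (m + 1)) (s : ℝ) (z : En (m + 1)) :
    c0 (D.W q s z) = (c0 (D.N q (z - q)) - (D.r q : ℂ)) / (s : ℂ) := D.c0_scale _ _ _

theorem c0_W_re (q : En (m + 1)) (s : ℝ) (z : En (m + 1)) :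
    (c0 (D.W q s z)).re = ((c0 (D.N q (z - q))).re - D.r q) / s := by
  rw [c0_W, div_ofReal_re, sub_re, ofReal_re]

theorem norm_tl_W_sq (q : En (m + 1)) {s : ℝ} (hs : 0 < s) (z : En (m + 1)) :
    ‖tl (D.W q s z)‖ ^ 2 = ‖tl (z - q)‖ ^ 2 / s := by
  rw [W, tl_scale, tl_N, norm_smul, norm_div, norm_one, norm_real, Real.norm_of_nonneg
    (Real.sqrt_nonneg s), mul_pow, div_pow, Real.sq_sqrt hs.le]
  ring

section Interior

variable {D} {q z : En (m + 1)} {s : ℝ}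

theorem norm_sub_lt (hq : ‖q‖ < D.η) (hz : ‖z‖ < D.η) : ‖z - q‖ < 2 * D.η := by
  linarith [norm_sub_le z q]

theorem re_N_ge (hq : ‖q‖ < D.η) (hz : ‖z‖ < D.η) :
    1 / 2 * ‖z - q‖ ^ 2 - D.r z ≤ (c0 (D.N q (z - q))).re - D.r q := by
  have := (abs_le.1 (D.taylor_half hq (norm_sub_lt hq hz))).1
  rw [add_sub_cancel] at this
  linarith

theorem re_W_pos (hq : ‖q‖ < D.η) (hz : ‖z‖ < D.η) (hzΩ : z ∈ Ω) (hs : 0 < s) :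
    0 < (c0 (D.W q s z)).re ∧ ‖z - q‖ ^ 2 ≤ 2 * (s * (c0 (D.W q s z)).re) := by
  have h1 := re_N_ge hq hz
  have h2 : D.r z < 0 := (D.mem_iff' (by linarith [D.η_pos])).1 hzΩ
  rw [c0_W_re, mul_div_cancel₀ _ hs.ne']
  refine ⟨div_pos (by nlinarith [sq_nonneg ‖z - q‖]) hs, by linarith⟩

theorem W_add_one_ne (hq : ‖q‖ < D.η) (hz : ‖z‖ < D.η) (hzΩ : z ∈ Ω) (hs : 0 < s) :
    c0 (D.W q s z) + 1 ≠ 0 := by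
  intro h
  have := (re_W_pos hq hz hzΩ hs).1
  have h2 := congrArg Complex.re h
  simp at h2
  linarith

theorem differentiableAt_Θ (hq : ‖q‖ < D.η) (hz : ‖z‖ < D.η) (hzΩ : z ∈ Ω) (hs : 0 < s) :
    DifferentiableAt ℂ (D.Θ q s) z := by
  have h1 : DifferentiableAt ℂ (D.W q s) z :=
    (D.differentiable_scale q s).differentiableAt.comp z
      ((D.differentiable_N q).differentiableAt.comp z (differentiableAt_id.sub_const q))
  exact (differentiableAt_cay (W_add_one_ne hq hz hzΩ hs)).comp z h1

theorem cayInv_Θ (hq : ‖q‖ < D.η) (hz : ‖z‖ < D.η) (hzΩ : z ∈ Ω) (hs : 0 < s) :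
    cayInv (D.Θ q s z) = D.W q s z := cayInv_cay (W_add_one_ne hq hz hzΩ hs)

theorem Ξ_Θ (hq : ‖q‖ < D.η) (hz : ‖z‖ < D.η) (hzΩ : z ∈ Ω) (hs : 0 < s) :
    D.Ξ q s (D.Θ q s z) = z := by
  rw [Ξ, cayInv_Θ hq hz hzΩ hs, W, D.unscale_scale q hs, D.Ninv_N hq (norm_sub_lt hq hz)]
  simp

theorem norm_Θ_sq_le {ε : ℝ} (hq : ‖q‖ < D.η) (hz : ‖z‖ < D.η) (hzΩ : z ∈ Ω) (hs : 0 < s)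
    (hε : 0 ≤ ε)
    (hT : |D.r z - D.r q + (c0 (D.N q (z - q))).re - ‖z - q‖ ^ 2| ≤ ε * ‖z - q‖ ^ 2) :
    ‖D.Θ q s z‖ ^ 2 ≤ 1 + 2 * ε := by
  obtain ⟨h1, h2⟩ := re_W_pos hq hz hzΩ hs
  have h3 : D.r z < 0 := (D.mem_iff' (by linarith [D.η_pos])).1 hzΩ
  have h4 := one_sub_norm_cay_sq (W_add_one_ne hq hz hzΩ hs)
  have h5 : 4 * (c0 (D.W q s z)).re ≤ ‖c0 (D.W q s z) + 1‖ ^ 2 := by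
    rw [← normSq_eq_norm_sq, normSq_apply]
    simp
    nlinarith [sq_nonneg ((c0 (D.W q s z)).re - 1), sq_nonneg (c0 (D.W q s z)).im]
  have h6 : -(2 * ε) * (c0 (D.W q s z)).re ≤ (c0 (D.W q s z)).re - ‖tl (D.W q s z)‖ ^ 2 := by
    rw [D.norm_tl_W_sq q hs]
    have h7 := (abs_le.1 hT).1
    have h8 : s * (c0 (D.W q s z)).re = (c0 (D.N q (z - q))).re - D.r q := by
      rw [c0_W_re, mul_div_cancel₀ _ hs.ne']
    have h9 : ‖tl (z - q)‖ ^ 2 ≤ ‖z - q‖ ^ 2 := by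
      gcongr; exact norm_tl_le _
    have h10 : ‖tl (z - q)‖ ^ 2 ≤ (1 + 2 * ε) * (s * (c0 (D.W q s z)).re) := by
      nlinarith
    have h11 : ‖tl (z - q)‖ ^ 2 / s ≤ (1 + 2 * ε) * (c0 (D.W q s z)).re := by
      rw [div_le_iff₀ hs]; linarith
    linarith
  have hn : 0 < ‖c0 (D.W q s z) + 1‖ ^ 2 := by linarith
  have h12 : -(2 * ε) ≤ 4 * ((c0 (D.W q s z)).re - ‖tl (D.W q s z)‖ ^ 2) /
      ‖c0 (D.W q s z) + 1‖ ^ 2 := by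
    rw [le_div_iff₀ hn]
    nlinarith
  rw [← h4] at h12
  change -(2 * ε) ≤ 1 - ‖D.Θ q s z‖ ^ 2 at h12
  linarith

theorem norm_Θ_sq_le_two (hq : ‖q‖ < D.η) (hz : ‖z‖ < D.η) (hzΩ : z ∈ Ω) (hs : 0 < s) :
    ‖D.Θ q s z‖ ^ 2 ≤ 2 := by
  have h := D.taylor_half hq (norm_sub_lt hq hz)
  rw [add_sub_cancel] at h
  have := norm_Θ_sq_le hq hz hzΩ hs (by norm_num) h
  linarith

end Interior

theorem exists_norm_Θ_sq_le {ε : ℝ} (hε : 0 < ε) : ∃ δ > 0, ∀ q z, ‖q‖ < δ → ‖z‖ < δ → z ∈ Ω →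
    ∀ s > 0, ‖D.Θ q s z‖ ^ 2 ≤ 1 + ε := by
  obtain ⟨δ, hδ, h⟩ := D.taylor (ε / 2) (half_pos hε)
  have := D.η_pos
  refine ⟨min D.η (δ / 2), by positivity, fun q z hq hz hzΩ s hs => ?_⟩
  rw [lt_min_iff] at hq hz
  have h2 : ‖z - q‖ < δ := by linarith [norm_sub_le z q]
  have h1 := h q (z - q) (by linarith) h2
  rw [add_sub_cancel, ← c0_N] at h1
  have := norm_Θ_sq_le hq.1 hz.1 hzΩ hs (half_pos hε).le h1
  linarith

theorem Θ_self {y : En (m + 1)} (hr : D.r y < 0) : D.Θ y (-D.r y) y = 0 := by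
  have h : (D.r y : ℂ) ≠ 0 := by exact_mod_cast hr.ne
  have h0 : D.W y (-D.r y) y = e0 := by
    refine ext_c0_tl ?_ ?_
    · rw [c0_W, sub_self, N_zero]; simp [h]
    · rw [W, tl_scale, sub_self, N_zero]; simp
  refine ext_c0_tl ?_ ?_
  · simp [Θ, h0]
  · simp [Θ, h0]

end NormData

namespace NormData

variable {m : ℕ} {Ω : Set (En (m + 1))} (D : NormData Ω)

theorem norm_cayInv_bounds {R : ℝ} (hR : R < 1) {u : En (m + 1)} (hu : ‖u‖ ≤ R) :
    ‖c0 (cayInv u)‖ ≤ 2 / (1 - R) ∧ ‖tl (cayInv u)‖ ≤ 2 / (1 - R) ∧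
    (1 - R ^ 2) / 4 ≤ (c0 (cayInv u)).re - ‖tl (cayInv u)‖ ^ 2 := by
  have h0 := one_sub_c0_ne hR hu
  have hc : ‖c0 u‖ ≤ R := (norm_c0_le u).trans hu
  have hR0 : 0 ≤ R := (norm_nonneg u).trans hu
  have h1 : 1 - R ≤ ‖1 - c0 u‖ := by
    have := norm_sub_norm_le (1 : ℂ) (c0 u)
    rw [norm_one] at this; linarith
  have h2 : ‖1 - c0 u‖ ≤ 2 := by
    have := norm_sub_le (1 : ℂ) (c0 u)
    rw [norm_one] at this; linarith
  have h3 : ‖1 + c0 u‖ ≤ 2 := by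
    have := norm_add_le (1 : ℂ) (c0 u)
    rw [norm_one] at this; linarith
  have hp : 0 < 1 - R := by linarith
  refine ⟨?_, ?_, ?_⟩
  · rw [c0_cayInv, norm_div]
    gcongr
  · rw [tl_cayInv, norm_smul, norm_div, norm_one, div_mul_eq_mul_div, one_mul]
    have := norm_tl_le u
    gcongr
    linarith
  · rw [siegel_cayInv h0]
    have : ‖u‖ ^ 2 ≤ R ^ 2 := by gcongr
    have h4 : ‖1 - c0 u‖ ^ 2 ≤ 4 := by nlinarith [norm_nonneg (1 - c0 u)]
    have h5 : 0 < ‖1 - c0 u‖ ^ 2 := by positivity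
    have h6 : 0 ≤ 1 - R ^ 2 := by nlinarith
    gcongr
    linarith

set_option maxHeartbeats 800000 in
theorem exists_Ξ_bounds {R ε : ℝ} (hR0 : 0 ≤ R) (hR : R < 1) (hε : 0 < ε) :
    ∃ σ > 0, ∃ K, ∀ q s, ‖q‖ < σ → 0 < s → s < σ → |D.r q| ≤ s → ∀ u, ‖u‖ ≤ R →
      DifferentiableAt ℂ (D.Ξ q s) u ∧ D.Ξ q s u ∈ Ω ∧ ‖D.Ξ q s u‖ < ε ∧ D.Θ q s (D.Ξ q s u) = u ∧
      D.N q (D.Ξ q s u - q) = D.unscale q s (cayInv u) ∧ ‖D.Ξ q s u - q‖ ≤ √s * K := by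
  have hη := D.η_pos
  have hp : 0 < 1 - R := by linarith
  set K : ℝ := 2 / (1 - R) with hK
  have hK0 : 0 < K := by positivity
  set K2 : ℝ := 2 * (2 * K + 1) with hK2
  have hK20 : 0 < K2 := by positivity
  set κ : ℝ := (1 - R ^ 2) / 4 with hκ
  have hκ0 : 0 < κ := by
    have : R ^ 2 < 1 := by nlinarith
    rw [hκ]; linarith
  set C : ℝ := K + 1 + K2 + ‖D.B‖ * K2 ^ 2 with hC
  have hC0 : 0 < C := by positivity
  obtain ⟨e, he0, he1, he2⟩ : ∃ e : ℝ, 0 < e ∧ e ≤ 1 ∧ e * (C ^ 2 + K2 ^ 2) < κ := by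
    refine ⟨min 1 (κ / (2 * (C ^ 2 + K2 ^ 2))), by positivity, min_le_left _ _, ?_⟩
    calc _ ≤ κ / (2 * (C ^ 2 + K2 ^ 2)) * (C ^ 2 + K2 ^ 2) := by gcongr; exact min_le_right _ _
      _ = κ / 2 := by field_simp
      _ < κ := by linarith
  obtain ⟨δ1, hδ1, hT⟩ := D.taylor e he0
  obtain ⟨δ2, hδ2, ha⟩ := D.a_near e he0
  set b : ℝ := min (min e (δ1 / (2 * K2))) (min (ε / (2 * K2)) (D.η / (2 * K2))) with hb
  have hb0 : 0 < b := by positivity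
  refine ⟨min (min (min δ1 δ2) (min D.η (ε / 2))) (b ^ 2), by positivity, K2, ?_⟩
  intro q s hq hs hsσ hr u hu
  rw [lt_min_iff] at hq hsσ
  have hq1 : ‖q‖ < δ1 := hq.1.trans_le ((min_le_left _ _).trans (min_le_left _ _))
  have hq2 : ‖q‖ < δ2 := hq.1.trans_le ((min_le_left _ _).trans (min_le_right _ _))
  have hq3 : ‖q‖ < D.η := hq.1.trans_le ((min_le_right _ _).trans (min_le_left _ _))
  have hq4 : ‖q‖ < ε / 2 := hq.1.trans_le ((min_le_right _ _).trans (min_le_right _ _))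
  have hsb : √s < b := by
    rw [Real.sqrt_lt' hb0]; exact hsσ.2
  have hse : √s ≤ e := hsb.le.trans ((min_le_left _ _).trans (min_le_left _ _))
  have hs1 : √s * K2 < δ1 := by
    have := hsb.trans_le ((min_le_left _ _).trans (min_le_right _ _))
    rw [lt_div_iff₀ (by positivity)] at this
    linarith [mul_nonneg (Real.sqrt_nonneg s) hK20.le]
  have hs2 : √s * K2 < ε / 2 := by
    have := hsb.trans_le ((min_le_right _ _).trans (min_le_left _ _))
    rw [lt_div_iff₀ (by positivity)] at this
    linarith
  have hs3 : √s * K2 < D.η / 2 := by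
    have := hsb.trans_le ((min_le_right _ _).trans (min_le_right _ _))
    rw [lt_div_iff₀ (by positivity)] at this
    linarith
  have hs0 := Real.sqrt_nonneg s
  have hss : √s * √s = s := Real.mul_self_sqrt hs.le
  obtain ⟨w1, w2, w3⟩ := norm_cayInv_bounds hR hu
  rw [← hK] at w1 w2
  rw [← hκ] at w3
  set w := cayInv u with hw
  set y := D.unscale q s w with hy
  have hc0y : ‖c0 y‖ ≤ s * (K + 1) := by
    rw [hy, c0_unscale]
    refine (norm_add_le _ _).trans ?_
    rw [norm_mul, norm_real, norm_real, Real.norm_of_nonneg hs.le, Real.norm_eq_abs]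
    calc s * ‖c0 w‖ + |D.r q| ≤ s * K + s := by gcongr
      _ = _ := by ring
  have htly : ‖tl y‖ ≤ √s * K := by
    rw [hy, tl_unscale, norm_smul, norm_real, Real.norm_of_nonneg hs0]
    gcongr
  have hyn : ‖y‖ ≤ √s * (2 * K + 1) := by
    have h1 : ‖y‖ ≤ ‖c0 y‖ + ‖tl y‖ := by
      conv_lhs => rw [← c0_smul_add_tl y]
      refine (norm_add_le _ _).trans ?_
      rw [norm_smul, norm_e0, mul_one]
    have h2 : s * (K + 1) ≤ √s * (K + 1) := by
      gcongr
      calc s = √s * √s := hss.symm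
        _ ≤ √s * 1 := by gcongr; exact hse.trans he1
        _ = √s := mul_one _
    linarith
  have hy2 : ‖y‖ < D.η / 2 := by
    have : √s * (2 * K + 1) ≤ √s * K2 := by gcongr; linarith
    linarith
  obtain ⟨v1, v2⟩ := D.Ninv_spec hq3 hy2
  have hΞ : D.Ξ q s u = q + D.Ninv q y := rfl
  set v := D.Ninv q y with hv
  have hvn : ‖v‖ ≤ √s * K2 := by linarith
  have hΞv : D.Ξ q s u - q = v := by rw [hΞ]; simp
  have hzn : ‖D.Ξ q s u‖ ≤ ‖q‖ + √s * K2 := by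
    rw [hΞ]; exact (norm_add_le _ _).trans (by linarith)
  have hu0 := one_sub_c0_ne hR hu
  refine ⟨?_, ?_, by linarith, ?_, by rw [hΞv, v1], by rw [hΞv]; exact hvn⟩
  · have d1 : DifferentiableAt ℂ (fun x => D.unscale q s (cayInv x)) u :=
      (D.differentiable_unscale q s).differentiableAt.comp u (differentiableAt_cayInv hu0)
    have d2 : DifferentiableAt ℂ (D.Ninv q) y :=
      (D.differentiableOn_Ninv hq3).differentiableAt (isOpen_ball.mem_nhds (by simpa using hy2))
    exact (d2.comp u d1).const_add q
  · rw [D.mem_iff' (by linarith)]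
    have t := (abs_le.1 (hT q v hq1 (hvn.trans_lt hs1))).2
    rw [← c0_N, v1, ← hΞ, hy, c0_unscale, add_re, ofReal_re, re_ofReal_mul] at t
    have hv0 : ‖c0 v‖ ≤ √s * (e * C) := by
      have i1 := ha q hq2 v
      have i2 := D.norm_B_le v v
      have i3 : c0 v = c0 y - (D.a q v - c0 v) - D.B v v := by
        rw [← v1, c0_N]; ring
      have i4 : ‖c0 v‖ ≤ ‖c0 y‖ + ‖D.a q v - c0 v‖ + ‖D.B v v‖ := by
        conv_lhs => rw [i3]
        refine (norm_sub_le _ _).trans ?_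
        gcongr
        exact norm_sub_le _ _
      have i5 : s * (K + 1) ≤ √s * e * (K + 1) := by
        calc s * (K + 1) = √s * √s * (K + 1) := by rw [hss]
          _ ≤ _ := by gcongr
      have i6 : e * ‖v‖ ≤ √s * e * K2 := by
        calc e * ‖v‖ ≤ e * (√s * K2) := by gcongr
          _ = _ := by ring
      have i7 : ‖D.B‖ * ‖v‖ * ‖v‖ ≤ ‖D.B‖ * (√s * K2) * (e * K2) := by
        gcongr
        exact hvn.trans (by gcongr)
      have i8 : √s * (e * C) = √s * e * (K + 1) + √s * e * K2 + ‖D.B‖ * (√s * K2) * (e * K2) := by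
        rw [hC]; ring
      linarith
    have hvs : ‖v‖ ^ 2 = ‖c0 v‖ ^ 2 + s * ‖tl w‖ ^ 2 := by
      rw [norm_sq_eq v, ← D.tl_N q v, v1, hy, tl_unscale, norm_smul, norm_real,
        Real.norm_of_nonneg hs0, mul_pow, Real.sq_sqrt hs.le]
    have hv1 : ‖v‖ ^ 2 ≤ s * K2 ^ 2 := by
      calc ‖v‖ ^ 2 ≤ (√s * K2) ^ 2 := by gcongr
        _ = _ := by rw [mul_pow, Real.sq_sqrt hs.le]
    have hv2 : ‖c0 v‖ ^ 2 ≤ s * (e * C ^ 2) := by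
      calc ‖c0 v‖ ^ 2 ≤ (√s * (e * C)) ^ 2 := by gcongr
        _ = s * (e * C ^ 2) * e := by rw [mul_pow, Real.sq_sqrt hs.le]; ring
        _ ≤ s * (e * C ^ 2) * 1 := by gcongr
        _ = _ := by ring
    have hv3 : e * ‖v‖ ^ 2 ≤ s * (e * K2 ^ 2) := by
      calc e * ‖v‖ ^ 2 ≤ e * (s * K2 ^ 2) := by gcongr
        _ = _ := by ring
    have hfin : s * (e * (C ^ 2 + K2 ^ 2)) < s * κ := by gcongr
    have hw4 : s * κ ≤ s * ((c0 w).re - ‖tl w‖ ^ 2) := by gcongr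
    rw [hvs] at t
    rw [hvs] at hv3
    have e1 : s * ((c0 w).re - ‖tl w‖ ^ 2) = s * (c0 w).re - s * ‖tl w‖ ^ 2 := by ring
    have e2 : s * (e * (C ^ 2 + K2 ^ 2)) = s * (e * C ^ 2) + s * (e * K2 ^ 2) := by ring
    rw [e1] at hw4
    rw [e2] at hfin
    linarith
  · rw [Θ, W, hΞv, v1, hy, D.scale_unscale q hs, hw, cay_cayInv hu0]

end NormData

section Limits

variable {E F : Type*} [NormedAddCommGroup E] [NormedSpace ℂ E] [NormedAddCommGroup F]
  [NormedSpace ℂ F] {ι : Type*}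

theorem LocBdd.eventually_ball {l : Filter ι} {f : ι → E → F} {U : Set E} (hf : LocBdd l f U)
    {z : E} (hz : z ∈ U) {y : F} (h : Tendsto (fun j => f j z) l (𝓝 y)) {δ : ℝ} (hδ : 0 < δ) :
    ∃ ε > 0, ∀ᶠ j in l, ∀ w ∈ ball z ε, ‖f j w - y‖ < δ := by
  obtain ⟨ε, hε, M, hM⟩ := hf z hz
  set M' := max M 1 with hM'
  have hM'0 : 0 < M' := lt_max_of_lt_right one_pos
  refine ⟨min ε (ε * δ / (4 * M')), by positivity, ?_⟩
  filter_upwards [hM, h.eventually (ball_mem_nhds y (half_pos hδ))] with j hj hyj w hw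
  rw [mem_ball, lt_min_iff] at hw
  have h1 : dist (f j w) (f j z) ≤ 2 * M' / ε * dist w z := by
    refine Complex.dist_le_div_mul_dist_of_mapsTo_ball hj.1 (fun w hw => ?_) hw.1
    rw [mem_closedBall, dist_eq_norm]
    have := hj.2 w hw
    have := hj.2 z (mem_ball_self hε)
    have := norm_sub_le (f j w) (f j z)
    have := le_max_left M 1
    linarith
  have h2 : 2 * M' / ε * dist w z < 2 * M' / ε * (ε * δ / (4 * M')) := by
    have := hw.2
    gcongr
  have h3 : 2 * M' / ε * (ε * δ / (4 * M')) = δ / 2 := by field_simp; ring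
  rw [← dist_eq_norm]
  have := dist_triangle (f j w) (f j z) y
  linarith

end Limits

theorem interior_closure_ball_subset {E : Type*} [NormedAddCommGroup E] [NormedSpace ℂ E] :
    interior (closure (ball (0 : E) 1)) ⊆ ball 0 1 := by
  have : NormedSpace ℝ E := NormedSpace.restrictScalars ℝ ℂ E
  rw [closure_ball _ one_ne_zero, interior_closedBall _ one_ne_zero]

theorem norm_le_one_of_tendsto {E ι : Type*} [NormedAddCommGroup E] {l : Filter ι} [l.NeBot]
    {x : ι → E} {y : E} (h : Tendsto x l (𝓝 y))
    (hb : ∀ ε > 0, ∀ᶠ j in l, ‖x j‖ ^ 2 ≤ 1 + ε) : ‖y‖ ≤ 1 := by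
  have h2 : ‖y‖ ^ 2 ≤ 1 :=
    le_of_forall_pos_le_add fun ε hε => le_of_tendsto (h.norm.pow 2) (hb ε hε)
  nlinarith [norm_nonneg y]

namespace NormData

variable {m : ℕ} {Ω : Set (En (m + 1))} (D : NormData Ω)

/-- The peak function at the origin. -/
def G (z : En (m + 1)) : ℂ := c0 (D.N 0 z)

theorem G_zero : D.G 0 = 0 := by simp [G, N_zero]

theorem differentiable_G : Differentiable ℂ D.G := c0.differentiable.comp (D.differentiable_N 0)

theorem G_re_ge {z : En (m + 1)} (hz : ‖z‖ < D.η) (hzΩ : z ∈ Ω) :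
    1 / 2 * ‖z‖ ^ 2 < (D.G z).re := by
  have := re_N_ge (D := D) (q := 0) (by simpa using D.η_pos) hz
  rw [sub_zero, D.r_zero, sub_zero] at this
  have h2 : D.r z < 0 := (D.mem_iff' (by linarith [D.η_pos])).1 hzΩ
  simp only [G]
  linarith

theorem norm_N_sub_le {q z : En (m + 1)} (hq : ‖q‖ < D.η) (hz : ‖z‖ < D.η) :
    ‖D.N q (z - q)‖ ≤ 3 / 2 * ‖z - q‖ := by
  have := D.N_close hq (z - q) (by simpa using norm_sub_lt hq hz) 0
    (by simpa using D.η_pos)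
  rw [N_zero, sub_zero, sub_zero] at this
  have := norm_sub_norm_le (D.N q (z - q)) (z - q)
  linarith

theorem tendsto_r : Tendsto D.r (𝓝 0) (𝓝 0) := by
  have h0 : Tendsto (fun v => ‖D.N 0 v‖ + 2 * ‖v‖ ^ 2) (𝓝 0) (𝓝 0) := by
    have h1 := (D.differentiable_N 0).continuous.norm.tendsto 0
    have h2 := ((continuous_norm (E := En (m + 1))).tendsto 0).pow 2 |>.const_mul 2
    simpa [N_zero] using h1.add h2
  refine squeeze_zero_norm' ?_ h0
  filter_upwards [ball_mem_nhds (0 : En (m + 1)) D.η_pos] with v hv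
  have hv' : ‖v‖ < D.η := by simpa using hv
  have h := D.taylor_half (q := 0) (v := v) (by simpa using D.η_pos) (by linarith [D.η_pos])
  rw [zero_add, D.r_zero, sub_zero, abs_le] at h
  have h1 : |(c0 (D.N 0 v)).re| ≤ ‖D.N 0 v‖ := (abs_re_le_norm _).trans (norm_c0_le _)
  rw [abs_le] at h1
  rw [Real.norm_eq_abs, abs_le]
  constructor <;> nlinarith [sq_nonneg ‖v‖]

theorem differentiableAt_Ξ_Θ {q z : En (m + 1)} {s : ℝ} (hq : ‖q‖ < D.η / 6) (hz : ‖z‖ < D.η / 6)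
    (hzΩ : z ∈ Ω) (hs : 0 < s) : DifferentiableAt ℂ (D.Ξ q s) (D.Θ q s z) := by
  have hη := D.η_pos
  have hq' : ‖q‖ < D.η := by linarith
  have hz' : ‖z‖ < D.η := by linarith
  have h1 : 1 - c0 (D.Θ q s z) ≠ 0 := by
    have hw := W_add_one_ne hq' hz' hzΩ hs
    rw [Θ, c0_cay]
    intro h
    rw [sub_eq_zero, eq_div_iff hw, one_mul] at h
    have := congrArg Complex.re h
    simp at this
    linarith
  have h2 : DifferentiableAt ℂ (fun x => D.unscale q s (cayInv x)) (D.Θ q s z) :=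
    (D.differentiable_unscale q s).differentiableAt.comp _ (differentiableAt_cayInv h1)
  have h3 : DifferentiableAt ℂ (D.Ninv q) (D.unscale q s (cayInv (D.Θ q s z))) := by
    rw [cayInv_Θ hq' hz' hzΩ hs, W, D.unscale_scale q hs]
    refine (D.differentiableOn_Ninv hq').differentiableAt (isOpen_ball.mem_nhds ?_)
    have := D.norm_N_sub_le hq' hz'
    have := norm_sub_le z q
    rw [mem_ball_zero_iff]
    linarith
  exact (DifferentiableAt.comp (D.Θ q s z) h3 h2).const_add q

section Peak

variable {E : Type*} [NormedAddCommGroup E] [NormedSpace ℂ E] [FiniteDimensional ℂ E]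
  {ι : Type*} {l : Ultrafilter ι} {V : Set E} {f : ι → E → En (m + 1)}

/-- Holomorphic families with values in `Ω` whose base point tends to the peak point `0` tend to
`0` everywhere. -/
theorem tendsto_zero_of_base (D : NormData Ω) (hVo : IsOpen V) (hVc : IsPreconnected V)
    (hf : LocBdd (l : Filter ι) f V) (hm : ∀ z ∈ V, ∀ᶠ j in (l : Filter ι), f j z ∈ Ω)
    {o : E} (ho : o ∈ V) (h0 : Tendsto (fun j => f j o) l (𝓝 0)) :
    ∀ z ∈ V, Tendsto (fun j => f j z) l (𝓝 0) := by
  obtain ⟨φ, hφ⟩ := hf.exists_limit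
  have hφd := hf.differentiableOn_limit hVo hφ
  have hφo : φ o = 0 := tendsto_nhds_unique (hφ o ho) h0
  have hφoc : ContinuousAt φ o := (hφd.differentiableAt (hVo.mem_nhds ho)).continuousAt
  have hnear : ∀ᶠ z in 𝓝 o, z ∈ V ∧ ‖φ z‖ < D.η := by
    refine Filter.Eventually.and (hVo.mem_nhds ho) ?_
    refine hφoc.norm.eventually_lt continuousAt_const ?_
    simpa [hφo] using D.η_pos
  have hG : ∀ z ∈ V, ‖φ z‖ < D.η → 1 / 2 * ‖φ z‖ ^ 2 ≤ (D.G (φ z)).re := by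
    intro z hz hn
    refine le_of_tendsto_of_tendsto (((hφ z hz).norm.pow 2).const_mul (1 / 2))
      ((Complex.continuous_re.tendsto _).comp
        ((D.differentiable_G.continuous.tendsto _).comp (hφ z hz))) ?_
    filter_upwards [hm z hz, (hφ z hz).norm.eventually_lt tendsto_const_nhds hn] with j h1 h2
    exact (D.G_re_ge h2 h1).le
  have hev : φ =ᶠ[𝓝 o] fun _ => 0 := by
    set h : E → ℂ := fun z => cexp (-D.G (φ z)) with hh
    have hnorm : ∀ z, ‖h z‖ = Real.exp (-(D.G (φ z)).re) := fun z => by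
      simp [hh, Complex.norm_exp]
    have hho : ‖h o‖ = 1 := by rw [hnorm, hφo, G_zero]; simp
    have hd : ∀ᶠ z in 𝓝 o, DifferentiableAt ℂ h z := by
      filter_upwards [hVo.mem_nhds ho] with z hz
      have h1 : DifferentiableAt ℂ (fun z => D.G (φ z)) z :=
        D.differentiable_G.differentiableAt.comp z (hφd.differentiableAt (hVo.mem_nhds hz))
      exact h1.neg.cexp
    have hmax : IsLocalMax (norm ∘ h) o := by
      filter_upwards [hnear] with z hz
      rw [comp_apply, comp_apply, hho, hnorm]
      have := hG z hz.1 hz.2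
      rw [Real.exp_le_one_iff]
      nlinarith [sq_nonneg ‖φ z‖]
    filter_upwards [Complex.norm_eventually_eq_of_isLocalMax hd hmax, hnear] with z h1 h2
    rw [hho, hnorm, Real.exp_eq_one_iff] at h1
    have h3 := hG z h2.1 h2.2
    have h4 : ‖φ z‖ ^ 2 ≤ 0 := by linarith
    exact norm_eq_zero.1 (pow_eq_zero_iff two_ne_zero |>.1 (le_antisymm h4 (sq_nonneg _)))
  intro z hz
  have : φ z = 0 := eqOn_of_eventuallyEq hVo hVc hφd (differentiableOn_const _) ho hev hz
  rw [← this]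
  exact hφ z hz

end Peak

/-- The Wong–Rosay theorem in normalized coordinates. -/
theorem wong_rosay (D : NormData Ω) (hΩo : IsOpen Ω) (hΩc : IsPreconnected Ω) (hbd : Bornology.IsBounded Ω)
    (hreg : interior (closure Ω) ⊆ Ω) {ι : Type*} {l : Ultrafilter ι}
    {φ χ : ι → En (m + 1) → En (m + 1)} (hφ : ∀ j, DifferentiableOn ℂ (φ j) Ω)
    (hφm : ∀ j, MapsTo (φ j) Ω Ω) (hχ : ∀ j, DifferentiableOn ℂ (χ j) Ω)
    (hχm : ∀ j, MapsTo (χ j) Ω Ω) (hχφ : ∀ j, ∀ z ∈ Ω, χ j (φ j z) = z)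
    (hφχ : ∀ j, ∀ z ∈ Ω, φ j (χ j z) = z) {o : En (m + 1)} (ho : o ∈ Ω)
    (h0 : Tendsto (fun j => φ j o) l (𝓝 0)) :
    ∃ Φ Ψ : En (m + 1) → En (m + 1),
      DifferentiableOn ℂ Φ Ω ∧ MapsTo Φ Ω (ball 0 1) ∧
      DifferentiableOn ℂ Ψ (ball 0 1) ∧ MapsTo Ψ (ball 0 1) Ω ∧
      (∀ z ∈ Ω, Ψ (Φ z) = z) ∧ (∀ w ∈ ball (0 : En (m + 1)) 1, Φ (Ψ w) = w) := by
  have hη := D.η_pos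
  obtain ⟨M, hM⟩ := hbd.exists_norm_le
  have hφb : LocBdd (l : Filter ι) φ Ω := LocBdd.of_bound hΩo M hφ fun j w hw => hM _ (hφm j hw)
  have hφ0 := D.tendsto_zero_of_base hΩo hΩc hφb
    (fun z hz => Eventually.of_forall fun j => hφm j hz) ho h0
  set y : ι → En (m + 1) := fun j => φ j o with hy
  set s : ι → ℝ := fun j => -D.r (y j) with hs
  have hyn : Tendsto (fun j => ‖y j‖) l (𝓝 0) := by simpa using h0.norm
  have hs0 : Tendsto s l (𝓝 0) := by simpa using (D.tendsto_r.comp h0).neg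
  have hspos : ∀ᶠ j in (l : Filter ι), 0 < s j := by
    filter_upwards [hyn.eventually_lt_const (show (0 : ℝ) < D.η by linarith)] with j hj
    have := (D.mem_iff' (show ‖y j‖ < 3 * D.η by linarith)).1 (hφm j ho)
    simp only [hs]; linarith
  set f : ι → En (m + 1) → En (m + 1) := fun j z => D.Θ (y j) (s j) (φ j z) with hf
  set g : ι → En (m + 1) → En (m + 1) := fun j u => χ j (D.Ξ (y j) (s j) u) with hg
  have hsmall : ∀ z ∈ Ω, ∀ δ > 0, ∃ ε > 0, ball z ε ⊆ Ω ∧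
      ∀ᶠ j in (l : Filter ι), ‖y j‖ < δ ∧ 0 < s j ∧ ∀ w ∈ ball z ε, ‖φ j w‖ < δ := by
    intro z hz δ hδ
    obtain ⟨ε1, hε1, hb⟩ := Metric.isOpen_iff.1 hΩo z hz
    obtain ⟨ε2, hε2, hb2⟩ := hφb.eventually_ball hz (hφ0 z hz) hδ
    refine ⟨min ε1 ε2, lt_min hε1 hε2, (ball_subset_ball (min_le_left _ _)).trans hb, ?_⟩
    filter_upwards [hb2, hyn.eventually_lt_const hδ, hspos] with j h1 h2 h3
    refine ⟨h2, h3, fun w hw => ?_⟩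
    simpa using h1 w (ball_subset_ball (min_le_right _ _) hw)
  have hΞ : ∀ u ∈ ball (0 : En (m + 1)) 1, ∀ δ > 0, ∃ ε > 0, ∀ᶠ j in (l : Filter ι),
      ‖y j‖ < δ ∧ 0 < s j ∧ ∀ w ∈ ball u ε, DifferentiableAt ℂ (D.Ξ (y j) (s j)) w ∧
      D.Ξ (y j) (s j) w ∈ Ω ∧ ‖D.Ξ (y j) (s j) w‖ < δ ∧
      D.Θ (y j) (s j) (D.Ξ (y j) (s j) w) = w := by
    intro u hu δ hδ
    have hu1 : ‖u‖ < 1 := by simpa using hu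
    have hu0 := norm_nonneg u
    obtain ⟨σ, hσ, K, h⟩ := D.exists_Ξ_bounds (R := (1 + ‖u‖) / 2) (by linarith) (by linarith) hδ
    refine ⟨(1 - ‖u‖) / 2, by linarith, ?_⟩
    filter_upwards [hyn.eventually_lt_const hσ, hyn.eventually_lt_const hδ, hspos,
      hs0.eventually_lt_const hσ] with j h1 h2 h3 h4
    refine ⟨h2, h3, fun w hw => ?_⟩
    have hwn : ‖w‖ ≤ (1 + ‖u‖) / 2 := by
      rw [mem_ball, dist_eq_norm] at hw
      have := norm_le_norm_add_norm_sub' w u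
      linarith
    obtain ⟨c1, c2, c3, c4, -⟩ := h (y j) (s j) h1 h3 h4
      (by rw [← abs_neg]; exact (abs_of_pos h3).le) w hwn
    exact ⟨c1, c2, c3, c4⟩
  have hfb : LocBdd (l : Filter ι) f Ω := by
    intro z hz
    obtain ⟨ε, hε, hb, h⟩ := hsmall z hz D.η hη
    refine ⟨ε, hε, 2, ?_⟩
    filter_upwards [h] with j ⟨h1, h2, h3⟩
    refine ⟨fun w hw => ?_, fun w hw => ?_⟩
    · exact ((differentiableAt_Θ h1 (h3 w hw) (hφm j (hb hw)) h2).comp w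
        ((hφ j).differentiableAt (hΩo.mem_nhds (hb hw)))).differentiableWithinAt
    · have := norm_Θ_sq_le_two h1 (h3 w hw) (hφm j (hb hw)) h2
      change ‖D.Θ (y j) (s j) (φ j w)‖ ≤ 2
      nlinarith [norm_nonneg (D.Θ (y j) (s j) (φ j w))]
  have hgb : LocBdd (l : Filter ι) g (ball 0 1) := by
    intro u hu
    obtain ⟨ε, hε, h⟩ := hΞ u hu 1 one_pos
    refine ⟨ε, hε, M, ?_⟩
    filter_upwards [h] with j ⟨h1, h2, h3⟩
    refine ⟨fun w hw => ?_, fun w hw => hM _ (hχm j (h3 w hw).2.1)⟩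
    exact (((hχ j).differentiableAt (hΩo.mem_nhds (h3 w hw).2.1)).comp w
      (h3 w hw).1).differentiableWithinAt
  obtain ⟨Φ, hΦ⟩ := hfb.exists_limit
  obtain ⟨Ψ, hΨ⟩ := hgb.exists_limit
  have hΦc : ∀ z ∈ Ω, Φ z ∈ closure (ball (0 : En (m + 1)) 1) := by
    intro z hz
    rw [closure_ball _ one_ne_zero, mem_closedBall_zero_iff]
    refine norm_le_one_of_tendsto (hΦ z hz) fun ε hε => ?_
    obtain ⟨δ, hδ, hδ2⟩ := D.exists_norm_Θ_sq_le hε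
    obtain ⟨ε, hε, hb, h⟩ := hsmall z hz δ hδ
    filter_upwards [h] with j ⟨h1, h2, h3⟩
    exact hδ2 _ _ h1 (h3 z (mem_ball_self hε)) (hφm j hz) _ h2
  have hΨc : ∀ u ∈ ball (0 : En (m + 1)) 1, Ψ u ∈ closure Ω := by
    intro u hu
    obtain ⟨ε, hε, h⟩ := hΞ u hu 1 one_pos
    refine mem_closure_of_tendsto (hΨ u hu) ?_
    filter_upwards [h] with j ⟨h1, h2, h3⟩
    exact hχm j (h3 u (mem_ball_self hε)).2.1
  have hΦo : Φ o = 0 := by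
    refine tendsto_nhds_unique (hΦ o ho) (tendsto_const_nhds.congr' ?_)
    filter_upwards [hspos] with j hj
    exact (D.Θ_self (by simp only [hs] at hj; linarith)).symm
  obtain ⟨c1, c2, c3, c4, c5, c6⟩ := cartan_limit hΩo hΩc hreg isOpen_ball
    (convex_ball (0 : En (m + 1)) 1).isPreconnected interior_closure_ball_subset hfb hgb hΦ hΨ hΦc hΨc
    (by
      intro z hz
      obtain ⟨ε, hε, hb, h⟩ := hsmall z hz (D.η / 6) (by linarith)
      refine ⟨ε, hε, ?_⟩
      filter_upwards [h] with j ⟨h1, h2, h3⟩ w hw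
      have hw3 := h3 w hw
      have hwΩ := hφm j (hb hw)
      have e1 : D.Ξ (y j) (s j) (f j w) = φ j w := Ξ_Θ (by linarith) (by linarith) hwΩ h2
      refine ⟨?_, ?_⟩
      · have d1 : DifferentiableAt ℂ (χ j) (D.Ξ (y j) (s j) (f j w)) := by
          rw [e1]; exact (hχ j).differentiableAt (hΩo.mem_nhds hwΩ)
        exact d1.comp _ (D.differentiableAt_Ξ_Θ h1 hw3 hwΩ h2)
      · change χ j (D.Ξ (y j) (s j) (f j w)) = w
        rw [e1, hχφ j w (hb hw)])
    (by
      intro u hu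
      obtain ⟨ε, hε, h⟩ := hΞ u hu D.η hη
      refine ⟨ε, hε, ?_⟩
      filter_upwards [h] with j ⟨h1, h2, h3⟩ w hw
      obtain ⟨d1, d2, d3, d4⟩ := h3 w hw
      have e1 : φ j (g j w) = D.Ξ (y j) (s j) w := hφχ j _ d2
      refine ⟨?_, ?_⟩
      · have d1 : DifferentiableAt ℂ (D.Θ (y j) (s j)) (φ j (g j w)) := by
          rw [e1]; exact differentiableAt_Θ h1 d3 d2 h2
        exact d1.comp _ ((hφ j).differentiableAt (hΩo.mem_nhds (hχm j d2)))
      · change D.Θ (y j) (s j) (φ j (g j w)) = w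
        rw [e1, d4])
    ho (by rw [hΦo]; exact mem_ball_self one_pos)
  exact ⟨Φ, Ψ, c1, c3, c2, c4, c5, c6⟩

end NormData

namespace NormData

variable {m : ℕ} {Ω : Set (En (m + 1))} (D : NormData Ω)

/-- The half-plane parameter beyond which the normal disc lies in `Ω`. -/
def A : ℝ := 6 + 2 / D.η

theorem A_pos : 0 < D.A := by
  have := D.η_pos
  unfold A; positivity

/-- The normal disc at the boundary point, parametrized by a right half-plane. -/
def ψ (ξ : ℂ) : En (m + 1) := D.Ninv 0 (ξ⁻¹ • e0)

section Disc

variable {D} {ξ : ℂ}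

theorem norm_zero_lt : ‖(0 : En (m + 1))‖ < D.η := by simpa using D.η_pos

theorem lt_norm_of_A_lt (h : D.A < ξ.re) : D.A < ‖ξ‖ :=
  h.trans_le ((le_abs_self _).trans (abs_re_le_norm ξ))

theorem ne_zero_of_A_lt (h : D.A < ξ.re) : ξ ≠ 0 := by
  intro h0
  rw [h0, zero_re] at h
  linarith [D.A_pos]

theorem norm_inv_smul_lt (h : D.A < ξ.re) : ‖ξ⁻¹ • (e0 : En (m + 1))‖ < D.η / 2 := by
  have h1 := lt_norm_of_A_lt h
  have hη := D.η_pos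
  rw [norm_smul, norm_e0, mul_one, norm_inv, inv_lt_comm₀ (by linarith [D.A_pos]) (by positivity),
    inv_div]
  unfold A at h1
  linarith

theorem N_ψ (h : D.A < ξ.re) : D.N 0 (D.ψ ξ) = ξ⁻¹ • e0 :=
  (D.Ninv_spec norm_zero_lt (norm_inv_smul_lt h)).1

theorem norm_ψ_le (h : D.A < ξ.re) : ‖D.ψ ξ‖ ≤ 2 * ‖ξ‖⁻¹ := by
  have := (D.Ninv_spec norm_zero_lt (norm_inv_smul_lt h)).2
  rwa [norm_smul, norm_e0, mul_one, norm_inv] at this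

theorem norm_ψ_lt (h : D.A < ξ.re) : ‖D.ψ ξ‖ < D.η := by
  have := (D.Ninv_spec norm_zero_lt (norm_inv_smul_lt h)).2
  have := norm_inv_smul_lt h
  unfold ψ
  linarith

theorem G_ψ (h : D.A < ξ.re) : D.G (D.ψ ξ) = ξ⁻¹ := by
  rw [G, N_ψ h]; simp

theorem ψ_mem (h : D.A < ξ.re) : D.ψ ξ ∈ Ω := by
  have hη := D.η_pos
  have h1 := norm_ψ_lt h
  rw [D.mem_iff' (by linarith)]
  have t := (abs_le.1 (D.taylor_half norm_zero_lt (v := D.ψ ξ) (by linarith))).2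
  have hG := G_ψ h
  rw [G] at hG
  rw [zero_add, D.r_zero, sub_zero, hG, inv_re, normSq_eq_norm_sq] at t
  have h2 := norm_ψ_le h
  have h0 : 0 < ‖ξ‖ := by linarith [D.A_pos, lt_norm_of_A_lt h]
  have h3 : ‖D.ψ ξ‖ ^ 2 ≤ 4 / ‖ξ‖ ^ 2 := by
    calc ‖D.ψ ξ‖ ^ 2 ≤ (2 * ‖ξ‖⁻¹) ^ 2 := by gcongr
      _ = _ := by field_simp; norm_num
  have h4 : 6 / ‖ξ‖ ^ 2 < ξ.re / ‖ξ‖ ^ 2 := by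
    have : 6 < ξ.re := by
      have : 0 < 2 / D.η := by positivity
      unfold A at h; linarith
    gcongr
  have h5 : 6 / ‖ξ‖ ^ 2 = 3 / 2 * (4 / ‖ξ‖ ^ 2) := by ring
  linarith

theorem differentiableAt_ψ (h : D.A < ξ.re) : DifferentiableAt ℂ D.ψ ξ := by
  have h1 : DifferentiableAt ℂ (fun ξ : ℂ => ξ⁻¹ • (e0 : En (m + 1))) ξ :=
    (differentiableAt_inv (ne_zero_of_A_lt h)).smul_const _
  have h2 : DifferentiableAt ℂ (D.Ninv 0) (ξ⁻¹ • e0) :=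
    (D.differentiableOn_Ninv norm_zero_lt).differentiableAt
      (isOpen_ball.mem_nhds (by simpa using norm_inv_smul_lt h))
  exact DifferentiableAt.comp ξ h2 h1

end Disc

theorem norm_G_sub_le {v w : En (m + 1)} (hv : ‖v‖ < D.η) (hw : ‖w‖ < D.η) :
    ‖D.G v - D.G w‖ ≤ 3 / 2 * ‖v - w‖ := by
  have hη := D.η_pos
  have h1 := D.N_close norm_zero_lt v (by simp; linarith) w (by simp; linarith)
  have h2 := norm_sub_norm_le (D.N 0 v - D.N 0 w) (v - w)
  have h3 := norm_c0_le (D.N 0 v - D.N 0 w)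
  rw [map_sub] at h3
  simp only [G]
  linarith

/-- Holomorphic self-maps of `Ω` tangent to the identity at the boundary point `0`. -/
structure IsTangent (Ω : Set (En (m + 1))) (f : En (m + 1) → En (m + 1)) : Prop where
  diff : DifferentiableOn ℂ f Ω
  maps : MapsTo f Ω Ω
  littleO : ∀ ε > 0, ∃ δ > 0, ∀ z ∈ Ω, ‖z‖ < δ → ‖f z - z‖ ≤ ε * ‖z‖

theorem IsTangent.id : IsTangent Ω (fun z => z) :=
  ⟨differentiableOn_id, mapsTo_id _, fun ε hε => ⟨1, one_pos, fun z _ _ => by simp; positivity⟩⟩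

theorem IsTangent.comp {f g : En (m + 1) → En (m + 1)} (hf : IsTangent Ω f) (hg : IsTangent Ω g) :
    IsTangent Ω (f ∘ g) := by
  refine ⟨hf.diff.comp hg.diff hg.maps, hf.maps.comp hg.maps, fun ε hε => ?_⟩
  obtain ⟨δ1, hδ1, h1⟩ := hf.littleO (ε / 4) (by positivity)
  obtain ⟨δ2, hδ2, h2⟩ := hg.littleO (min 1 (ε / 2)) (by positivity)
  refine ⟨min (δ1 / 2) δ2, by positivity, fun z hz hzn => ?_⟩
  rw [lt_min_iff] at hzn
  have i2 := h2 z hz hzn.2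
  have hz0 := norm_nonneg z
  have i3 : ‖g z - z‖ ≤ ‖z‖ := i2.trans (by nlinarith [min_le_left 1 (ε / 2)])
  have i4 : ‖g z - z‖ ≤ ε / 2 * ‖z‖ := i2.trans (by nlinarith [min_le_right 1 (ε / 2)])
  have i5 : ‖g z‖ ≤ 2 * ‖z‖ := by
    have := norm_le_norm_add_norm_sub' (g z) z
    linarith
  have i6 := h1 (g z) (hg.maps hz) (by linarith)
  have i7 : ε / 4 * ‖g z‖ ≤ ε / 4 * (2 * ‖z‖) := by gcongr
  have i8 := norm_add_le (f (g z) - g z) (g z - z)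
  rw [sub_add_sub_cancel] at i8
  simp only [comp_apply]
  linarith

theorem IsTangent.iterate {f : En (m + 1) → En (m + 1)} (hf : IsTangent Ω f) (k : ℕ) :
    IsTangent Ω (f^[k]) := by
  induction k with
  | zero => exact IsTangent.id
  | succ k ih => rw [iterate_succ]; exact ih.comp hf

section Julia

variable {D} {f : En (m + 1) → En (m + 1)} {A' : ℝ}

theorem IsTangent.tendsto_mul_G (hf : IsTangent Ω f) :
    Tendsto (fun x : ℝ => (x : ℂ) * D.G (f (D.ψ x))) atTop (𝓝 1) := by
  rw [Metric.tendsto_nhds]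
  intro ε hε
  obtain ⟨δ, hδ, h⟩ := hf.littleO (min 1 (ε / 6)) (by positivity)
  filter_upwards [eventually_gt_atTop D.A, eventually_gt_atTop (2 / δ),
    eventually_gt_atTop (4 / D.η)] with x h1 h2 h3
  have hη := D.η_pos
  have hx0 : 0 < x := D.A_pos.trans h1
  have hA : D.A < (x : ℂ).re := by simpa using h1
  have hψ := norm_ψ_le hA
  rw [norm_real, Real.norm_of_nonneg hx0.le] at hψ
  have hψδ : ‖D.ψ x‖ < δ := by
    refine hψ.trans_lt ?_
    rw [div_lt_iff₀ hδ] at h2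
    rw [← div_eq_mul_inv, div_lt_iff₀ hx0]; linarith
  have hψη : ‖D.ψ x‖ < D.η / 2 := by
    refine hψ.trans_lt ?_
    rw [div_lt_iff₀ hη] at h3
    rw [← div_eq_mul_inv, div_lt_iff₀ hx0]; linarith
  have i1 := h _ (ψ_mem hA) hψδ
  have hψ0 := norm_nonneg (D.ψ x)
  have i2 : ‖f (D.ψ x) - D.ψ x‖ ≤ ‖D.ψ x‖ := i1.trans (by nlinarith [min_le_left 1 (ε / 6)])
  have i3 : ‖f (D.ψ x) - D.ψ x‖ ≤ ε / 6 * ‖D.ψ x‖ :=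
    i1.trans (by nlinarith [min_le_right 1 (ε / 6)])
  have i4 : ‖f (D.ψ x)‖ < D.η := by
    have := norm_le_norm_add_norm_sub' (f (D.ψ x)) (D.ψ x)
    linarith
  have i5 := D.norm_G_sub_le i4 (norm_ψ_lt hA)
  rw [G_ψ hA] at i5
  have i6 : ε / 6 * ‖D.ψ x‖ ≤ ε / 6 * (2 * x⁻¹) := by gcongr
  have hxc : (x : ℂ) ≠ 0 := by exact_mod_cast hx0.ne'
  have e : (x : ℂ) * D.G (f (D.ψ x)) - 1 = x * (D.G (f (D.ψ x)) - (x : ℂ)⁻¹) := by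
    field_simp
  rw [dist_eq_norm, e, norm_mul, norm_real, Real.norm_of_nonneg hx0.le]
  calc x * ‖D.G (f (D.ψ x)) - (x : ℂ)⁻¹‖ ≤ x * (ε / 2 * x⁻¹) := by gcongr; linarith
    _ = ε / 2 := by field_simp
    _ < ε := by linarith

theorem G_ne_zero {z : En (m + 1)} (hz : ‖z‖ < D.η) (hzΩ : z ∈ Ω) : D.G z ≠ 0 := by
  intro h
  have := D.G_re_ge hz hzΩ
  rw [h, zero_re] at this
  nlinarith [sq_nonneg ‖z‖]

theorem inv_G_re_pos {z : En (m + 1)} (hz : ‖z‖ < D.η) (hzΩ : z ∈ Ω) : 0 < (D.G z)⁻¹.re := by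
  rw [inv_re]
  have := D.G_re_ge hz hzΩ
  exact div_pos (by nlinarith [sq_nonneg ‖z‖]) (normSq_pos.2 (G_ne_zero hz hzΩ))

theorem norm_sq_le_of_inv_G_re {z : En (m + 1)} (hz : ‖z‖ < D.η) (hzΩ : z ∈ Ω) {b : ℝ} (hb : 0 < b)
    (h : b ≤ (D.G z)⁻¹.re) : ‖z‖ ^ 2 ≤ 2 / b := by
  have h1 := D.G_re_ge hz hzΩ
  have h2 : (D.G z).re ≤ ‖D.G z‖ := (le_abs_self _).trans (abs_re_le_norm _)
  have h3 : b ≤ ‖D.G z‖⁻¹ := by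
    rw [← norm_inv]; exact h.trans ((le_abs_self _).trans (abs_re_le_norm _))
  have h4 : ‖D.G z‖ ≤ 1 / b := by
    rw [one_div]; exact (le_inv_comm₀ hb (norm_pos_iff.2 (G_ne_zero hz hzΩ))).1 h3
  have h5 : 2 / b = 2 * (1 / b) := by ring
  linarith

/-- Differentiability of the half-plane function attached to a self-map. -/
theorem IsTangent.differentiableAt_inv_G (hf : DifferentiableOn ℂ f Ω) (hm : MapsTo f Ω Ω)
    (hΩo : IsOpen Ω) {ξ : ℂ} (hξ : D.A < ξ.re) (hη : ‖f (D.ψ ξ)‖ < D.η) :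
    DifferentiableAt ℂ (fun ξ => (D.G (f (D.ψ ξ)))⁻¹) ξ := by
  have h1 : DifferentiableAt ℂ (fun ξ => f (D.ψ ξ)) ξ :=
    DifferentiableAt.comp ξ (hf.differentiableAt (hΩo.mem_nhds (ψ_mem hξ))) (differentiableAt_ψ hξ)
  have h3 : DifferentiableAt ℂ D.G (f (D.ψ ξ)) := D.differentiable_G.differentiableAt
  have h2 : DifferentiableAt ℂ (fun ξ => D.G (f (D.ψ ξ))) ξ :=
    DifferentiableAt.comp (g := D.G) (f := fun ξ => f (D.ψ ξ)) ξ h3 h1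
  exact h2.fun_inv (G_ne_zero hη (hm (ψ_mem hξ)))

theorem IsTangent.julia (hf : IsTangent Ω f) (hΩo : IsOpen Ω) (hA' : D.A ≤ A')
    (hb : ∀ ξ : ℂ, A' < ξ.re → ‖f (D.ψ ξ)‖ < D.η) {ξ : ℂ} (hξ : A' < ξ.re) :
    ξ.re - A' ≤ (D.G (f (D.ψ ξ)))⁻¹.re := by
  set h : ℂ → ℂ := fun ζ => (D.G (f (D.ψ (ζ + A'))))⁻¹ with hh
  have hre : ∀ ζ : ℂ, 0 < ζ.re → A' < (ζ + A').re := fun ζ hζ => by simpa using hζ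
  have key := halfPlane_julia (h := h) (a := ξ - A') ?_ ?_ ?_ ?_
  · simpa [hh] using key
  · intro ζ hζ
    have h1 := IsTangent.differentiableAt_inv_G hf.diff hf.maps hΩo (hA'.trans_lt (hre ζ hζ))
      (hb _ (hre ζ hζ))
    exact (DifferentiableAt.comp ζ h1 (differentiableAt_id.add_const (A' : ℂ))).differentiableWithinAt
  · intro ζ hζ
    exact inv_G_re_pos (hb _ (hre ζ hζ)) (hf.maps (ψ_mem (hA'.trans_lt (hre ζ hζ))))
  · have t1 : Tendsto (fun x : ℝ => ((x + A' : ℝ) : ℂ) * D.G (f (D.ψ ((x + A' : ℝ) : ℂ)))) atTop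
        (𝓝 1) := hf.tendsto_mul_G.comp (tendsto_atTop_add_const_right _ A' tendsto_id)
    have t2 : Tendsto (fun x : ℝ => ((1 + A' / x : ℝ) : ℂ)) atTop (𝓝 1) := by
      have : Tendsto (fun x : ℝ => (1 + A' / x : ℝ)) atTop (𝓝 1) := by
        simpa using (tendsto_const_nhds (x := (1 : ℝ))).add
          (tendsto_const_nhds.div_atTop (a := A') tendsto_id)
      simpa [Function.comp_def] using (Complex.continuous_ofReal.tendsto 1).comp this
    have t3 := t2.mul (t1.inv₀ one_ne_zero)
    rw [inv_one, mul_one] at t3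
    refine t3.congr' ?_
    filter_upwards [eventually_gt_atTop 0, eventually_gt_atTop (-A')] with x hx hx'
    have hxc : (x : ℂ) ≠ 0 := by exact_mod_cast hx.ne'
    have hxA : ((x : ℂ) + A') ≠ 0 := by
      exact_mod_cast (show x + A' ≠ 0 by linarith)
    simp only [hh]
    push_cast
    rw [mul_inv]
    field_simp
  · simpa using hξ

end Julia

end NormData

namespace NormData

section Uniform

variable {m : ℕ} {Ω : Set (En (m + 1))} {D : NormData Ω} {f : En (m + 1) → En (m + 1)} {ρ R : ℝ}

theorem IsTangent.exists_bound (hf : IsTangent Ω f) (hρ : 0 < ρ) :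
    ∃ A', D.A ≤ A' ∧ ∀ ξ : ℂ, A' < ξ.re → ‖f (D.ψ ξ)‖ ≤ ρ := by
  obtain ⟨δ, hδ, h⟩ := hf.littleO 1 one_pos
  refine ⟨max D.A (max (2 / δ) (4 / ρ)), le_max_left _ _, fun ξ hξ => ?_⟩
  rw [max_lt_iff, max_lt_iff] at hξ
  obtain ⟨hA, h1, h2⟩ := hξ
  have hn : ξ.re ≤ ‖ξ‖ := (le_abs_self _).trans (abs_re_le_norm ξ)
  have h0 : 0 < ‖ξ‖ := D.A_pos.trans (lt_norm_of_A_lt hA)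
  have hψ := norm_ψ_le hA
  rw [div_lt_iff₀ hδ] at h1
  rw [div_lt_iff₀ hρ] at h2
  have i1 : ‖D.ψ ξ‖ < δ := by
    refine hψ.trans_lt ?_
    rw [← div_eq_mul_inv, div_lt_iff₀ h0]
    nlinarith
  have i2 : 2 * ‖D.ψ ξ‖ ≤ ρ := by
    have : 2 * ‖ξ‖⁻¹ ≤ ρ / 2 := by
      rw [← div_eq_mul_inv, div_le_iff₀ h0]; nlinarith
    linarith
  have i3 := h _ (ψ_mem hA) i1
  have := norm_le_norm_add_norm_sub' (f (D.ψ ξ)) (D.ψ ξ)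
  linarith

/-- One improvement step: a bound on a half-plane propagates to a larger half-plane. -/
theorem IsTangent.bound_step (hf : IsTangent Ω f) (hΩo : IsOpen Ω) (hR : ∀ z ∈ Ω, ‖z‖ < R)
    (hρ : 0 < ρ) (hρη : 2 * ρ ≤ D.η) (hρR : ρ ≤ R) {κ d : ℝ} (hκ : κ = ρ / (4 * R)) (hd : 0 < d)
    (hd' : 4 / (κ * ρ ^ 2) ≤ d)
    (h : ∀ ξ : ℂ, D.A + d < ξ.re → ‖f (D.ψ ξ)‖ ≤ ρ) :
    ∀ ξ : ℂ, D.A + (1 - κ / 2) * d < ξ.re → ‖f (D.ψ ξ)‖ ≤ ρ := by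
  have hR0 : 0 < R := hρ.trans_le hρR
  have hκ0 : 0 < κ := by rw [hκ]; positivity
  have hκR : 2 * R * κ = ρ / 2 := by rw [hκ]; field_simp; norm_num
  have hκ1 : κ < 1 := by rw [hκ, div_lt_one (by positivity)]; linarith
  have hκd : κ * d < d := by nlinarith
  have hη : ∀ ξ : ℂ, D.A + (1 - κ) * d < ξ.re → ‖f (D.ψ ξ)‖ < D.η := by
    intro ξ hξ
    set c : ℂ := ξ + ((κ * d : ℝ) : ℂ) with hc
    have hcre : c.re = ξ.re + κ * d := by rw [hc, add_re, ofReal_re]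
    have hcA : D.A + d < c.re := by rw [hcre]; linarith
    have hball : ∀ w ∈ ball c d, D.A < w.re := by
      intro w hw
      rw [mem_ball, dist_eq_norm] at hw
      have := (abs_re_le_norm (w - c)).trans_lt hw
      rw [sub_re, abs_lt] at this
      linarith [this.1]
    have hdiff : DifferentiableOn ℂ (fun ξ => f (D.ψ ξ)) (ball c d) := fun w hw =>
      (DifferentiableAt.comp w (hf.diff.differentiableAt (hΩo.mem_nhds (ψ_mem (hball w hw))))
        (differentiableAt_ψ (hball w hw))).differentiableWithinAt
    have hmaps : MapsTo (fun ξ => f (D.ψ ξ)) (ball c d) (ball (f (D.ψ c)) (2 * R)) := by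
      intro w hw
      have h1 := hR _ (hf.maps (ψ_mem (hball w hw)))
      have h2 := hR _ (hf.maps (ψ_mem (hball c (mem_ball_self hd))))
      rw [mem_ball, dist_eq_norm]
      have := norm_sub_le (f (D.ψ w)) (f (D.ψ c))
      linarith
    have hdist : dist ξ c = κ * d := by
      rw [dist_comm, dist_eq_norm, hc, add_sub_cancel_left, norm_real,
        Real.norm_of_nonneg (by positivity)]
    have key := Complex.dist_le_div_mul_dist_of_mapsTo_ball hdiff (hmaps.mono_right ball_subset_closedBall) (z := ξ)
      (by rw [mem_ball, hdist]; exact hκd)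
    rw [hdist, dist_eq_norm] at key
    have e : 2 * R / d * (κ * d) = ρ / 2 := by rw [← hκR]; field_simp
    rw [e] at key
    have h3 := h c hcA
    have := norm_le_norm_add_norm_sub' (f (D.ψ ξ)) (f (D.ψ c))
    linarith
  intro ξ hξ
  have hκd0 : 0 < κ * d := by positivity
  have hξ' : D.A + (1 - κ) * d < ξ.re := by linarith
  have hj := hf.julia hΩo (A' := D.A + (1 - κ) * d) (by nlinarith) hη hξ'
  have hAξ : D.A < ξ.re := by nlinarith
  have h1 := norm_sq_le_of_inv_G_re (hη ξ hξ') (hf.maps (ψ_mem hAξ)) (b := κ * d / 2)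
    (by positivity) (by linarith)
  have h2 : 2 / (κ * d / 2) ≤ ρ ^ 2 := by
    rw [div_le_iff₀ (by positivity)] at hd' ⊢
    linarith
  exact abs_le_of_sq_le_sq' (h1.trans h2) hρ.le |>.2

/-- All tangent self-maps are controlled on a common half-plane. -/
theorem exists_uniform (D : NormData Ω) (hΩo : IsOpen Ω) (hbd : Bornology.IsBounded Ω)
    (hρ : 0 < ρ) (hρη : 2 * ρ ≤ D.η) :
    ∃ A₁, D.A ≤ A₁ ∧ ∀ f, IsTangent Ω f → ∀ ξ : ℂ, A₁ < ξ.re →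
      ‖f (D.ψ ξ)‖ ≤ ρ ∧ ξ.re - A₁ ≤ (D.G (f (D.ψ ξ)))⁻¹.re := by
  obtain ⟨M, hM⟩ := hbd.exists_norm_le
  set R := max (M + 1) ρ with hRdef
  have hR : ∀ z ∈ Ω, ‖z‖ < R := fun z hz => (hM z hz).trans_lt (by
    have := le_max_left (M + 1) ρ; rw [← hRdef] at this; linarith)
  have hρR : ρ ≤ R := le_max_right _ _
  have hR0 : 0 < R := hρ.trans_le hρR
  set κ := ρ / (4 * R) with hκ
  have hκ0 : 0 < κ := by positivity
  have hκ1 : κ < 1 := by rw [hκ, div_lt_one (by positivity)]; linarith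
  set d₀ := 4 / (κ * ρ ^ 2) with hd₀
  have hd₀0 : 0 < d₀ := by positivity
  refine ⟨D.A + d₀, by linarith, fun f hf => ?_⟩
  have hS : ∀ ξ : ℂ, D.A + d₀ < ξ.re → ‖f (D.ψ ξ)‖ ≤ ρ := by
    have ind : ∀ n : ℕ, ∀ d : ℝ, 0 < d → (1 - κ / 2) ^ n * d ≤ d₀ →
        (∀ ξ : ℂ, D.A + d < ξ.re → ‖f (D.ψ ξ)‖ ≤ ρ) →
        ∀ ξ : ℂ, D.A + d₀ < ξ.re → ‖f (D.ψ ξ)‖ ≤ ρ := by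
      intro n
      induction n with
      | zero => intro d _ h1 h2 ξ hξ; exact h2 ξ (by simp at h1; linarith)
      | succ n ih =>
        intro d hd h1 h2 ξ hξ
        by_cases hdd : d ≤ d₀
        · exact h2 ξ (by linarith)
        · refine ih ((1 - κ / 2) * d) (mul_pos (by linarith) hd) ?_ ?_ ξ hξ
          · rw [← mul_assoc, ← pow_succ]; exact h1
          · exact hf.bound_step hΩo hR hρ hρη hρR hκ hd (not_le.1 hdd).le h2
    obtain ⟨A', hA', hb⟩ := hf.exists_bound (D := D) hρ
    set d := A' - D.A + 1
    have hd : 0 < d := by simp only [d]; linarith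
    obtain ⟨n, hn⟩ := exists_pow_lt_of_lt_one (div_pos hd₀0 hd) (show 1 - κ / 2 < 1 by linarith)
    refine ind n d hd ((lt_div_iff₀ hd).1 hn).le fun ξ hξ => hb ξ ?_
    simp only [d] at hξ; linarith
  exact fun ξ hξ => ⟨hS ξ hξ, hf.julia hΩo (by linarith)
    (fun ξ hξ => (hS ξ hξ).trans_lt (by linarith)) hξ⟩

end Uniform

end NormData

variable {n : ℕ}

/-- A one-parameter family behaving like the iterates of a map, uniformly close to linear
isometries. -/
structure NearIso (ε : ℝ) (g : ℕ → En n → En n) : Prop where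
  diff : ∀ k, DifferentiableOn ℂ (g k) (ball 0 (3 / 4))
  near : ∀ k, ∃ U : En n →ₗᵢ[ℂ] En n, ∀ u ∈ ball (0 : En n) (3 / 4), ‖g k u - U u‖ ≤ ε
  zero : ∀ u ∈ ball (0 : En n) (3 / 4), g 0 u = u
  succ : ∀ k, ∀ u ∈ ball (0 : En n) (1 / 2), g (k + 1) u = g k (g 1 u)

namespace NearIso

theorem ball_sub {u : En n} (hu : u ∈ ball (0 : En n) (1 / 2)) :
    ball u (1 / 4) ⊆ ball (0 : En n) (3 / 4) := by
  intro w hw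
  rw [mem_ball] at *
  linarith [dist_triangle w u 0]

section Fixed

variable {f : En n → En n} {U : En n →ₗᵢ[ℂ] En n} {ε : ℝ}

theorem norm_fderiv_sub_le (hd : DifferentiableOn ℂ f (ball 0 (3 / 4)))
    (h : ∀ u ∈ ball (0 : En n) (3 / 4), ‖f u - U u‖ ≤ ε) {u : En n}
    (hu : u ∈ ball (0 : En n) (1 / 2)) :
    ‖fderiv ℂ f u - U.toContinuousLinearMap‖ ≤ 8 * ε := by
  have hs := ball_sub hu
  have h1 : DifferentiableAt ℂ f u := hd.differentiableAt
    (isOpen_ball.mem_nhds (hs (mem_ball_self (by norm_num))))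
  have h2 := norm_fderiv_le_of_bound (f := fun u => f u - U.toContinuousLinearMap u) (z := u)
    (R := 1 / 4) (M := ε) (by norm_num)
    ((hd.mono hs).sub U.toContinuousLinearMap.differentiable.differentiableOn)
    (fun w hw => h w (hs hw))
  rw [fderiv_fun_sub h1 U.toContinuousLinearMap.differentiableAt,
    ContinuousLinearMap.fderiv] at h2
  linarith

theorem norm_sub_sub_le (hd : DifferentiableOn ℂ f (ball 0 (3 / 4)))
    (h : ∀ u ∈ ball (0 : En n) (3 / 4), ‖f u - U u‖ ≤ ε) {u v : En n}
    (hu : u ∈ ball (0 : En n) (1 / 2)) (hv : v ∈ ball (0 : En n) (1 / 2)) :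
    ‖f u - f v - U (u - v)‖ ≤ 8 * ε * ‖u - v‖ := by
  have h3 : ∀ w ∈ ball (0 : En n) (1 / 2), DifferentiableAt ℂ f w := fun w hw =>
    hd.differentiableAt (isOpen_ball.mem_nhds (ball_sub hw (mem_ball_self (by norm_num))))
  have := (convex_ball (0 : En n) (1 / 2)).norm_image_sub_le_of_norm_hasFDerivWithin_le'
    (f := f) (f' := fderiv ℂ f) (φ := U.toContinuousLinearMap) (C := 8 * ε)
    (fun w hw => (h3 w hw).hasFDerivAt.hasFDerivWithinAt)
    (fun w hw => norm_fderiv_sub_le hd h hw) hv hu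
  simpa using this

theorem norm_midpoint_le (hd : DifferentiableOn ℂ f (ball 0 (3 / 4)))
    (h : ∀ u ∈ ball (0 : En n) (3 / 4), ‖f u - U u‖ ≤ ε) {u v : En n}
    (hu : u ∈ ball (0 : En n) (1 / 2)) (hv : ‖v‖ < 1 / 4) :
    ‖f (u + v) + f (u - v) - (2 : ℝ) • f u‖ ≤ 128 * ε * ‖v‖ ^ 2 := by
  have hs := ball_sub hu
  set k : En n → En n := fun u => f u - U.toContinuousLinearMap u with hk
  have hkd : DifferentiableOn ℂ k (ball u (1 / 4)) :=
    (hd.mono hs).sub U.toContinuousLinearMap.differentiable.differentiableOn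
  have h1 := norm_remainder_le_of_bound (f := k) (z := u) (R := 1 / 4) (M := ε) (w := u + v)
    (by norm_num) hkd (fun w hw => h w (hs hw)) (by simpa using hv)
  have h2 := norm_remainder_le_of_bound (f := k) (z := u) (R := 1 / 4) (M := ε) (w := u - v)
    (by norm_num) hkd (fun w hw => h w (hs hw)) (by simpa using hv)
  have e : f (u + v) + f (u - v) - (2 : ℝ) • f u =
      (k (u + v) - k u - fderiv ℂ k u (u + v - u)) +
      (k (u - v) - k u - fderiv ℂ k u (u - v - u)) := by
    have e1 : u + v - u = v := by abel
    have e2 : u - v - u = -v := by abel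
    rw [e1, e2, map_neg, two_smul]
    simp only [hk, map_add, map_sub]
    abel
  rw [e]
  refine (norm_add_le _ _).trans ((add_le_add h1 h2).trans (le_of_eq ?_))
  simp
  ring

end Fixed

variable {ε : ℝ} {g : ℕ → En n → En n}

theorem norm_le (H : NearIso ε g) (k : ℕ) {u : En n} (hu : u ∈ ball (0 : En n) (3 / 4)) :
    ‖g k u‖ ≤ ‖u‖ + ε := by
  obtain ⟨U, hU⟩ := H.near k
  have := norm_le_norm_add_norm_sub' (g k u) (U u)
  rw [U.norm_map] at this
  linarith [hU u hu]

theorem norm_sub_le (H : NearIso ε g) (k : ℕ) {u v : En n} (hu : u ∈ ball (0 : En n) (1 / 2))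
    (hv : v ∈ ball (0 : En n) (1 / 2)) : ‖g k u - g k v‖ ≤ (1 + 8 * ε) * ‖u - v‖ := by
  obtain ⟨U, hU⟩ := H.near k
  have h1 := norm_sub_sub_le (H.diff k) hU hu hv
  have := norm_le_norm_add_norm_sub' (g k u - g k v) (U (u - v))
  rw [U.norm_map] at this
  linarith

theorem le_norm_sub (H : NearIso ε g) (k : ℕ) {u v : En n} (hu : u ∈ ball (0 : En n) (1 / 2))
    (hv : v ∈ ball (0 : En n) (1 / 2)) : (1 - 8 * ε) * ‖u - v‖ ≤ ‖g k u - g k v‖ := by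
  obtain ⟨U, hU⟩ := H.near k
  have h1 := norm_sub_sub_le (H.diff k) hU hu hv
  have := norm_le_norm_add_norm_sub (g k u - g k v) (U (u - v))
  rw [U.norm_map] at this
  linarith

/-- The members of a near-isometric family have a common almost central fixed point. -/
theorem exists_fixed (H : NearIso ε g) (hε0 : 0 ≤ ε) (hε : ε ≤ 1 / 1000) :
    ∃ c, ‖c‖ ≤ ε ∧ g 1 c = c := by
  set K := closedBall (0 : En n) (1 / 8)
  have hK2 : K ⊆ ball (0 : En n) (1 / 2) := closedBall_subset_ball (by norm_num)
  have h23 : ball (0 : En n) (1 / 2) ⊆ ball (0 : En n) (3 / 4) := ball_subset_ball (by norm_num)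
  set v : En n → ℝ := fun u => ⨆ k, ‖g k u‖ ^ 2 with hv
  have hle1 : ∀ k, ∀ u ∈ ball (0 : En n) (1 / 2), ‖g k u‖ ≤ 1 := fun k u hu => by
    have := H.norm_le k (h23 hu)
    rw [mem_ball_zero_iff] at hu
    linarith
  have hbdd : ∀ u ∈ ball (0 : En n) (1 / 2), BddAbove (range fun k => ‖g k u‖ ^ 2) := by
    rintro u hu
    refine ⟨1, ?_⟩
    rintro _ ⟨k, rfl⟩
    exact pow_le_one₀ (norm_nonneg _) (hle1 k u hu)
  have hvk : ∀ u ∈ ball (0 : En n) (1 / 2), ∀ k, ‖g k u‖ ^ 2 ≤ v u := fun u hu k =>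
    le_ciSup (hbdd u hu) k
  have hlip : ContinuousOn v K := by
    refine (LipschitzOnWith.of_le_add_mul (K := 4) ?_).continuousOn
    intro x hx y hy
    refine ciSup_le fun k => ?_
    have h1 := H.norm_sub_le k (hK2 hx) (hK2 hy)
    have h2 := hle1 k x (hK2 hx)
    have h3 := hle1 k y (hK2 hy)
    have h4 := hvk y (hK2 hy) k
    have h5 : ‖g k x‖ ≤ ‖g k y‖ + ‖g k x - g k y‖ := norm_le_norm_add_norm_sub' _ _
    have h6 : ‖g k x - g k y‖ ≤ 2 * ‖x - y‖ := h1.trans (by gcongr; linarith)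
    rw [dist_eq_norm]
    push_cast
    have h7 : ‖g k x‖ ^ 2 - ‖g k y‖ ^ 2 = (‖g k x‖ - ‖g k y‖) * (‖g k x‖ + ‖g k y‖) := by ring
    have h8 : (‖g k x‖ - ‖g k y‖) * (‖g k x‖ + ‖g k y‖) ≤ 2 * ‖x - y‖ * 2 := by
      calc _ ≤ (2 * ‖x - y‖) * (‖g k x‖ + ‖g k y‖) := by gcongr; linarith
        _ ≤ _ := by gcongr; linarith
    linarith
  obtain ⟨c, hcK, hc⟩ := (isCompact_closedBall (0 : En n) (1 / 8)).exists_isMinOn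
    ⟨0, mem_closedBall_self (by norm_num)⟩ hlip
  have h0 : v 0 ≤ ε ^ 2 := ciSup_le fun k => by
    have := H.norm_le k (mem_ball_self (x := (0 : En n)) (by norm_num : (0 : ℝ) < 3 / 4))
    rw [norm_zero, zero_add] at this
    gcongr
  have hvc : v c ≤ ε ^ 2 := (hc (mem_closedBall_self (by norm_num))).trans h0
  have hck : ∀ k, ‖g k c‖ ≤ ε := fun k =>
    abs_le_of_sq_le_sq' ((hvk c (hK2 hcK) k).trans hvc) hε0 |>.2
  have hcε : ‖c‖ ≤ ε := by
    have := hck 0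
    rwa [H.zero c (h23 (hK2 hcK))] at this
  refine ⟨c, hcε, ?_⟩
  set y := g 1 c with hy
  have hyε : ‖y‖ ≤ ε := hck 1
  have hyK : y ∈ ball (0 : En n) (1 / 2) := by rw [mem_ball_zero_iff]; linarith
  have hvy : ∀ k, ‖g k y‖ ^ 2 ≤ v c := fun k => by
    rw [hy, ← H.succ k c (hK2 hcK)]; exact hvk c (hK2 hcK) (k + 1)
  set a := (1 / 2 : ℝ) • (c + y) with ha
  set h := (1 / 2 : ℝ) • (c - y) with hh
  have e1 : a + h = c := by
    rw [ha, hh, ← smul_add, add_add_sub_cancel, ← two_smul ℝ c, smul_smul]; norm_num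
  have e2 : a - h = y := by
    rw [ha, hh, ← smul_sub, add_sub_sub_cancel, ← two_smul ℝ y, smul_smul]; norm_num
  have e3 : c - y = (2 : ℝ) • h := by rw [hh, smul_smul]; norm_num
  have haε : ‖a‖ ≤ ε := by
    rw [ha, norm_smul]
    have := norm_add_le c y
    norm_num
    linarith
  have hhε : ‖h‖ ≤ ε := by
    rw [hh, norm_smul]
    have := _root_.norm_sub_le c y
    norm_num
    linarith
  have haK : a ∈ ball (0 : En n) (1 / 2) := by rw [mem_ball_zero_iff]; linarith
  have hva : v a ≤ v c - ‖h‖ ^ 2 / 4 := by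
    refine ciSup_le fun k => ?_
    obtain ⟨U, hU⟩ := H.near k
    have i1 := norm_midpoint_le (H.diff k) hU haK (v := h) (by linarith)
    rw [e1, e2] at i1
    have i2 := H.le_norm_sub k (hK2 hcK) hyK
    rw [e3, norm_smul, Real.norm_of_nonneg zero_le_two] at i2
    have i3 := parallelogram_law_with_norm ℂ (g k c) (g k y)
    have i4 := hvk c (hK2 hcK) k
    have i5 := hvy k
    have i6 : ‖(2 : ℝ) • g k a‖ ≤ ‖g k c + g k y‖ + ‖g k c + g k y - (2 : ℝ) • g k a‖ :=
      norm_le_norm_add_norm_sub _ _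
    rw [norm_smul, Real.norm_of_nonneg zero_le_two] at i6
    have i7 : ‖g k c + g k y‖ ≤ 2 * ε := by
      have i8 : ‖g k y‖ ≤ ε := abs_le_of_sq_le_sq' (i5.trans hvc) hε0 |>.2
      have := norm_add_le (g k c) (g k y)
      linarith [hck k]
    generalize ‖g k c + g k y - (2 : ℝ) • g k a‖ = e at *
    generalize ‖g k c + g k y‖ = s at *
    have hh0 := norm_nonneg h
    have hh2 : ‖h‖ ^ 2 ≤ ε ^ 2 := by gcongr
    have j1 : 3 / 2 * ‖h‖ ≤ ‖g k c - g k y‖ := by nlinarith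
    have j2 : 9 / 4 * ‖h‖ ^ 2 ≤ ‖g k c - g k y‖ ^ 2 := by
      calc 9 / 4 * ‖h‖ ^ 2 = (3 / 2 * ‖h‖) ^ 2 := by ring
        _ ≤ _ := by gcongr
    have j3 : e ≤ ‖h‖ ^ 2 := i1.trans (by nlinarith [sq_nonneg ‖h‖])
    have j4 : (2 * ‖g k a‖) ^ 2 ≤ s ^ 2 + ‖h‖ ^ 2 / 4 := by
      have hs0 : 0 ≤ s + ‖h‖ ^ 2 := by
        have := norm_nonneg (g k a)
        linarith
      calc (2 * ‖g k a‖) ^ 2 ≤ (s + ‖h‖ ^ 2) ^ 2 := by gcongr; linarith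
        _ = s ^ 2 + ‖h‖ ^ 2 * (2 * s + ‖h‖ ^ 2) := by ring
        _ ≤ s ^ 2 + ‖h‖ ^ 2 * (1 / 4) := by gcongr; nlinarith
        _ = _ := by ring
    nlinarith
  have haK' : a ∈ K := by rw [mem_closedBall_zero_iff]; linarith
  have := hc haK'

  have hh2 : ‖h‖ ^ 2 ≤ 0 := by
    have : v c ≤ v a := this
    linarith
  have hh3 : h = 0 := by
    rw [← norm_eq_zero]; exact pow_eq_zero_iff two_ne_zero |>.1 (le_antisymm hh2 (sq_nonneg _))
  rw [hh3, smul_zero, sub_eq_zero] at e3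
  exact e3.symm

end NearIso

/-- If all powers of `A` and `B` stay close to common isometries, `A` and `B` have the same
power traces. -/
theorem trace_eq_of_powers_close {n : ℕ} {A B : En n →L[ℂ] En n} {ε : ℝ} (hε : ε ≤ 1 / 8)
    (h : ∀ k : ℕ, ∃ U : En n →ₗᵢ[ℂ] En n, ‖A ^ k - U.toContinuousLinearMap‖ ≤ ε ∧
      ‖B ^ k - U.toContinuousLinearMap‖ ≤ ε) (k : ℕ) :
    LinearMap.trace ℂ (En n) (A ^ k : En n →L[ℂ] En n) =
      LinearMap.trace ℂ (En n) (B ^ k : En n →L[ℂ] En n) := by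
  have : ProperSpace (En n →L[ℂ] En n) := FiniteDimensional.proper ℂ _
  have hlow : ∀ k : ℕ, ∀ x, 1 / 2 * ‖x‖ ≤ ‖(A ^ k) x‖ := by
    intro k x
    obtain ⟨U, h1, -⟩ := h k
    have h2 := ((A ^ k - U.toContinuousLinearMap).le_opNorm x).trans
      (mul_le_mul_of_nonneg_right h1 (norm_nonneg x))
    have h3 := norm_le_norm_add_norm_sub ((A ^ k) x) (U x)
    rw [U.norm_map] at h3
    have h4 : (A ^ k - U.toContinuousLinearMap) x = (A ^ k) x - U x := rfl
    rw [h4] at h2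
    nlinarith [norm_nonneg x]
  obtain ⟨C, hAC, hCA⟩ : ∃ C : En n →L[ℂ] En n, A * C = 1 ∧ C * A = 1 := by
    have hinj : Injective (A : En n →ₗ[ℂ] En n) := by
      rw [← LinearMap.ker_eq_bot, LinearMap.ker_eq_bot']
      intro x hx
      have := hlow 1 x
      rw [pow_one, show A x = 0 from hx, norm_zero] at this
      exact norm_eq_zero.1 (by linarith [norm_nonneg x])
    set e := (LinearEquiv.ofInjectiveEndo (A : En n →ₗ[ℂ] En n) hinj).toContinuousLinearEquiv
    have he : ∀ x, e x = A x := fun x => rfl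
    refine ⟨(e.symm : En n →L[ℂ] En n), ?_, ?_⟩
    · ext1 x
      show A (e.symm x) = x
      rw [← he]; simp
    · ext1 x
      show e.symm (A x) = x
      rw [← he]; simp
  have hCk : ∀ k : ℕ, A ^ k * C ^ k = 1 ∧ C ^ k * A ^ k = 1 := fun k => by
    have hcomm : Commute A C := by rw [Commute, SemiconjBy, hAC, hCA]
    rw [← hcomm.mul_pow, ← hcomm.symm.mul_pow, hAC, hCA, one_pow]
    exact ⟨rfl, rfl⟩
  have hCn : ∀ k : ℕ, ‖C ^ k‖ ≤ 2 := fun k => by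
    refine ContinuousLinearMap.opNorm_le_bound _ zero_le_two fun x => ?_
    have h1 := hlow k ((C ^ k) x)
    have h2 : (A ^ k) ((C ^ k) x) = x := by
      show (A ^ k * C ^ k) x = x
      rw [(hCk k).1]; rfl
    rw [h2] at h1
    linarith
  have hT : ∀ k : ℕ, ‖C ^ k * B ^ k - 1‖ ≤ 1 / 2 := fun k => by
    obtain ⟨U, h1, h2⟩ := h k
    have e : C ^ k * B ^ k - 1 = C ^ k * ((B ^ k - U.toContinuousLinearMap) -
        (A ^ k - U.toContinuousLinearMap)) := by
      rw [sub_sub_sub_cancel_right, mul_sub, (hCk k).2]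
    rw [e]
    calc _ ≤ ‖C ^ k‖ * (‖B ^ k - U.toContinuousLinearMap‖ + ‖A ^ k - U.toContinuousLinearMap‖) :=
          (norm_mul_le _ _).trans (by gcongr; exact norm_sub_le _ _)
      _ ≤ 2 * (1 / 8 + 1 / 8) := by gcongr; exacts [hCn k, h2.trans hε, h1.trans hε]
      _ = 1 / 2 := by norm_num
  set S : ℕ → (En n →L[ℂ] En n) := fun N =>
    (((N + 1 : ℕ) : ℂ)⁻¹) • ∑ i ∈ Finset.range (N + 1), C ^ i * B ^ i with hS
  have hS1 : ∀ N, ‖S N - 1‖ ≤ 1 / 2 := by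
    intro N
    have hN : (0 : ℝ) < N + 1 := by positivity
    have hN' : ((N + 1 : ℕ) : ℂ) ≠ 0 := by exact_mod_cast hN.ne'
    have e : S N - 1 = (((N + 1 : ℕ) : ℂ)⁻¹) • ∑ i ∈ Finset.range (N + 1), (C ^ i * B ^ i - 1) := by
      rw [Finset.sum_sub_distrib, smul_sub, Finset.sum_const, Finset.card_range, hS,
        ← Nat.cast_smul_eq_nsmul ℂ, smul_smul, inv_mul_cancel₀ hN', one_smul]
    rw [e, norm_smul, norm_inv, Complex.norm_natCast, Nat.cast_add_one]
    calc _ ≤ (N + 1 : ℝ)⁻¹ * ∑ i ∈ Finset.range (N + 1), (1 / 2 : ℝ) := by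
          gcongr
          exact (norm_sum_le _ _).trans (Finset.sum_le_sum fun i _ => hT i)
      _ = 1 / 2 := by
          rw [Finset.sum_const, Finset.card_range, nsmul_eq_mul]; push_cast; field_simp
  have hS2 : ∀ N, C * S N * B - S N = (((N + 1 : ℕ) : ℂ)⁻¹) • (C ^ (N + 1) * B ^ (N + 1) - 1) := by
    intro N
    have : ∀ i, C * (C ^ i * B ^ i) * B = C ^ (i + 1) * B ^ (i + 1) := fun i => by
      rw [pow_succ' C, pow_succ B]; simp only [mul_assoc]
    have e : C * (∑ i ∈ Finset.range (N + 1), C ^ i * B ^ i) * B -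
        ∑ i ∈ Finset.range (N + 1), C ^ i * B ^ i = C ^ (N + 1) * B ^ (N + 1) - 1 := by
      rw [Finset.mul_sum, Finset.sum_mul, ← Finset.sum_sub_distrib]
      simp only [this]
      rw [Finset.sum_range_sub (fun i => C ^ i * B ^ i)]
      simp
    rw [← e, hS]
    simp only
    rw [mul_smul_comm, smul_mul_assoc]
    exact (smul_sub _ _ _).symm
  obtain ⟨T, hTl⟩ := exists_tendsto_of_bounded (l := hyperfilter ℕ) (x := S) (M := ‖(1 : En n →L[ℂ] En n)‖ + 1 / 2)
    (Eventually.of_forall fun N => by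
      have := norm_le_norm_add_norm_sub' (S N) 1
      linarith [hS1 N])
  have hT1 : ‖T - 1‖ ≤ 1 / 2 := le_of_tendsto ((hTl.sub_const 1).norm)
    (Eventually.of_forall hS1)
  have hT2 : C * T * B - T = 0 := by
    have t1 : Tendsto (fun N => C * S N * B - S N) (hyperfilter ℕ : Filter ℕ) (𝓝 (C * T * B - T)) :=
      ((hTl.const_mul C).mul_const B).sub hTl
    refine tendsto_nhds_unique t1 ?_
    have t2 : Tendsto (fun N : ℕ => (N + 1 : ℝ)⁻¹ * (1 / 2)) (hyperfilter ℕ : Filter ℕ) (𝓝 0) := by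
      have := (tendsto_one_div_add_atTop_nhds_zero_nat (𝕜 := ℝ)).mul_const (1 / 2)
      rw [zero_mul] at this
      refine (this.congr fun N => by rw [one_div]).mono_left ?_
      rw [← Nat.cofinite_eq_atTop]; exact hyperfilter_le_cofinite
    refine squeeze_zero_norm (fun N => ?_) t2
    rw [hS2, norm_smul, norm_inv, Complex.norm_natCast, Nat.cast_add_one]
    gcongr
    exact hT _
  have hTB : T * B = A * T := by
    rw [sub_eq_zero] at hT2
    calc T * B = A * C * T * B := by rw [hAC, one_mul]
      _ = A * (C * T * B) := by simp only [mul_assoc]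
      _ = A * T := by rw [hT2]
  have hTu : IsUnit T := by
    have := isUnit_one_sub_of_norm_lt_one (x := 1 - T) (by rw [norm_sub_rev]; linarith)
    rwa [sub_sub_cancel] at this
  obtain ⟨u, rfl⟩ := hTu
  have hB : B ^ k = ↑u⁻¹ * (A ^ k * u) := by
    have hs : SemiconjBy (u : En n →L[ℂ] En n) (B ^ k) (A ^ k) :=
      SemiconjBy.pow_right hTB k
    rw [← hs.eq, Units.inv_mul_cancel_left]
  have h2 : ((B ^ k : En n →L[ℂ] En n) : En n →ₗ[ℂ] En n) =
      ((↑u⁻¹ : En n →L[ℂ] En n) : En n →ₗ[ℂ] En n) * ((A ^ k * u : En n →L[ℂ] En n) : En n →ₗ[ℂ] En n) := by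
    rw [hB]; rfl
  rw [h2, LinearMap.trace_mul_comm]
  congr 1
  have h3 : A ^ k * ↑u * ↑u⁻¹ = A ^ k := by rw [mul_assoc, Units.mul_inv, mul_one]
  conv_lhs => rw [← h3]
  rfl

namespace NearIso

variable {n : ℕ} {ε : ℝ} {g : ℕ → En n → En n}

theorem fderiv_eq_pow (H : NearIso ε g) {c : En n}
    (hc : c ∈ ball (0 : En n) (1 / 2)) (h1 : g 1 c = c) (k : ℕ) :
    fderiv ℂ (g k) c = fderiv ℂ (g 1) c ^ k := by
  have hc' : c ∈ ball (0 : En n) (3 / 4) := ball_subset_ball (by norm_num) hc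
  have hd : ∀ k, DifferentiableAt ℂ (g k) c := fun k =>
    (H.diff k).differentiableAt (isOpen_ball.mem_nhds hc')
  induction k with
  | zero =>
    have : g 0 =ᶠ[𝓝 c] id := by
      filter_upwards [isOpen_ball.mem_nhds hc'] with u hu using H.zero u hu
    rw [this.fderiv_eq, fderiv_id, pow_zero]; rfl
  | succ k ih =>
    have : g (k + 1) =ᶠ[𝓝 c] (g k ∘ g 1) := by
      filter_upwards [isOpen_ball.mem_nhds hc] with u hu using H.succ k u hu
    rw [this.fderiv_eq, fderiv_comp c (by rw [h1]; exact hd k) (hd 1), h1, ih, pow_succ]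
    rfl

theorem trace_eq (H : NearIso ε g) (hε : ε ≤ 1 / 64) {c d : En n}
    (hc : c ∈ ball (0 : En n) (1 / 2)) (hd : d ∈ ball (0 : En n) (1 / 2)) (hgc : g 1 c = c)
    (hgd : g 1 d = d) (k : ℕ) :
    LinearMap.trace ℂ (En n) (fderiv ℂ (g k) c) = LinearMap.trace ℂ (En n) (fderiv ℂ (g k) d) := by
  rw [H.fderiv_eq_pow hc hgc, H.fderiv_eq_pow hd hgd]
  refine trace_eq_of_powers_close le_rfl (fun k => ?_) k
  obtain ⟨U, hU⟩ := H.near k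
  refine ⟨U, ?_, ?_⟩
  · rw [← H.fderiv_eq_pow hc hgc]
    exact (norm_fderiv_sub_le (H.diff k) hU hc).trans (by linarith)
  · rw [← H.fderiv_eq_pow hd hgd]
    exact (norm_fderiv_sub_le (H.diff k) hU hd).trans (by linarith)

end NearIso

/-- A linear isometry whose trace is close to the dimension is close to the identity. -/
theorem norm_sub_le_of_trace {n : ℕ} (U : En n →ₗᵢ[ℂ] En n) {δ : ℝ}
    (h : n - δ ≤ (LinearMap.trace ℂ (En n) U.toLinearMap).re) (x : En n) :
    ‖U x - x‖ ≤ n * √(2 * δ) * ‖x‖ := by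
  set b := EuclideanSpace.basisFun (Fin n) ℂ with hb
  have htr : (LinearMap.trace ℂ (En n) U.toLinearMap).re = ∑ i, (inner ℂ (b i) (U (b i))).re := by
    rw [LinearMap.trace_eq_sum_inner _ b, re_sum]; rfl
  have hle : ∀ i, (inner ℂ (b i) (U (b i))).re ≤ 1 := fun i => by
    have h1 := (re_le_norm (inner ℂ (b i) (U (b i)))).trans (norm_inner_le_norm (b i) (U (b i)))
    rw [U.norm_map, b.orthonormal.1 i] at h1
    linarith
  have hi : ∀ i, ‖U (b i) - b i‖ ≤ √(2 * δ) := fun i => by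
    apply Real.le_sqrt_of_sq_le
    rw [@norm_sub_sq ℂ, U.norm_map, b.orthonormal.1 i, ← inner_conj_symm]
    have h2 : ∑ j, (1 - (inner ℂ (b j) (U (b j))).re) ≤ δ := by
      rw [Finset.sum_sub_distrib, ← htr]; simp; linarith
    have h3 := (Finset.single_le_sum (f := fun j => 1 - (inner ℂ (b j) (U (b j))).re)
      (fun j _ => sub_nonneg.2 (hle j)) (Finset.mem_univ i)).trans h2
    simp only [RCLike.re_eq_complex_re, conj_re]
    linarith
  have hx : U x - x = ∑ i, (inner ℂ (b i) x) • (U (b i) - b i) := by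
    conv_lhs => rw [← b.sum_repr' x]
    rw [map_sum, ← Finset.sum_sub_distrib]
    simp only [map_smul, smul_sub]
  rw [hx]
  calc _ ≤ ∑ i : Fin n, ‖x‖ * √(2 * δ) := by
        refine (norm_sum_le _ _).trans (Finset.sum_le_sum fun i _ => ?_)
        rw [norm_smul]
        gcongr
        · have := norm_inner_le_norm (𝕜 := ℂ) (b i) x
          rwa [b.orthonormal.1 i, one_mul] at this
        · exact hi i
    _ = _ := by rw [Finset.sum_const, Finset.card_univ, Fintype.card_fin, nsmul_eq_mul]; ring

theorem norm_trace_le {n : ℕ} (A : En n →L[ℂ] En n) :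
    ‖LinearMap.trace ℂ (En n) A‖ ≤ n * ‖A‖ := by
  set b := EuclideanSpace.basisFun (Fin n) ℂ with hb
  rw [LinearMap.trace_eq_sum_inner _ b]
  calc _ ≤ ∑ i : Fin n, ‖A‖ := by
        refine (norm_sum_le _ _).trans (Finset.sum_le_sum fun i _ => ?_)
        refine (norm_inner_le_norm _ _).trans ?_
        have := A.le_opNorm (b i)
        rw [b.orthonormal.1 i, mul_one] at this
        rw [b.orthonormal.1 i, one_mul]
        exact this
    _ = _ := by rw [Finset.sum_const, Finset.card_univ, Fintype.card_fin, nsmul_eq_mul]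

namespace NearIso

variable {n : ℕ} {ε : ℝ} {g : ℕ → En n → En n}

/-- A near-isometric family with full traces at a fixed point is trivial. -/
theorem eq_id (H : NearIso ε g) (hε : ε ≤ 1 / 64)
    (hε2 : n * √(2 * (n * (8 * ε))) ≤ 1 / 4) {c : En n}
    (hc : c ∈ ball (0 : En n) (1 / 2))
    (htr : ∀ k, LinearMap.trace ℂ (En n) (fderiv ℂ (g k) c) = n) :
    ∀ u ∈ ball (0 : En n) (1 / 4), g 1 u = u := by
  have hk : ∀ k, ∀ u ∈ ball (0 : En n) (1 / 2), ∀ v ∈ ball (0 : En n) (1 / 2),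
      ‖g k u - g k v - (u - v)‖ ≤ 1 / 2 * ‖u - v‖ := by
    intro k u hu v hv
    obtain ⟨U, hU⟩ := H.near k
    have h1 := norm_sub_sub_le (H.diff k) hU hu hv
    have h2 := norm_fderiv_sub_le (H.diff k) hU hc
    have h3 := (norm_trace_le (fderiv ℂ (g k) c - U.toContinuousLinearMap)).trans
      (mul_le_mul_of_nonneg_left h2 (Nat.cast_nonneg n))
    have h4 : LinearMap.trace ℂ (En n) (fderiv ℂ (g k) c - U.toContinuousLinearMap :
        En n →L[ℂ] En n) = n - LinearMap.trace ℂ (En n) U.toLinearMap := by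
      rw [← htr k, ← map_sub]; rfl
    rw [h4] at h3
    have h5 := (re_le_norm _).trans h3
    rw [sub_re, natCast_re] at h5
    have h6 := norm_sub_le_of_trace U (δ := n * (8 * ε)) (by linarith) (u - v)
    have h7 := norm_add_le (g k u - g k v - U (u - v)) (U (u - v) - (u - v))
    rw [sub_add_sub_cancel] at h7
    have h8 := mul_le_mul_of_nonneg_right hε2 (norm_nonneg (u - v))
    have h9 : 8 * ε * ‖u - v‖ ≤ 1 / 8 * ‖u - v‖ := by gcongr; linarith
    have h0 := norm_nonneg (u - v)
    linarith
  intro u hu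
  have hu2 : u ∈ ball (0 : En n) (1 / 2) := ball_subset_ball (by norm_num) hu
  have hu3 : u ∈ ball (0 : En n) (3 / 4) := ball_subset_ball (by norm_num) hu
  have hle : ∀ k, ‖g k u‖ < 1 / 2 := fun k => by
    have := H.norm_le k hu3
    rw [mem_ball_zero_iff] at hu
    linarith
  have hw : g 1 u ∈ ball (0 : En n) (1 / 2) := by rw [mem_ball_zero_iff]; exact hle 1
  set w := g 1 u with hwdef
  have hN : ∀ N : ℕ, N * ‖w - u‖ ≤ 2 := by
    intro N
    have h1 : ‖∑ k ∈ Finset.range N, (g k w - g k u - (w - u))‖ ≤ N * (1 / 2 * ‖w - u‖) := by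
      refine (norm_sum_le_of_le _ fun k _ => hk k w hw u hu2).trans (le_of_eq ?_)
      rw [Finset.sum_const, Finset.card_range, nsmul_eq_mul]
    have h2 : ∑ k ∈ Finset.range N, (g k w - g k u - (w - u)) = (g N u - g 0 u) - (N : ℝ) • (w - u) := by
      rw [Finset.sum_sub_distrib, Finset.sum_const, Finset.card_range,
        ← Nat.cast_smul_eq_nsmul ℝ]
      congr 1
      rw [← Finset.sum_range_sub (fun k => g k u)]
      exact Finset.sum_congr rfl fun k _ => by rw [H.succ k u hu2]
    rw [h2] at h1
    have h3' : ‖(N : ℝ) • (w - u)‖ ≤ ‖g N u - g 0 u‖ + ‖g N u - g 0 u - (N : ℝ) • (w - u)‖ :=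
      norm_le_norm_add_norm_sub _ _
    rw [norm_smul, Real.norm_of_nonneg (Nat.cast_nonneg N)] at h3'
    have h4 := _root_.norm_sub_le (g N u) (g 0 u)
    linarith [hle N, hle 0]
  by_contra hne
  have hpos : 0 < ‖w - u‖ := norm_pos_iff.2 (sub_ne_zero.2 hne)
  obtain ⟨N, hN2⟩ := exists_nat_gt (2 / ‖w - u‖)
  rw [div_lt_iff₀ hpos] at hN2
  linarith [hN N]

end NearIso

namespace NormData

variable {m : ℕ} {Ω : Set (En (m + 1))}

/-- Self-maps of `Ω` satisfying a Julia inequality along the normal disc. -/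
structure IsJ (D : NormData Ω) (A₁ η₁ : ℝ) (f : En (m + 1) → En (m + 1)) : Prop where
  diff : DifferentiableOn ℂ f Ω
  maps : MapsTo f Ω Ω
  bound : ∀ ξ : ℂ, A₁ < ξ.re → ‖f (D.ψ ξ)‖ ≤ η₁
  julia : ∀ ξ : ℂ, A₁ < ξ.re → ξ.re - A₁ ≤ (D.G (f (D.ψ ξ)))⁻¹.re

/-- Mutually inverse automorphisms both satisfying the Julia inequality. -/
structure IsJPair (D : NormData Ω) (A₁ η₁ : ℝ) (f g : En (m + 1) → En (m + 1)) : Prop where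
  fst : D.IsJ A₁ η₁ f
  snd : D.IsJ A₁ η₁ g
  left_inv : ∀ z ∈ Ω, g (f z) = z
  right_inv : ∀ z ∈ Ω, f (g z) = z

variable {D : NormData Ω} {A₁ η₁ : ℝ} {f g : En (m + 1) → En (m + 1)}

theorem IsJPair.symm (h : D.IsJPair A₁ η₁ f g) : D.IsJPair A₁ η₁ g f :=
  ⟨h.snd, h.fst, h.right_inv, h.left_inv⟩

theorem IsJ.congr (hA : D.A ≤ A₁) (hf : D.IsJ A₁ η₁ f) (h : EqOn g f Ω) : D.IsJ A₁ η₁ g := by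
  refine ⟨hf.diff.congr h, hf.maps.congr h.symm, fun ξ hξ => ?_, fun ξ hξ => ?_⟩
  · rw [h (ψ_mem (hA.trans_lt hξ))]; exact hf.bound ξ hξ
  · rw [h (ψ_mem (hA.trans_lt hξ))]; exact hf.julia ξ hξ

theorem IsJ.of_tendsto {ι : Type*} {l : Ultrafilter ι} {f : ι → En (m + 1) → En (m + 1)}
    {φ : En (m + 1) → En (m + 1)} (hA : D.A ≤ A₁) (hη₁ : η₁ < D.η)
    (hf : ∀ᶠ j in (l : Filter ι), D.IsJ A₁ η₁ (f j))
    (h : ∀ z ∈ Ω, Tendsto (fun j => f j z) l (𝓝 (φ z)))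
    (hd : DifferentiableOn ℂ φ Ω) (hm : MapsTo φ Ω Ω) : D.IsJ A₁ η₁ φ := by
  have hb : ∀ ξ : ℂ, A₁ < ξ.re → ‖φ (D.ψ ξ)‖ ≤ η₁ := fun ξ hξ =>
    le_of_tendsto (h _ (ψ_mem (hA.trans_lt hξ))).norm (hf.mono fun j hj => hj.bound ξ hξ)
  refine ⟨hd, hm, hb, fun ξ hξ => ?_⟩
  have hψ := ψ_mem (D := D) (hA.trans_lt hξ)
  have h1 := ((D.differentiable_G.continuous.tendsto _).comp (h _ hψ)).inv₀
    (G_ne_zero ((hb ξ hξ).trans_lt hη₁) (hm hψ))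
  exact ge_of_tendsto ((continuous_re.tendsto _).comp h1) (hf.mono fun j hj => hj.julia ξ hξ)

/-- The standing situation: a domain with a normalized strongly pseudoconvex boundary point `0`,
an automorphism tangent to the identity there, whose orbits do not accumulate at nearby boundary
points. -/
structure Sys (D : NormData Ω) (η₁ : ℝ) (F G : En (m + 1) → En (m + 1)) : Prop where
  isOpen : IsOpen Ω
  preconn : IsPreconnected Ω
  bdd : Bornology.IsBounded Ω
  hreg : interior (closure Ω) ⊆ Ω
  tangent : IsTangent Ω F
  diff : DifferentiableOn ℂ G Ω
  maps : MapsTo G Ω Ω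
  left_inv : ∀ z ∈ Ω, G (F z) = z
  right_inv : ∀ z ∈ Ω, F (G z) = z
  η₁_pos : 0 < η₁
  η₁_le : 2 * η₁ ≤ D.η
  noEscape : ∀ l : Ultrafilter ℕ, ∀ o ∈ Ω, ∀ q ∈ frontier Ω, ‖q‖ ≤ η₁ →
    ¬ Tendsto (fun k => F^[k] o) l (𝓝 q)

section

variable {F G : En (m + 1) → En (m + 1)}

theorem iterate_left_inv (hFm : MapsTo F Ω Ω) (h : ∀ z ∈ Ω, G (F z) = z) (k : ℕ) :
    ∀ z ∈ Ω, G^[k] (F^[k] z) = z := by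
  induction k with
  | zero => intro z _; rfl
  | succ k ih =>
    intro z hz
    rw [iterate_succ_apply', iterate_succ_apply, ih _ (hFm hz), h z hz]

theorem differentiableOn_iterate (hFm : MapsTo F Ω Ω) (hF : DifferentiableOn ℂ F Ω) (k : ℕ) :
    DifferentiableOn ℂ (F^[k]) Ω := by
  induction k with
  | zero => exact differentiableOn_id
  | succ k ih => rw [iterate_succ]; exact ih.comp hF hFm

variable {ι : Type*} (l : Ultrafilter ι) (k : ι → ℕ)

theorem Sys.locBdd_F (S : Sys D η₁ F G) (l : Filter ι) : LocBdd l (fun j => F^[k j]) Ω := by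
  obtain ⟨M, hM⟩ := S.bdd.exists_norm_le
  exact LocBdd.of_bound S.isOpen M (fun j => differentiableOn_iterate S.tangent.maps S.tangent.diff _)
    fun j w hw => hM _ (S.tangent.maps.iterate _ hw)

theorem Sys.locBdd_G (S : Sys D η₁ F G) (l : Filter ι) : LocBdd l (fun j => G^[k j]) Ω := by
  obtain ⟨M, hM⟩ := S.bdd.exists_norm_le
  exact LocBdd.of_bound S.isOpen M (fun j => differentiableOn_iterate S.maps S.diff _)
    fun j w hw => hM _ (S.maps.iterate _ hw)

theorem Sys.exists_limits (S : Sys D η₁ F G) (hA : D.A ≤ A₁)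
    (hJ : ∀ k, D.IsJ A₁ η₁ (F^[k])) :
    ∃ φ γ : En (m + 1) → En (m + 1),
      (∀ z ∈ Ω, Tendsto (fun j => F^[k j] z) l (𝓝 (φ z))) ∧
      (∀ z ∈ Ω, Tendsto (fun j => G^[k j] z) l (𝓝 (γ z))) ∧
      DifferentiableOn ℂ φ Ω ∧ DifferentiableOn ℂ γ Ω ∧ MapsTo φ Ω Ω ∧ MapsTo γ Ω Ω ∧
      (∀ z ∈ Ω, γ (φ z) = z) ∧ ∀ z ∈ Ω, φ (γ z) = z := by
  have hf := S.locBdd_F k (l : Filter ι)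
  have hg := S.locBdd_G k (l : Filter ι)
  obtain ⟨φ, hφ⟩ := hf.exists_limit
  obtain ⟨γ, hγ⟩ := hg.exists_limit
  have hA1 : A₁ < ((A₁ + 1 : ℝ) : ℂ).re := by simp
  set o := D.ψ ((A₁ + 1 : ℝ) : ℂ)
  have ho : o ∈ Ω := ψ_mem (hA.trans_lt hA1)
  have hφc : ∀ z ∈ Ω, φ z ∈ closure Ω := fun z hz =>
    mem_closure_of_tendsto (hφ z hz) (Eventually.of_forall fun j => S.tangent.maps.iterate _ hz)
  have hγc : ∀ z ∈ Ω, γ z ∈ closure Ω := fun z hz =>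
    mem_closure_of_tendsto (hγ z hz) (Eventually.of_forall fun j => S.maps.iterate _ hz)
  have ho2 : φ o ∈ Ω := by
    by_contra hn
    refine S.noEscape (l.map k) o ho (φ o) ⟨hφc o ho, by rwa [S.isOpen.interior_eq]⟩
      (le_of_tendsto (hφ o ho).norm (Eventually.of_forall fun j => (hJ _).bound _ hA1)) ?_
    exact hφ o ho
  refine ⟨φ, γ, hφ, hγ, cartan_limit S.isOpen S.preconn S.hreg S.isOpen S.preconn S.hreg hf hg hφ hγ
    hφc hγc ?_ ?_ ho ho2⟩
  · intro z hz
    obtain ⟨ε, hε, hb⟩ := Metric.isOpen_iff.1 S.isOpen z hz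
    refine ⟨ε, hε, Eventually.of_forall fun j w hw => ⟨?_, ?_⟩⟩
    · exact (differentiableOn_iterate S.maps S.diff _).differentiableAt
        (S.isOpen.mem_nhds (S.tangent.maps.iterate _ (hb hw)))
    · exact iterate_left_inv S.tangent.maps S.left_inv _ w (hb hw)
  · intro z hz
    obtain ⟨ε, hε, hb⟩ := Metric.isOpen_iff.1 S.isOpen z hz
    refine ⟨ε, hε, Eventually.of_forall fun j w hw => ⟨?_, ?_⟩⟩
    · exact (differentiableOn_iterate S.tangent.maps S.tangent.diff _).differentiableAt
        (S.isOpen.mem_nhds (S.maps.iterate _ (hb hw)))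
    · exact iterate_left_inv S.maps S.right_inv _ w (hb hw)

theorem Sys.isJ_inverse (S : Sys D η₁ F G) (hA : D.A ≤ A₁)
    (hJ : ∀ k, D.IsJ A₁ η₁ (F^[k])) (k : ℕ) : D.IsJ A₁ η₁ (G^[k]) := by
  have hη : η₁ < D.η := by linarith [S.η₁_pos, S.η₁_le]
  obtain ⟨φ, γ, hφ, hγ, hφd, hγd, hφm, hγm, hγφ, hφγ⟩ :=
    S.exists_limits (hyperfilter ℕ) (fun j => j) hA hJ
  have hge : ∀ N : ℕ, ∀ᶠ j in (hyperfilter ℕ : Filter ℕ), N ≤ j := fun N =>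
    (Nat.hyperfilter_le_atTop (eventually_ge_atTop N))
  have hGd := fun i => differentiableOn_iterate S.maps S.diff i
  have hGm := fun i => S.maps.iterate i
  have step : ∀ i, D.IsJ A₁ η₁ (fun z => G^[i] (φ (G^[k] z))) := by
    intro i
    refine IsJ.of_tendsto (l := hyperfilter ℕ) (f := fun j z => G^[i] (F^[j] (G^[k] z))) hA hη ?_ ?_
      ((hGd i).comp (hφd.comp (hGd k) (hGm k)) (hφm.comp (hGm k)))
      ((hGm i).comp (hφm.comp (hGm k)))
    · filter_upwards [hge (i + k)] with j hj
      obtain ⟨a, rfl⟩ := Nat.exists_eq_add_of_le hj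
      refine (hJ a).congr hA fun z hz => ?_
      show G^[i] (F^[i + k + a] (G^[k] z)) = F^[a] z
      rw [show i + k + a = i + (a + k) by ring, iterate_add_apply, iterate_add_apply F a k,
        iterate_left_inv S.maps S.right_inv k z hz,
        iterate_left_inv S.tangent.maps S.left_inv i _ (S.tangent.maps.iterate a hz)]
    · intro z hz
      have hc : ContinuousAt (G^[i]) (φ (G^[k] z)) := ((hGd i).differentiableAt
        (S.isOpen.mem_nhds (hφm (hGm k hz)))).continuousAt
      exact hc.tendsto.comp (hφ _ (hGm k hz))
  refine IsJ.of_tendsto (l := hyperfilter ℕ) hA hη (Eventually.of_forall step) ?_ (hGd k) (hGm k)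
  intro z hz
  have := hγ _ (hφm (hGm k hz))
  rwa [hγφ _ (hGm k hz)] at this

/-- All powers, and all limits of powers, form pairs satisfying a common Julia inequality. -/
theorem Sys.exists_pairs (S : Sys D η₁ F G) : ∃ A₁, D.A ≤ A₁ ∧
    (∀ k, D.IsJPair A₁ η₁ (F^[k]) (G^[k])) ∧
    ∀ {ι : Type} (l : Ultrafilter ι) (k : ι → ℕ), ∃ φ γ, D.IsJPair A₁ η₁ φ γ ∧
      (∀ z ∈ Ω, Tendsto (fun j => F^[k j] z) l (𝓝 (φ z))) ∧
      (∀ z ∈ Ω, Tendsto (fun j => G^[k j] z) l (𝓝 (γ z))) := by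
  have hη : η₁ < D.η := by linarith [S.η₁_pos, S.η₁_le]
  obtain ⟨A₁, hA, h⟩ := D.exists_uniform S.isOpen S.bdd S.η₁_pos S.η₁_le
  have hJ : ∀ k, D.IsJ A₁ η₁ (F^[k]) := fun k =>
    have ht := S.tangent.iterate k
    ⟨ht.diff, ht.maps, fun ξ hξ => (h _ ht ξ hξ).1, fun ξ hξ => (h _ ht ξ hξ).2⟩
  have hJ' := S.isJ_inverse hA hJ
  refine ⟨A₁, hA, fun k => ⟨hJ k, hJ' k, iterate_left_inv S.tangent.maps S.left_inv k,
    iterate_left_inv S.maps S.right_inv k⟩, fun l k => ?_⟩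
  obtain ⟨φ, γ, hφ, hγ, hφd, hγd, hφm, hγm, hγφ, hφγ⟩ := S.exists_limits l k hA hJ
  exact ⟨φ, γ, ⟨IsJ.of_tendsto hA hη (Eventually.of_forall fun j => hJ _) hφ hφd hφm,
    IsJ.of_tendsto hA hη (Eventually.of_forall fun j => hJ' _) hγ hγd hγm, hγφ, hφγ⟩, hφ, hγ⟩

end

end NormData

namespace NormData

variable {m : ℕ} {Ω : Set (En (m + 1))} {D : NormData Ω} {A₁ η₁ : ℝ}
  {f g : En (m + 1) → En (m + 1)}

/-- The defect in the Julia inequality, as a function on the right half-plane. -/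
def defect (D : NormData Ω) (A₁ : ℝ) (f : En (m + 1) → En (m + 1)) (ζ : ℂ) : ℂ :=
  (D.G (f (D.ψ (ζ + A₁))))⁻¹ - ζ

theorem IsJ.defect_re_nonneg (hf : D.IsJ A₁ η₁ f) {ζ : ℂ} (hζ : 0 < ζ.re) :
    0 ≤ (D.defect A₁ f ζ).re := by
  have := hf.julia (ζ + A₁) (by simpa using hζ)
  simp only [add_re, ofReal_re] at this
  simp only [defect, sub_re]
  linarith

theorem IsJ.differentiableOn_defect (hf : D.IsJ A₁ η₁ f) (hΩo : IsOpen Ω) (hA : D.A ≤ A₁)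
    (hη : η₁ < D.η) : DifferentiableOn ℂ (D.defect A₁ f) {ξ | 0 < ξ.re} := by
  intro ζ hζ
  have hre : A₁ < (ζ + A₁).re := by simpa using hζ
  have h1 := IsTangent.differentiableAt_inv_G (D := D) hf.diff hf.maps hΩo (hA.trans_lt hre)
    ((hf.bound _ hre).trans_lt hη)
  have h2 : DifferentiableAt ℂ (fun ζ : ℂ => ζ + (A₁ : ℂ)) ζ := by fun_prop
  have h3 := DifferentiableAt.comp (g := fun ξ => (D.G (f (D.ψ ξ)))⁻¹)
    (f := fun ζ : ℂ => ζ + (A₁ : ℂ)) ζ h1 h2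
  exact (h3.sub differentiableAt_id).differentiableWithinAt

theorem IsJ.norm_defect_div_le (hf : D.IsJ A₁ η₁ f) (hΩo : IsOpen Ω) (hA : D.A ≤ A₁)
    (hη : η₁ < D.η) {x y : ℝ} (hy : 0 < y) (hxy : y < x) :
    ‖D.defect A₁ f x / x‖ ≤ ‖D.defect A₁ f y‖ / x + (D.defect A₁ f y).re / y := by
  have hx := hy.trans hxy
  have h := halfPlane_growth (hf.differentiableOn_defect hΩo hA hη)
    (fun ξ hξ => hf.defect_re_nonneg hξ) hy hxy
  have h0 := hf.defect_re_nonneg (ζ := y) (by simpa using hy)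
  have h1 := norm_le_norm_add_norm_sub' (D.defect A₁ f x) (D.defect A₁ f y)
  rw [norm_div, norm_real, Real.norm_of_nonneg hx.le, div_le_iff₀ hx, add_mul,
    div_mul_cancel₀ _ hx.ne']
  calc ‖D.defect A₁ f x‖ ≤ ‖D.defect A₁ f y‖ + (x / y - 1) * (D.defect A₁ f y).re := by linarith
    _ ≤ ‖D.defect A₁ f y‖ + (x / y) * (D.defect A₁ f y).re := by gcongr; linarith
    _ = _ := by ring

/-- The defect has a nonnegative angular derivative at infinity. -/
theorem IsJ.exists_angular (hf : D.IsJ A₁ η₁ f) (hΩo : IsOpen Ω) (hA : D.A ≤ A₁)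
    (hη : η₁ < D.η) : ∃ β : ℝ, 0 ≤ β ∧
      Tendsto (fun x : ℝ => D.defect A₁ f x / x) atTop (𝓝 β) := by
  set e := D.defect A₁ f with he
  set S : Set ℝ := (fun y : ℝ => (e y).re / y) '' Ioi 0 with hS
  have hnn : ∀ y : ℝ, 0 < y → 0 ≤ (e y).re := fun y hy =>
    hf.defect_re_nonneg (ζ := y) (by simpa using hy)
  have hbdd : BddBelow S := ⟨0, by rintro _ ⟨y, hy, rfl⟩; exact div_nonneg (hnn y hy) (le_of_lt hy)⟩
  have hne : S.Nonempty := ⟨_, 1, mem_Ioi.2 one_pos, rfl⟩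
  set β := sInf S with hβ
  have hβ0 : 0 ≤ β := le_csInf hne (by
    rintro _ ⟨y, hy, rfl⟩; exact div_nonneg (hnn y hy) (le_of_lt hy))
  have hle : ∀ y : ℝ, 0 < y → β ≤ (e y).re / y := fun y hy => csInf_le hbdd ⟨y, hy, rfl⟩
  have hdivre : ∀ x : ℝ, (e x / x).re = (e x).re / x := fun x => by rw [div_ofReal_re]
  have hup : ∀ ε > 0, ∀ᶠ x : ℝ in atTop, (e x / x).re < β + ε ∧ ‖e x / x‖ < β + ε := by
    intro ε hε
    obtain ⟨_, ⟨y, hy, rfl⟩, hlt⟩ := exists_lt_of_csInf_lt hne (show sInf S < β + ε / 2 by linarith)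
    have hy' : (0 : ℝ) < y := hy
    have ht : Tendsto (fun x : ℝ => ‖e y‖ / x) atTop (𝓝 0) := tendsto_const_nhds.div_atTop tendsto_id
    filter_upwards [eventually_gt_atTop y, ht.eventually_lt_const (show (0:ℝ) < ε / 2 by linarith)]
      with x hx h1
    have h2 := hf.norm_defect_div_le hΩo hA hη hy' hx
    have h3 : ‖e x / x‖ < β + ε := by
      change ‖e x / x‖ ≤ ‖e y‖ / x + (e y).re / y at h2
      linarith
    exact ⟨((le_abs_self _).trans (abs_re_le_norm _)).trans_lt h3, h3⟩
  have hlow : ∀ᶠ x : ℝ in atTop, β ≤ (e x / x).re := by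
    filter_upwards [eventually_gt_atTop 0] with x hx
    rw [hdivre]; exact hle x hx
  have t1 : Tendsto (fun x : ℝ => (e x / x).re) atTop (𝓝 β) := by
    rw [Metric.tendsto_nhds]
    intro ε hε
    filter_upwards [hup ε hε, hlow] with x h1 h2
    rw [Real.dist_eq, abs_lt]; constructor <;> linarith [h1.1]
  have t2 : Tendsto (fun x : ℝ => ‖e x / x‖) atTop (𝓝 β) := by
    rw [Metric.tendsto_nhds]
    intro ε hε
    filter_upwards [hup ε hε, hlow] with x h1 h2
    have := (le_abs_self _).trans (abs_re_le_norm (e x / x))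
    rw [Real.dist_eq, abs_lt]; constructor <;> linarith [h1.2]
  refine ⟨β, hβ0, ?_⟩
  rw [tendsto_iff_norm_sub_tendsto_zero]
  have t3 : Tendsto (fun x : ℝ => ‖e x / x - β‖ ^ 2) atTop (𝓝 0) := by
    have : Tendsto (fun x : ℝ => ‖e x / x‖ ^ 2 - 2 * β * (e x / x).re + β ^ 2) atTop
        (𝓝 (β ^ 2 - 2 * β * β + β ^ 2)) := ((t2.pow 2).sub (t1.const_mul _)).add_const _
    rw [show β ^ 2 - 2 * β * β + β ^ 2 = 0 by ring] at this
    refine this.congr fun x => ?_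
    rw [← normSq_eq_norm_sq, ← normSq_eq_norm_sq, normSq_apply, normSq_apply]
    simp only [sub_re, sub_im, ofReal_re, ofReal_im]
    ring
  have := t3.sqrt
  simpa using this

variable {ι : Type*} {l : Filter ι} {t : ι → ℝ} {fs : ι → En (m + 1) → En (m + 1)}

/-- Rewriting convergence of the defect quotients as convergence of rescaled values of `1 / G`. -/
theorem tendsto_mul_inv_G (ht : Tendsto t l (𝓝[>] 0)) {β : ℝ} {ξ : ℝ} (hξ : 0 < ξ)
    (h : Tendsto (fun j => D.defect A₁ (fs j) (ξ / t j - A₁ : ℝ) / (ξ / t j - A₁ : ℝ)) l (𝓝 β)) :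
    Tendsto (fun j => (t j : ℂ) * (D.G (fs j (D.ψ (ξ / t j : ℝ))))⁻¹) l
      (𝓝 (((1 + β) * ξ : ℝ) : ℂ)) := by
  have ht0 : Tendsto t l (𝓝 0) := ht.mono_right nhdsWithin_le_nhds
  have hpos : ∀ᶠ j in l, 0 < t j := ht self_mem_nhdsWithin
  have htop : Tendsto (fun j => ξ / t j) l atTop := by
    simpa [div_eq_mul_inv] using (tendsto_inv_nhdsGT_zero.comp ht).const_mul_atTop hξ
  have h1 : Tendsto (fun j => (((ξ - A₁ * t j : ℝ)) : ℂ)) l (𝓝 ((ξ : ℝ) : ℂ)) := by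
    have := (ht0.const_mul A₁).const_sub ξ
    rw [mul_zero, sub_zero] at this
    exact (continuous_ofReal.tendsto _).comp this
  have h2 := (h.mul h1).add h1
  rw [show (((1 + β) * ξ : ℝ) : ℂ) = (β : ℂ) * ξ + ξ by push_cast; ring]
  refine h2.congr' ?_
  filter_upwards [hpos, htop.eventually_gt_atTop A₁] with j hj hA
  have hx : ((ξ / t j - A₁ : ℝ) : ℂ) ≠ 0 := by
    rw [ofReal_ne_zero]; exact (sub_pos.2 hA).ne'
  have htj : (t j : ℂ) ≠ 0 := ofReal_ne_zero.2 hj.ne'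
  have e1 : ((ξ - A₁ * t j : ℝ) : ℂ) = t j * ((ξ / t j - A₁ : ℝ) : ℂ) := by
    push_cast; field_simp
  rw [e1, defect, show ((ξ / t j - A₁ : ℝ) : ℂ) + (A₁ : ℂ) = ((ξ / t j : ℝ) : ℂ) by push_cast; ring]
  generalize ((ξ / t j - A₁ : ℝ) : ℂ) = x at *
  field_simp
  ring

theorem tendsto_sub_atTop_of_pos (ht : Tendsto t l (𝓝[>] 0)) {ξ : ℝ} (hξ : 0 < ξ) (A : ℝ) :
    Tendsto (fun j => ξ / t j - A) l atTop := by
  have : Tendsto (fun j => ξ / t j) l atTop := by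
    simpa [div_eq_mul_inv] using (tendsto_inv_nhdsGT_zero.comp ht).const_mul_atTop hξ
  exact tendsto_atTop_add_const_right _ (-A) this

/-- If maps converge to one without angular defect, their defects along a simultaneous
rescaling vanish. -/
theorem tendsto_defect_of_limit (hΩo : IsOpen Ω) (hA : D.A ≤ A₁) (hη : η₁ < D.η)
    (hfs : ∀ j, D.IsJ A₁ η₁ (fs j)) (hf : D.IsJ A₁ η₁ f)
    (hlim : ∀ z ∈ Ω, Tendsto (fun j => fs j z) l (𝓝 (f z)))
    (h0 : Tendsto (fun x : ℝ => D.defect A₁ f x / x) atTop (𝓝 0))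
    {x : ι → ℝ} (hx : Tendsto x l atTop) :
    Tendsto (fun j => D.defect A₁ (fs j) (x j) / x j) l (𝓝 0) := by
  rw [Metric.tendsto_nhds]
  intro ε hε
  obtain ⟨y, hy, hy0⟩ := ((Metric.tendsto_nhds.1 h0 (ε / 4) (by linarith)).and
    (eventually_gt_atTop (0 : ℝ))).exists
  rw [dist_zero_right] at hy
  have hre : A₁ < ((y : ℂ) + A₁).re := by simpa using hy0
  have hψ : D.ψ ((y : ℂ) + A₁) ∈ Ω := ψ_mem (hA.trans_lt hre)
  have hc : Tendsto (fun j => D.defect A₁ (fs j) y) l (𝓝 (D.defect A₁ f y)) :=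
    ((((D.differentiable_G.continuous.tendsto _).comp (hlim _ hψ)).inv₀
      (G_ne_zero ((hf.bound _ hre).trans_lt hη) (hf.maps hψ))).sub_const _)
  have hre2 : (D.defect A₁ f y).re / y < ε / 2 := by
    have h1 := (le_abs_self _).trans (abs_re_le_norm (D.defect A₁ f y / y))
    rw [div_ofReal_re] at h1
    linarith
  have h1 : Tendsto (fun j => ‖D.defect A₁ (fs j) y‖ / x j) l (𝓝 0) := hc.norm.div_atTop hx
  have h2 : Tendsto (fun j => (D.defect A₁ (fs j) y).re / y) l (𝓝 ((D.defect A₁ f y).re / y)) :=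
    ((continuous_re.tendsto _).comp hc).div_const _
  filter_upwards [h1.eventually_lt_const (show (0 : ℝ) < ε / 2 by linarith),
    h2.eventually_lt_const hre2, hx.eventually_gt_atTop y] with j a1 a2 a3
  rw [dist_zero_right]
  have := (hfs j).norm_defect_div_le hΩo hA hη hy0 a3
  linarith

end NormData

/-- The hyperbolic automorphism of the disc fixing `±1`, in half-plane coordinates a dilation. -/
def hyp (L : ℝ) (τ : ℂ) : ℂ := ((1 + τ) - L * (1 - τ)) / ((1 + τ) + L * (1 - τ))

theorem two_le_norm_hyp_denom {L : ℝ} (hL : 1 ≤ L) {τ : ℂ} (hτ : ‖τ‖ < 1) :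
    2 ≤ ‖(1 + τ) + L * (1 - τ)‖ := by
  have h1 : ((1 + τ) + L * (1 - τ) : ℂ).re = (1 + L) - (L - 1) * τ.re := by simp; ring
  have h2 := (le_abs_self _).trans (abs_re_le_norm ((1 + τ) + L * (1 - τ)))
  have h3 : τ.re ≤ 1 := (le_abs_self _).trans ((abs_re_le_norm τ).trans hτ.le)
  have h4 : (L - 1) * τ.re ≤ (L - 1) * 1 := by gcongr
  linarith

theorem one_sub_norm_hyp_sq_le {L : ℝ} (hL : 1 ≤ L) {τ : ℂ} (hτ : ‖τ‖ < 1) :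
    1 - ‖hyp L τ‖ ^ 2 ≤ L * (1 - ‖τ‖ ^ 2) := by
  have h2 := two_le_norm_hyp_denom hL hτ
  have h3 : 1 - ‖hyp L τ‖ ^ 2 = 4 * (L * (1 - ‖τ‖ ^ 2)) / ‖(1 + τ) + L * (1 - τ)‖ ^ 2 := by
    have h0 : ‖(1 + τ) + L * (1 - τ)‖ ^ 2 ≠ 0 := by positivity
    rw [hyp, norm_div, div_pow, eq_div_iff h0, sub_mul, div_mul_cancel₀ _ h0]
    simp only [← normSq_eq_norm_sq, normSq_apply]
    simp
    ring
  have hp : 0 ≤ L * (1 - ‖τ‖ ^ 2) := by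
    have := norm_nonneg τ
    have : ‖τ‖ ^ 2 ≤ 1 := by nlinarith
    exact mul_nonneg (by linarith) (by linarith)
  rw [h3, div_le_iff₀ (by positivity)]
  have : (4 : ℝ) ≤ ‖(1 + τ) + L * (1 - τ)‖ ^ 2 := by nlinarith
  nlinarith

/-- A self-map of the closed ball acting on the real diameter as a dilation in the first coordinate
preserves the complex disc through it. -/
theorem eq_hyp_smul_e0 {m : ℕ} {g : En (m + 1) → En (m + 1)} {L : ℝ} (hL : 1 ≤ L)
    (hg : DifferentiableOn ℂ g (ball 0 1)) (hgm : ∀ u ∈ ball (0 : En (m + 1)) 1, ‖g u‖ ≤ 1)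
    (hgL : ∀ τ : ℝ, |τ| < 1 → c0 (g ((τ : ℂ) • e0)) = hyp L τ) :
    ∀ τ : ℂ, ‖τ‖ < 1 → g (τ • e0) = hyp L τ • e0 := by
  have hmem : ∀ τ : ℂ, ‖τ‖ < 1 → τ • (e0 : En (m + 1)) ∈ ball (0 : En (m + 1)) 1 := fun τ hτ => by
    simpa [norm_smul] using hτ
  have hgd : DifferentiableOn ℂ (fun τ : ℂ => g (τ • e0)) (ball 0 1) := fun τ hτ =>
    (DifferentiableAt.comp (g := g) (f := fun τ : ℂ => τ • e0) τ (hg.differentiableAt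
      (isOpen_ball.mem_nhds (hmem τ (by simpa using hτ))))
      (by fun_prop)).differentiableWithinAt
  have hden : ∀ τ : ℂ, ‖τ‖ < 1 → (1 + τ) + L * (1 - τ) ≠ 0 := fun τ hτ h0 => by
    have := two_le_norm_hyp_denom hL hτ
    rw [h0, norm_zero] at this
    linarith
  have hd1 : DifferentiableOn ℂ (fun τ : ℂ => c0 (g (τ • e0))) (ball 0 1) :=
    c0.differentiable.comp_differentiableOn hgd
  have hd2 : DifferentiableOn ℂ (hyp L) (ball 0 1) := by
    intro τ hτ
    have := hden τ (by simpa using hτ)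
    unfold hyp
    fun_prop (disch := assumption)
  have hc0 : EqOn (fun τ : ℂ => c0 (g (τ • e0))) (hyp L) (ball 0 1) := by
    refine AnalyticOnNhd.eqOn_of_preconnected_of_frequently_eq (hd1.analyticOnNhd isOpen_ball)
      (hd2.analyticOnNhd isOpen_ball) (convex_ball (0 : ℂ) 1).isPreconnected
      (mem_ball_self one_pos) ?_
    have hseq : Tendsto (fun k : ℕ => ((1 / ((k : ℝ) + 2) : ℝ) : ℂ)) atTop (𝓝[≠] 0) := by
      refine tendsto_nhdsWithin_iff.2 ⟨?_, Eventually.of_forall fun k => ?_⟩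
      · have h1 : Tendsto (fun k : ℕ => (1 / ((k : ℝ) + 2))) atTop (𝓝 0) :=
          tendsto_const_nhds.div_atTop
            (tendsto_atTop_add_const_right _ _ tendsto_natCast_atTop_atTop)
        have := (continuous_ofReal.tendsto 0).comp h1
        rwa [ofReal_zero] at this
      · rw [mem_compl_singleton_iff, ofReal_ne_zero]
        positivity
    refine hseq.frequently (Eventually.frequently (Eventually.of_forall fun k => ?_))
    refine hgL _ ?_
    have : (0 : ℝ) ≤ k := k.cast_nonneg
    rw [abs_of_pos (by positivity), div_lt_one (by positivity)]
    linarith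
  have htl : ∀ τ : ℂ, ‖τ‖ < 1 → tl (g (τ • e0)) = 0 := by
    intro τ hτ
    have hb : ∀ σ : ℂ, ‖σ‖ < 1 → ‖tl (g (σ • e0))‖ ≤ √(L * (1 - ‖σ‖ ^ 2)) := by
      intro σ hσ
      refine Real.le_sqrt_of_sq_le ?_
      have h1 := norm_sq_eq (g (σ • e0))
      have h2 : ‖g (σ • e0)‖ ^ 2 ≤ 1 := pow_le_one₀ (norm_nonneg _) (hgm _ (hmem σ hσ))
      have h3 : c0 (g (σ • e0)) = hyp L σ := hc0 (show σ ∈ ball (0 : ℂ) 1 by simpa using hσ)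
      have h4 := one_sub_norm_hyp_sq_le hL hσ
      rw [h3] at h1
      linarith
    have hr : ∀ᶠ r : ℝ in 𝓝[<] 1, ‖tl (g (τ • e0))‖ ≤ √(L * (1 - r ^ 2)) := by
      filter_upwards [Ioo_mem_nhdsLT hτ] with r hr
      have hr0 : 0 < r := (norm_nonneg τ).trans_lt hr.1
      have hcl : closure (ball (0 : ℂ) r) ⊆ ball 0 1 := by
        rw [closure_ball _ hr0.ne']; exact closedBall_subset_ball hr.2
      refine Complex.norm_le_of_forall_mem_frontier_norm_le (U := ball (0 : ℂ) r)
        (f := fun τ : ℂ => tl (g (τ • e0))) isBounded_ball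
        ((tl.differentiable.comp_differentiableOn hgd).mono hcl).diffContOnCl ?_
        (subset_closure (by simpa using hr.1))
      intro σ hσ
      rw [frontier_ball _ hr0.ne', mem_sphere_zero_iff_norm] at hσ
      rw [← hσ]
      exact hb σ (by rw [hσ]; exact hr.2)
    have hlim : Tendsto (fun r : ℝ => √(L * (1 - r ^ 2))) (𝓝[<] 1) (𝓝 0) := by
      have : Continuous (fun r : ℝ => √(L * (1 - r ^ 2))) := by fun_prop
      have h := this.tendsto 1
      simp only [one_pow, sub_self, mul_zero, Real.sqrt_zero] at h
      exact h.mono_left nhdsWithin_le_nhds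
    exact norm_eq_zero.1 (le_antisymm (ge_of_tendsto hlim hr) (norm_nonneg _))
  intro τ hτ
  refine ext_c0_tl ?_ ?_
  · have : c0 (g (τ • e0)) = hyp L τ := hc0 (show τ ∈ ball (0 : ℂ) 1 by simpa using hτ)
    rw [this]; simp
  · rw [htl τ hτ]; simp

theorem norm_hyp_zero_lt {L : ℝ} (hL : 1 ≤ L) : ‖hyp L 0‖ < 1 := by
  have : hyp L 0 = (((1 - L) / (1 + L) : ℝ) : ℂ) := by simp [hyp]
  rw [this, norm_real, Real.norm_eq_abs, abs_lt, lt_div_iff₀ (by linarith),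
    div_lt_iff₀ (by linarith)]
  constructor <;> linarith

theorem mul_eq_one_of_hyp_hyp {L L' : ℝ} (hL : 1 ≤ L) (hL' : 1 ≤ L') (h : hyp L' (hyp L 0) = 0) :
    L * L' = 1 := by
  have h0 : (1 + L : ℂ) ≠ 0 := by
    have : (1 + L : ℝ) ≠ 0 := by linarith
    exact_mod_cast this
  have h1 := two_le_norm_hyp_denom hL' (norm_hyp_zero_lt hL)
  have h2 : (1 + hyp L 0) + L' * (1 - hyp L 0) ≠ 0 := fun h3 => by
    rw [h3, norm_zero] at h1; linarith
  rw [hyp, div_eq_zero_iff, or_iff_left h2] at h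
  have h3 : hyp L 0 = (1 - L) / (1 + L) := by simp [hyp]
  rw [h3] at h
  field_simp at h
  have h4 : ((L * L' : ℝ) : ℂ) = ((1 : ℝ) : ℂ) := by
    push_cast
    linear_combination (-1/2 : ℂ) * h
  exact_mod_cast h4

namespace NormData

variable {m : ℕ} {Ω : Set (En (m + 1))} {D : NormData Ω} {A₁ η₁ : ℝ}

/-- A self-map of `Ω` read in the scaled coordinates at the boundary point. -/
def conj (D : NormData Ω) (t : ℝ) (f : En (m + 1) → En (m + 1)) (u : En (m + 1)) : En (m + 1) :=
  D.Θ 0 t (f (D.Ξ 0 t u))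

theorem Ξ_smul_e0 {t ξ : ℝ} {τ : ℂ} (h : (1 + τ) / (1 - τ) = (ξ : ℂ)⁻¹) :
    D.Ξ 0 t (τ • e0) = D.ψ ((ξ / t : ℝ) : ℂ) := by
  rw [Ξ, ψ, zero_add]
  congr 1
  refine ext_c0_tl ?_ ?_
  · rw [c0_unscale, D.r_zero, c0_cayInv]
    simp only [map_smul, c0_e0, smul_eq_mul, mul_one, h]
    push_cast
    rw [inv_div]
    simp [div_eq_mul_inv]
  · rw [tl_unscale, tl_cayInv]; simp

theorem c0_Θ_zero (t : ℝ) (z : En (m + 1)) :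
    c0 (D.Θ 0 t z) = (D.G z / t - 1) / (D.G z / t + 1) := by
  rw [Θ, c0_cay, c0_W, D.r_zero, sub_zero]
  simp [G]

theorem exists_Ξ_zero_bounds (D : NormData Ω) {u : En (m + 1)} (hu : u ∈ ball (0 : En (m + 1)) 1)
    {δ : ℝ} (hδ : 0 < δ) : ∃ ε > 0, ∃ σ > 0, ∀ t, 0 < t → t < σ → ∀ w ∈ ball u ε,
      DifferentiableAt ℂ (D.Ξ 0 t) w ∧ D.Ξ 0 t w ∈ Ω ∧ ‖D.Ξ 0 t w‖ < δ ∧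
      D.Θ 0 t (D.Ξ 0 t w) = w := by
  have hu1 : ‖u‖ < 1 := by simpa using hu
  have hu0 := norm_nonneg u
  obtain ⟨σ, hσ, K, h⟩ := D.exists_Ξ_bounds (R := (1 + ‖u‖) / 2) (by linarith) (by linarith) hδ
  refine ⟨(1 - ‖u‖) / 2, by linarith, σ, hσ, fun t ht0 ht w hw => ?_⟩
  have hwn : ‖w‖ ≤ (1 + ‖u‖) / 2 := by
    rw [mem_ball, dist_eq_norm] at hw
    have := norm_le_norm_add_norm_sub' w u
    linarith
  obtain ⟨c1, c2, c3, c4, -⟩ := h 0 t (by simpa using hσ) ht0 ht (by simp [D.r_zero, ht0.le]) w hwn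
  exact ⟨c1, c2, c3, c4⟩

variable {ι : Type*} {l : Ultrafilter ι} {t : ι → ℝ} {f g : ι → En (m + 1) → En (m + 1)}

/-- Along vanishing scales, Julia maps move the scaled balls to the boundary point. -/
theorem eventually_small (hΩo : IsOpen Ω) (hbd : Bornology.IsBounded Ω) (hη : η₁ < D.η)
    (ht : Tendsto t l (𝓝[>] 0)) (hA : D.A ≤ A₁)
    (hf : ∀ j, D.IsJ A₁ η₁ (f j)) {u : En (m + 1)} (hu : u ∈ ball (0 : En (m + 1)) 1)
    {δ : ℝ} (hδ : 0 < δ) : ∃ ε > 0, ∀ᶠ j in (l : Filter ι), 0 < t j ∧ ∀ w ∈ ball u ε,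
      DifferentiableAt ℂ (D.Ξ 0 (t j)) w ∧ D.Ξ 0 (t j) w ∈ Ω ∧ ‖D.Ξ 0 (t j) w‖ < δ ∧
      D.Θ 0 (t j) (D.Ξ 0 (t j) w) = w ∧ ‖f j (D.Ξ 0 (t j) w)‖ < δ := by
  have hpos : ∀ᶠ j in (l : Filter ι), 0 < t j := ht self_mem_nhdsWithin
  have ht0 : Tendsto t l (𝓝 0) := ht.mono_right nhdsWithin_le_nhds
  obtain ⟨M, hM⟩ := hbd.exists_norm_le
  have hb : LocBdd (l : Filter ι) (fun j u => f j (D.Ξ 0 (t j) u)) (ball 0 1) := by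
    intro u hu
    obtain ⟨ε, hε, σ, hσ, h⟩ := D.exists_Ξ_zero_bounds hu one_pos
    refine ⟨ε, hε, M, ?_⟩
    filter_upwards [hpos, ht0.eventually_lt_const hσ] with j h1 h2
    refine ⟨fun w hw => ?_, fun w hw => hM _ ((hf j).maps (h _ h1 h2 w hw).2.1)⟩
    obtain ⟨c1, c2, -⟩ := h _ h1 h2 w hw
    exact (((hf j).diff.differentiableAt (hΩo.mem_nhds c2)).comp w c1).differentiableWithinAt
  have hbase : Tendsto (fun j => f j (D.Ξ 0 (t j) 0)) l (𝓝 0) := by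
    have htop := tendsto_sub_atTop_of_pos ht one_pos A₁
    have h1 : Tendsto (fun j => √(2 / (1 / t j - A₁))) l (𝓝 0) := by
      have := (tendsto_const_nhds (x := (2 : ℝ))).div_atTop htop
      simpa using this.sqrt
    refine squeeze_zero_norm' ?_ h1
    filter_upwards [htop.eventually_gt_atTop 0] with j hj
    have e : D.Ξ 0 (t j) 0 = D.ψ ((1 / t j : ℝ) : ℂ) := by
      rw [← Ξ_smul_e0 (τ := 0) (by simp), zero_smul]
    have hre : A₁ < ((1 / t j : ℝ) : ℂ).re := by rw [ofReal_re]; linarith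
    rw [e]
    refine Real.le_sqrt_of_sq_le (norm_sq_le_of_inv_G_re ((hf j).bound _ hre |>.trans_lt hη)
      ((hf j).maps (ψ_mem (hA.trans_lt hre))) hj ?_)
    have := (hf j).julia _ hre
    rwa [ofReal_re] at this
  have hlim := D.tendsto_zero_of_base isOpen_ball (convex_ball (0 : En (m + 1)) 1).isPreconnected hb
    (fun u hu => by
      obtain ⟨ε, hε, σ, hσ, h⟩ := D.exists_Ξ_zero_bounds hu one_pos
      filter_upwards [hpos, ht0.eventually_lt_const hσ] with j h1 h2
      exact (hf j).maps (h _ h1 h2 u (mem_ball_self hε)).2.1) (mem_ball_self one_pos) hbase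
  obtain ⟨ε1, hε1, h1⟩ := hb.eventually_ball hu (hlim u hu) hδ
  obtain ⟨ε, hε, σ, hσ, h⟩ := D.exists_Ξ_zero_bounds hu hδ
  refine ⟨min ε ε1, lt_min hε hε1, ?_⟩
  filter_upwards [hpos, ht0.eventually_lt_const hσ, h1] with j a1 a2 a3
  refine ⟨a1, fun w hw => ?_⟩
  obtain ⟨c1, c2, c3, c4⟩ := h _ a1 a2 w (ball_subset_ball (min_le_left _ _) hw)
  refine ⟨c1, c2, c3, c4, ?_⟩
  simpa using a3 w (ball_subset_ball (min_le_right _ _) hw)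

theorem locBdd_conj (hΩo : IsOpen Ω) (hbd : Bornology.IsBounded Ω) (hη : η₁ < D.η)
    (ht : Tendsto t l (𝓝[>] 0)) (hA : D.A ≤ A₁)
    (hf : ∀ j, D.IsJ A₁ η₁ (f j)) :
    LocBdd (l : Filter ι) (fun j => D.conj (t j) (f j)) (ball 0 1) := by
  intro u hu
  obtain ⟨ε, hε, h⟩ := eventually_small hΩo hbd hη ht hA hf hu D.η_pos
  refine ⟨ε, hε, 2, ?_⟩
  filter_upwards [h] with j ⟨h1, h2⟩
  refine ⟨fun w hw => ?_, fun w hw => ?_⟩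
  · obtain ⟨c1, c2, c3, c4, c5⟩ := h2 w hw
    have d1 := differentiableAt_Θ (D := D) norm_zero_lt c5 ((hf j).maps c2) h1
    have d2 := ((hf j).diff.differentiableAt (hΩo.mem_nhds c2)).comp w c1
    exact (DifferentiableAt.comp (g := D.Θ 0 (t j)) (f := fun w => f j (D.Ξ 0 (t j) w)) w d1
      d2).differentiableWithinAt
  · obtain ⟨c1, c2, c3, c4, c5⟩ := h2 w hw
    have := norm_Θ_sq_le_two (D := D) norm_zero_lt c5 ((hf j).maps c2) h1
    change ‖D.Θ 0 (t j) (f j (D.Ξ 0 (t j) w))‖ ≤ 2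
    nlinarith [norm_nonneg (D.Θ 0 (t j) (f j (D.Ξ 0 (t j) w)))]

theorem norm_limit_conj_le_one (hΩo : IsOpen Ω) (hbd : Bornology.IsBounded Ω) (hη : η₁ < D.η)
    (ht : Tendsto t l (𝓝[>] 0)) (hA : D.A ≤ A₁)
    (hf : ∀ j, D.IsJ A₁ η₁ (f j)) {u v : En (m + 1)} (hu : u ∈ ball (0 : En (m + 1)) 1)
    (h : Tendsto (fun j => D.conj (t j) (f j) u) l (𝓝 v)) : ‖v‖ ≤ 1 := by
  refine norm_le_one_of_tendsto h fun ε hε => ?_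
  obtain ⟨δ, hδ, hδ2⟩ := D.exists_norm_Θ_sq_le hε
  obtain ⟨ε, hε, h⟩ := eventually_small hΩo hbd hη ht hA hf hu hδ
  filter_upwards [h] with j ⟨h1, h2⟩
  obtain ⟨c1, c2, c3, c4, c5⟩ := h2 u (mem_ball_self hε)
  exact hδ2 _ _ (by simpa using hδ) c5 ((hf j).maps c2) _ h1

theorem c0_limit_conj {φ : En (m + 1) → En (m + 1)} {L : ℝ} (hL : 1 ≤ L)
    (hφ : ∀ u ∈ ball (0 : En (m + 1)) 1, Tendsto (fun j => D.conj (t j) (f j) u) l (𝓝 (φ u)))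
    (hLim : ∀ ξ : ℝ, 0 < ξ → Tendsto (fun j => (t j : ℂ) * (D.G (f j (D.ψ (ξ / t j : ℝ))))⁻¹) l
      (𝓝 ((L * ξ : ℝ) : ℂ))) {τ : ℝ} (hτ : |τ| < 1) : c0 (φ ((τ : ℂ) • e0)) = hyp L τ := by
  obtain ⟨h1, h2⟩ := abs_lt.1 hτ
  set ξ : ℝ := (1 - τ) / (1 + τ) with hξ
  have hξ0 : 0 < ξ := div_pos (by linarith) (by linarith)
  have hLξ : 0 < L * ξ := by positivity
  have a1 : (1 + τ : ℂ) ≠ 0 := by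
    have : (1 + τ : ℝ) ≠ 0 := by linarith
    exact_mod_cast this
  have a2 : (1 - τ : ℂ) ≠ 0 := by
    have : (1 - τ : ℝ) ≠ 0 := by linarith
    exact_mod_cast this
  have hmem : (τ : ℂ) • (e0 : En (m + 1)) ∈ ball (0 : En (m + 1)) 1 := by
    simpa [norm_smul] using hτ
  have hc := (c0.continuous.tendsto _).comp (hφ _ hmem)
  have hne : ((L * ξ : ℝ) : ℂ) ≠ 0 := ofReal_ne_zero.2 hLξ.ne'
  have hlim := (hLim ξ hξ0).inv₀ hne
  have hne2 : ((L * ξ : ℝ) : ℂ)⁻¹ + 1 ≠ 0 := by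
    have : (L * ξ)⁻¹ + 1 ≠ 0 := by positivity
    exact_mod_cast this
  have hlim2 := (hlim.sub_const 1).div (hlim.add_const 1) hne2
  have heq : hyp L τ = (((L * ξ : ℝ) : ℂ)⁻¹ - 1) / (((L * ξ : ℝ) : ℂ)⁻¹ + 1) := by
    have a3 : (1 + τ + L * (1 - τ) : ℂ) ≠ 0 := by
      have : (1 + τ + L * (1 - τ) : ℝ) ≠ 0 := by nlinarith
      exact_mod_cast this
    have a4 : (L : ℂ) ≠ 0 := by
      have : L ≠ 0 := by linarith
      exact_mod_cast this
    have e : ((L * ξ : ℝ) : ℂ)⁻¹ = (1 + τ) / (L * (1 - τ)) := by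
      rw [hξ]; push_cast; field_simp
    rw [e, hyp]
    field_simp
  rw [heq]
  refine tendsto_nhds_unique hc (hlim2.congr fun j => ?_)
  have e2 : D.Ξ 0 (t j) ((τ : ℂ) • e0) = D.ψ ((ξ / t j : ℝ) : ℂ) := Ξ_smul_e0 (by
    rw [hξ]; push_cast; rw [inv_div])
  simp only [comp_apply, conj, e2, c0_Θ_zero, Pi.div_apply]
  rw [mul_inv, inv_inv, inv_mul_eq_div]

theorem conj_conj_of_leftInverse (hΩo : IsOpen Ω) (hbd : Bornology.IsBounded Ω) (hη : η₁ < D.η)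
    (ht : Tendsto t l (𝓝[>] 0)) (hA : D.A ≤ A₁)
    (hp : ∀ j, D.IsJPair A₁ η₁ (f j) (g j)) {u : En (m + 1)} (hu : u ∈ ball (0 : En (m + 1)) 1) :
    ∃ ε > 0, ∀ᶠ j in (l : Filter ι), ∀ w ∈ ball u ε,
      DifferentiableAt ℂ (D.conj (t j) (g j)) (D.conj (t j) (f j) w) ∧
      D.conj (t j) (g j) (D.conj (t j) (f j) w) = w := by
  have hη0 := D.η_pos
  obtain ⟨ε, hε, h⟩ := eventually_small hΩo hbd hη ht hA (fun j => (hp j).fst) hu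
    (show 0 < D.η / 6 by linarith)
  refine ⟨ε, hε, ?_⟩
  filter_upwards [h] with j ⟨h1, h2⟩ w hw
  obtain ⟨c1, c2, c3, c4, c5⟩ := h2 w hw
  have hfm := (hp j).fst.maps c2
  have e1 : D.Ξ 0 (t j) (D.conj (t j) (f j) w) = f j (D.Ξ 0 (t j) w) :=
    Ξ_Θ norm_zero_lt (by linarith) hfm h1
  have e2 := (hp j).left_inv _ c2
  refine ⟨?_, ?_⟩
  · have d1 : DifferentiableAt ℂ (D.Ξ 0 (t j)) (D.conj (t j) (f j) w) :=
      D.differentiableAt_Ξ_Θ (by simpa using hη0) c5 hfm h1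
    have d2 : DifferentiableAt ℂ (g j) (D.Ξ 0 (t j) (D.conj (t j) (f j) w)) := by
      rw [e1]; exact (hp j).snd.diff.differentiableAt (hΩo.mem_nhds hfm)
    have d3 : DifferentiableAt ℂ (D.Θ 0 (t j)) (g j (D.Ξ 0 (t j) (D.conj (t j) (f j) w))) := by
      rw [e1, e2]; exact differentiableAt_Θ norm_zero_lt (by linarith) c2 h1
    exact DifferentiableAt.comp (g := D.Θ 0 (t j)) (f := fun w => g j (D.Ξ 0 (t j) w)) _ d3
      (DifferentiableAt.comp (g := g j) (f := D.Ξ 0 (t j)) _ d2 d1)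
  · change D.Θ 0 (t j) (g j (D.Ξ 0 (t j) (D.conj (t j) (f j) w))) = w
    rw [e1, e2, c4]

/-- Scaling limits of automorphism pairs are unitary and fix the normal direction. -/
theorem exists_scaling_limit (hΩo : IsOpen Ω) (hbd : Bornology.IsBounded Ω) (hη : η₁ < D.η)
    (ht : Tendsto t l (𝓝[>] 0)) (hA : D.A ≤ A₁)
    (hp : ∀ j, D.IsJPair A₁ η₁ (f j) (g j)) {L L' : ℝ} (hL : 1 ≤ L) (hL' : 1 ≤ L')
    (hf : ∀ ξ : ℝ, 0 < ξ → Tendsto (fun j => (t j : ℂ) * (D.G (f j (D.ψ (ξ / t j : ℝ))))⁻¹) l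
      (𝓝 ((L * ξ : ℝ) : ℂ)))
    (hg : ∀ ξ : ℝ, 0 < ξ → Tendsto (fun j => (t j : ℂ) * (D.G (g j (D.ψ (ξ / t j : ℝ))))⁻¹) l
      (𝓝 ((L' * ξ : ℝ) : ℂ))) :
    L = 1 ∧ ∃ U : En (m + 1) →ₗᵢ[ℂ] En (m + 1), U e0 = e0 ∧ ∀ u ∈ ball (0 : En (m + 1)) 1,
      Tendsto (fun j => D.conj (t j) (f j) u) l (𝓝 (U u)) := by
  have b1 := locBdd_conj hΩo hbd hη ht hA (fun j => (hp j).fst)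
  have b2 := locBdd_conj hΩo hbd hη ht hA (fun j => (hp j).snd)
  obtain ⟨φ, hφ⟩ := b1.exists_limit
  obtain ⟨γ, hγ⟩ := b2.exists_limit
  have n1 : ∀ u ∈ ball (0 : En (m + 1)) 1, ‖φ u‖ ≤ 1 := fun u hu =>
    norm_limit_conj_le_one hΩo hbd hη ht hA (fun j => (hp j).fst) hu (hφ u hu)
  have n2 : ∀ u ∈ ball (0 : En (m + 1)) 1, ‖γ u‖ ≤ 1 := fun u hu =>
    norm_limit_conj_le_one hΩo hbd hη ht hA (fun j => (hp j).snd) hu (hγ u hu)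
  have hcl : ∀ v : En (m + 1), ‖v‖ ≤ 1 → v ∈ closure (ball (0 : En (m + 1)) 1) := fun v hv => by
    rw [closure_ball _ one_ne_zero, mem_closedBall_zero_iff]; exact hv
  have s1 := eq_hyp_smul_e0 hL (b1.differentiableOn_limit isOpen_ball hφ) n1
    (fun τ hτ => c0_limit_conj hL hφ hf hτ)
  have s2 := eq_hyp_smul_e0 hL' (b2.differentiableOn_limit isOpen_ball hγ) n2
    (fun τ hτ => c0_limit_conj hL' hγ hg hτ)
  have hφ0 : φ 0 = hyp L 0 • e0 := by
    have := s1 0 (by simp); rwa [zero_smul] at this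
  have hBc := (convex_ball (0 : En (m + 1)) 1).isPreconnected
  obtain ⟨c1, c2, c3, c4, c5, c6⟩ := cartan_limit isOpen_ball hBc interior_closure_ball_subset
    isOpen_ball hBc interior_closure_ball_subset b1 b2 hφ hγ (fun u hu => hcl _ (n1 u hu))
    (fun u hu => hcl _ (n2 u hu)) (fun u hu => conj_conj_of_leftInverse hΩo hbd hη ht hA hp hu)
    (fun u hu => conj_conj_of_leftInverse hΩo hbd hη ht hA (fun j => (hp j).symm) hu)
    (mem_ball_self one_pos)
    (by rw [hφ0]; simpa [norm_smul] using norm_hyp_zero_lt hL)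
  have hLL : L * L' = 1 := by
    refine mul_eq_one_of_hyp_hyp hL hL' ?_
    have h1 := c5 0 (mem_ball_self one_pos)
    rw [hφ0, s2 _ (norm_hyp_zero_lt hL)] at h1
    have := congrArg c0 h1
    simpa using this
  have hL1 : L = 1 := by nlinarith
  refine ⟨hL1, ?_⟩
  have h00 : φ 0 = 0 := by rw [hφ0, hL1]; simp [hyp]
  obtain ⟨U, hU⟩ := exists_linearIsometry_of_ball_automorphism c1 c3 c2 c4 c5 h00
  refine ⟨U, ?_, fun u hu => by rw [← hU u hu]; exact hφ u hu⟩
  have h1 := s1 (1 / 2) (by norm_num)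
  have hm : ((1 / 2 : ℂ)) • (e0 : En (m + 1)) ∈ ball (0 : En (m + 1)) 1 := by
    rw [mem_ball_zero_iff, norm_smul, norm_e0]; norm_num
  rw [hU _ hm, map_smul, hL1] at h1
  have h2 : hyp 1 (1 / 2) = 1 / 2 := by norm_num [hyp]
  rw [h2] at h1
  exact smul_right_injective _ (by norm_num : (1 / 2 : ℂ) ≠ 0) h1

end NormData

namespace NormData

variable {m : ℕ} {Ω : Set (En (m + 1))} {D : NormData Ω} {A₁ η₁ : ℝ}

theorem IsJPair.tendsto_defect {f g : En (m + 1) → En (m + 1)} (hp : D.IsJPair A₁ η₁ f g)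
    (hΩo : IsOpen Ω) (hbd : Bornology.IsBounded Ω) (hη : η₁ < D.η) (hA : D.A ≤ A₁) :
    Tendsto (fun x : ℝ => D.defect A₁ f x / x) atTop (𝓝 0) := by
  obtain ⟨β, hβ, h⟩ := hp.fst.exists_angular hΩo hA hη
  obtain ⟨β', hβ', h'⟩ := hp.snd.exists_angular hΩo hA hη
  have ht : Tendsto (fun k : ℕ => 1 / ((k : ℝ) + 1)) (hyperfilter ℕ : Filter ℕ) (𝓝[>] 0) := by
    refine tendsto_nhdsWithin_iff.2 ⟨?_, Eventually.of_forall fun k => ?_⟩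
    · exact tendsto_one_div_add_atTop_nhds_zero_nat.mono_left Nat.hyperfilter_le_atTop
    · rw [mem_Ioi]; positivity
  have key := exists_scaling_limit (l := hyperfilter ℕ) (f := fun _ => f) (g := fun _ => g)
    hΩo hbd hη ht hA (fun _ => hp) (L := 1 + β) (L' := 1 + β') (by linarith) (by linarith)
    (fun ξ hξ => tendsto_mul_inv_G (D := D) (A₁ := A₁) (fs := fun _ => f) ht hξ
      (h.comp (tendsto_sub_atTop_of_pos ht hξ A₁)))
    (fun ξ hξ => tendsto_mul_inv_G (D := D) (A₁ := A₁) (fs := fun _ => g) ht hξ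
      (h'.comp (tendsto_sub_atTop_of_pos ht hξ A₁)))
  have hβ0 : β = 0 := by linarith [key.1]
  rw [hβ0, ofReal_zero] at h
  exact h

variable {F G : En (m + 1) → En (m + 1)}

theorem Sys.η₁_lt (S : Sys D η₁ F G) : η₁ < D.η := by linarith [S.η₁_pos, S.η₁_le]

theorem Sys.exists_scaling_limit (S : Sys D η₁ F G) {ι : Type} (l : Ultrafilter ι) (k : ι → ℕ)
    {t : ι → ℝ} (ht : Tendsto t l (𝓝[>] 0)) :
    ∃ U : En (m + 1) →ₗᵢ[ℂ] En (m + 1), U e0 = e0 ∧ ∀ u ∈ ball (0 : En (m + 1)) 1,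
      Tendsto (fun j => D.conj (t j) (F^[k j]) u) l (𝓝 (U u)) := by
  obtain ⟨A₁, hA, hpk, hlim⟩ := S.exists_pairs
  obtain ⟨φ, γ, hp, hφ, hγ⟩ := hlim l k
  have aux : ∀ {fs : ι → En (m + 1) → En (m + 1)} {f : En (m + 1) → En (m + 1)},
      (∀ j, D.IsJ A₁ η₁ (fs j)) → D.IsJ A₁ η₁ f →
      (∀ z ∈ Ω, Tendsto (fun j => fs j z) l (𝓝 (f z))) →
      Tendsto (fun x : ℝ => D.defect A₁ f x / x) atTop (𝓝 0) → ∀ ξ : ℝ, 0 < ξ →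
      Tendsto (fun j => (t j : ℂ) * (D.G (fs j (D.ψ (ξ / t j : ℝ))))⁻¹) l
        (𝓝 ((1 * ξ : ℝ) : ℂ)) := by
    intro fs f h1 h2 h3 h4 ξ hξ
    have h5 := tendsto_defect_of_limit S.isOpen hA S.η₁_lt h1 h2 h3 h4
      (tendsto_sub_atTop_of_pos ht hξ A₁)
    have h6 := tendsto_mul_inv_G (β := 0) ht hξ (by rw [ofReal_zero]; exact h5)
    rwa [add_zero] at h6
  exact (NormData.exists_scaling_limit S.isOpen S.bdd S.η₁_lt ht hA (fun j => hpk (k j)) le_rfl le_rfl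
    (aux (fun j => (hpk _).fst) hp.fst hφ (hp.tendsto_defect S.isOpen S.bdd S.η₁_lt hA))
    (aux (fun j => (hpk _).snd) hp.snd hγ (hp.symm.tendsto_defect S.isOpen S.bdd S.η₁_lt hA))).2

theorem c0_isometry {U : En (m + 1) →ₗᵢ[ℂ] En (m + 1)} (hU : U e0 = e0) (v : En (m + 1)) :
    c0 (U v) = c0 v := by
  have h : ∀ w : En (m + 1), inner ℂ (e0 : En (m + 1)) w = c0 w := fun w => by
    simp [e0, c0, EuclideanSpace.inner_single_left]
  rw [← h, ← h, ← U.inner_map_map e0 v, hU]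

theorem tl_Θ (D : NormData Ω) {z : En (m + 1)} {t : ℝ} (hz : ‖z‖ < D.η) (hzΩ : z ∈ Ω)
    (ht : 0 < t) : tl (D.Θ 0 t z) = (1 - c0 (D.Θ 0 t z)) • ((1 : ℂ) / ((√t : ℝ) : ℂ)) • tl z := by
  have h := W_add_one_ne (D := D) norm_zero_lt hz hzΩ ht
  have e : tl (D.W 0 t z) = ((1 : ℂ) / ((√t : ℝ) : ℂ)) • tl z := by
    rw [W, tl_scale, tl_N, sub_zero]
  rw [Θ, tl_cay, c0_cay, e]
  congr 1
  field_simp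
  ring

/-- Scaling limits of a single map tangent to the identity are the identity. -/
theorem IsTangent.eq_of_scaling_limit {f : En (m + 1) → En (m + 1)} (hf : IsTangent Ω f)
    {ι : Type*} {l : Ultrafilter ι} {t : ι → ℝ} (ht : Tendsto t l (𝓝[>] 0))
    {U : En (m + 1) →ₗᵢ[ℂ] En (m + 1)} (hU : U e0 = e0) {u : En (m + 1)}
    (hu : u ∈ ball (0 : En (m + 1)) 1)
    (h : Tendsto (fun j => D.conj (t j) f u) l (𝓝 (U u))) : U u = u := by
  have hη := D.η_pos
  have hpos : ∀ᶠ j in (l : Filter ι), 0 < t j := ht self_mem_nhdsWithin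
  have ht0 : Tendsto t l (𝓝 0) := ht.mono_right nhdsWithin_le_nhds
  have hu1 : ‖u‖ < 1 := by simpa using hu
  have hne : 1 - c0 u ≠ 0 := one_sub_c0_ne hu1 le_rfl
  set z : ι → En (m + 1) := fun j => D.Ξ 0 (t j) u with hz
  have hdiff : Tendsto (fun j => ((1 : ℂ) / ((√(t j) : ℝ) : ℂ)) • tl (f (z j)) -
      ((1 : ℂ) / ((√(t j) : ℝ) : ℂ)) • tl (z j)) l (𝓝 0) := by
    rw [Metric.tendsto_nhds]
    intro ε hε
    obtain ⟨σ₀, hσ₀, K, h0⟩ := D.exists_Ξ_bounds (norm_nonneg u) hu1 one_pos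
    set K' := max K 0 + 1
    have hK' : 0 < K' := by positivity
    obtain ⟨δ, hδ, hfδ⟩ := hf.littleO (ε / (2 * K')) (by positivity)
    obtain ⟨σ, hσ, K₂, h1⟩ := D.exists_Ξ_bounds (norm_nonneg u) hu1 hδ
    filter_upwards [hpos, ht0.eventually_lt_const hσ, ht0.eventually_lt_const hσ₀] with j a1 a2 a3
    obtain ⟨-, c2, c3, -⟩ := h1 0 (t j) (by simpa using hσ) a1 a2 (by simp [D.r_zero, a1.le]) u le_rfl
    obtain ⟨-, -, -, -, -, c6⟩ :=
      h0 0 (t j) (by simpa using hσ₀) a1 a3 (by simp [D.r_zero, a1.le]) u le_rfl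
    rw [sub_zero] at c6
    have hs : 0 < √(t j) := Real.sqrt_pos.2 a1
    rw [dist_zero_right, ← smul_sub, ← map_sub, norm_smul, norm_div, norm_one, norm_real,
      Real.norm_of_nonneg hs.le, one_div, inv_mul_lt_iff₀ hs]
    calc ‖tl (f (z j) - z j)‖ ≤ ‖f (z j) - z j‖ := norm_tl_le _
      _ ≤ ε / (2 * K') * ‖z j‖ := hfδ _ c2 c3
      _ ≤ ε / (2 * K') * (√(t j) * K') := by
          gcongr
          refine c6.trans ?_
          gcongr
          linarith [le_max_left K 0]
      _ = √(t j) * ε / 2 := by field_simp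
      _ < √(t j) * ε := by have := mul_pos hs hε; linarith
  obtain ⟨σ, hσ, K, h1⟩ := D.exists_Ξ_bounds (norm_nonneg u) hu1 (show 0 < D.η / 4 by linarith)
  obtain ⟨δ, hδ, hfδ⟩ := hf.littleO 1 one_pos
  obtain ⟨σ', hσ', K', h1'⟩ := D.exists_Ξ_bounds (norm_nonneg u) hu1 hδ
  have hc : Tendsto (fun j => (1 - c0 (D.conj (t j) f u))) l (𝓝 (1 - c0 u)) := by
    have := ((c0.continuous.tendsto _).comp h).const_sub 1
    rwa [c0_isometry hU] at this
  have hlim : Tendsto (fun j => tl (D.conj (t j) f u)) l (𝓝 (tl u)) := by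
    have h2 := hc.smul (hdiff.add_const ((1 / (1 - c0 u)) • tl u))
    rw [zero_add, smul_smul, mul_one_div_cancel hne, one_smul] at h2
    refine h2.congr' ?_
    filter_upwards [hpos, ht0.eventually_lt_const hσ, ht0.eventually_lt_const hσ'] with j a1 a2 a3
    obtain ⟨-, c2, c3, c4, -⟩ :=
      h1 0 (t j) (by simpa using hσ) a1 a2 (by simp [D.r_zero, a1.le]) u le_rfl
    obtain ⟨-, -, c3', -⟩ :=
      h1' 0 (t j) (by simpa using hσ') a1 a3 (by simp [D.r_zero, a1.le]) u le_rfl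
    have e1 := D.tl_Θ (z := z j) (by linarith) c2 a1
    rw [c4] at e1
    have e2 : (1 / (1 - c0 u)) • tl u = ((1 : ℂ) / ((√(t j) : ℝ) : ℂ)) • tl (z j) := by
      rw [e1, smul_smul (1 / (1 - c0 u)), one_div_mul_cancel hne, one_smul]
    have hfz : ‖f (z j)‖ < D.η := by
      have a := hfδ _ c2 c3'
      have b := norm_le_norm_add_norm_sub' (f (z j)) (z j)
      simp only [hz] at b ⊢
      linarith
    have e3 : D.conj (t j) f u = D.Θ 0 (t j) (f (z j)) := rfl
    have e4 := D.tl_Θ hfz (hf.maps c2) a1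
    rw [← e3] at e4
    rw [e2, sub_add_cancel, e4]
  refine ext_c0_tl (c0_isometry hU u) ?_
  exact tendsto_nhds_unique ((tl.continuous.tendsto _).comp h) hlim

/-- The local facts about scaled maps needed on the ball of radius `3 / 4`. -/
def Good (D : NormData Ω) (t : ℝ) (f : En (m + 1) → En (m + 1)) (w : En (m + 1)) : Prop :=
  DifferentiableAt ℂ (D.Ξ 0 t) w ∧ D.Ξ 0 t w ∈ Ω ∧ ‖D.Ξ 0 t w‖ < D.η / 6 ∧
      D.Θ 0 t (D.Ξ 0 t w) = w ∧ ‖f (D.Ξ 0 t w)‖ < D.η / 6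

theorem Sys.eventually_good (S : Sys D η₁ F G) {ι : Type} (l : Ultrafilter ι) (k : ι → ℕ)
    {t : ι → ℝ} (ht : Tendsto t l (𝓝[>] 0)) {U : En (m + 1) →ₗᵢ[ℂ] En (m + 1)}
    (hU : ∀ u ∈ ball (0 : En (m + 1)) 1,
      Tendsto (fun j => D.conj (t j) (F^[k j]) u) l (𝓝 (U u))) {ε : ℝ} (hε : 0 < ε) :
    ∀ᶠ j in (l : Filter ι), ∀ w ∈ closedBall (0 : En (m + 1)) (3 / 4),
      D.Good (t j) (F^[k j]) w ∧ ‖D.conj (t j) (F^[k j]) w - U w‖ ≤ ε := by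
  have hη := D.η_pos
  obtain ⟨A₁, hA, hpk, -⟩ := S.exists_pairs
  have hJ : ∀ j, D.IsJ A₁ η₁ (F^[k j]) := fun j => (hpk _).fst
  refine eventually_forall_of_isCompact (isCompact_closedBall _ _) fun u hu => ?_
  have hu1 : u ∈ ball (0 : En (m + 1)) 1 := closedBall_subset_ball (by norm_num) hu
  obtain ⟨ε1, hε1, h1⟩ := eventually_small S.isOpen S.bdd S.η₁_lt ht hA hJ hu1
    (show 0 < D.η / 6 by linarith)
  obtain ⟨ε2, hε2, h2⟩ := (locBdd_conj S.isOpen S.bdd S.η₁_lt ht hA hJ).eventually_ball hu1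
    (hU u hu1) (half_pos hε)
  refine ⟨min (min ε1 ε2) (ε / 2), by positivity, ?_⟩
  filter_upwards [h1, h2] with j a1 a2 w hw
  simp only [mem_ball, lt_min_iff] at hw
  refine ⟨a1.2 w hw.1.1, ?_⟩
  have b1 := a2 w hw.1.2
  have b2 : ‖U u - U w‖ < ε / 2 := by
    rw [← map_sub, U.norm_map, ← dist_eq_norm, dist_comm]; exact hw.2
  have b3 := norm_sub_le_norm_sub_add_norm_sub (D.conj (t j) (F^[k j]) w) (U u) (U w)
  linarith

theorem Sys.exists_good (S : Sys D η₁ F G) {ε : ℝ} (hε : 0 < ε) : ∃ σ > 0, ∀ t, 0 < t → t < σ →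
    ∀ k, ∃ U : En (m + 1) →ₗᵢ[ℂ] En (m + 1), ∀ w ∈ closedBall (0 : En (m + 1)) (3 / 4),
      D.Good t (F^[k]) w ∧ ‖D.conj t (F^[k]) w - U w‖ ≤ ε := by
  by_contra! hcon
  choose t ht0 ht k hk using fun j : ℕ => hcon (1 / ((j : ℝ) + 1)) (by positivity)
  have htt : Tendsto t (hyperfilter ℕ : Filter ℕ) (𝓝[>] 0) := by
    refine tendsto_nhdsWithin_iff.2 ⟨?_, Eventually.of_forall ht0⟩
    exact (squeeze_zero (fun j => (ht0 j).le) (fun j => (ht j).le)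
      tendsto_one_div_add_atTop_nhds_zero_nat).mono_left Nat.hyperfilter_le_atTop
  obtain ⟨U, -, hU⟩ := S.exists_scaling_limit (hyperfilter ℕ) k htt
  obtain ⟨j, hj⟩ := (S.eventually_good (hyperfilter ℕ) k htt hU hε).exists
  obtain ⟨w, hw, h⟩ := hk j U
  exact absurd (hj w hw).2 (not_le.2 (h (hj w hw).1))

theorem Sys.exists_near_id (S : Sys D η₁ F G) (k : ℕ) {ε : ℝ} (hε : 0 < ε) : ∃ σ > 0, ∀ t, 0 < t →
    t < σ → ∀ w ∈ closedBall (0 : En (m + 1)) (3 / 4), ‖D.conj t (F^[k]) w - w‖ ≤ ε := by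
  by_contra! hcon
  choose t ht0 ht w hw hk using fun j : ℕ => hcon (1 / ((j : ℝ) + 1)) (by positivity)
  have htt : Tendsto t (hyperfilter ℕ : Filter ℕ) (𝓝[>] 0) := by
    refine tendsto_nhdsWithin_iff.2 ⟨?_, Eventually.of_forall ht0⟩
    exact (squeeze_zero (fun j => (ht0 j).le) (fun j => (ht j).le)
      tendsto_one_div_add_atTop_nhds_zero_nat).mono_left Nat.hyperfilter_le_atTop
  obtain ⟨U, hUe, hU⟩ := S.exists_scaling_limit (hyperfilter ℕ) (fun _ => k) htt
  obtain ⟨j, hj⟩ := (S.eventually_good (hyperfilter ℕ) (fun _ => k) htt hU hε).exists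
  have h1 : w j ∈ ball (0 : En (m + 1)) 1 := closedBall_subset_ball (by norm_num) (hw j)
  have h2 := (hj (w j) (hw j)).2
  rw [(S.tangent.iterate k).eq_of_scaling_limit htt hUe h1 (hU _ h1)] at h2
  exact absurd h2 (not_le.2 (hk j))

end NormData

namespace NormData

variable {m : ℕ} {Ω : Set (En (m + 1))} {D : NormData Ω} {η₁ : ℝ} {F G : En (m + 1) → En (m + 1)}

theorem differentiableAt_conj (hΩ : IsOpen Ω) {f : En (m + 1) → En (m + 1)}
    (hf : DifferentiableOn ℂ f Ω) (hm : MapsTo f Ω Ω) {t : ℝ} (ht : 0 < t) {w : En (m + 1)}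
    (h : D.Good t f w) : DifferentiableAt ℂ (D.conj t f) w := by
  have hη := D.η_pos
  obtain ⟨h1, h2, h3, h4, h5⟩ := h
  have d1 : DifferentiableAt ℂ (D.Θ 0 t) (f (D.Ξ 0 t w)) :=
    differentiableAt_Θ norm_zero_lt (by linarith) (hm h2) ht
  exact DifferentiableAt.comp (g := D.Θ 0 t) (f := fun u => f (D.Ξ 0 t u)) w d1
    (DifferentiableAt.comp (g := f) (f := D.Ξ 0 t) w (hf.differentiableAt (hΩ.mem_nhds h2)) h1)

theorem fderiv_Ξ_comp_fderiv_Θ (hΩ : IsOpen Ω) {t : ℝ} (ht : 0 < t) {z : En (m + 1)} (hz : z ∈ Ω)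
    (hzη : ‖z‖ < D.η / 6) :
    (fderiv ℂ (D.Ξ 0 t) (D.Θ 0 t z)).comp (fderiv ℂ (D.Θ 0 t) z) =
      ContinuousLinearMap.id ℂ (En (m + 1)) := by
  have hη := D.η_pos
  have hzη' : ‖z‖ < D.η := by linarith
  have d1 : DifferentiableAt ℂ (D.Θ 0 t) z := differentiableAt_Θ norm_zero_lt hzη' hz ht
  have d2 : DifferentiableAt ℂ (D.Ξ 0 t) (D.Θ 0 t z) :=
    D.differentiableAt_Ξ_Θ (by simpa using hη) hzη hz ht
  rw [← fderiv_comp z d2 d1]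
  have : (D.Ξ 0 t ∘ D.Θ 0 t) =ᶠ[𝓝 z] id := by
    filter_upwards [hΩ.mem_nhds hz, (isOpen_lt continuous_norm continuous_const).mem_nhds hzη']
      with w hw hwη
    exact Ξ_Θ norm_zero_lt hwη hw ht
  rw [this.fderiv_eq, fderiv_id]

/-- The trace of the derivative at a fixed point does not depend on the scaling. -/
theorem trace_fderiv_conj (hΩ : IsOpen Ω) {f : En (m + 1) → En (m + 1)}
    (hf : DifferentiableOn ℂ f Ω) {t : ℝ} (ht : 0 < t) {w : En (m + 1)}
    (h : D.Good t f w) (hfix : f (D.Ξ 0 t w) = D.Ξ 0 t w) :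
    LinearMap.trace ℂ (En (m + 1)) (fderiv ℂ (D.conj t f) w) =
      LinearMap.trace ℂ (En (m + 1)) (fderiv ℂ f (D.Ξ 0 t w)) := by
  have hη := D.η_pos
  obtain ⟨h1, h2, h3, h4, h5⟩ := h
  have d1 : DifferentiableAt ℂ (D.Θ 0 t) (f (D.Ξ 0 t w)) := by
    rw [hfix]; exact differentiableAt_Θ norm_zero_lt (by linarith) h2 ht
  have d2 := hf.differentiableAt (hΩ.mem_nhds h2)
  have e1 : fderiv ℂ (D.conj t f) w = (fderiv ℂ (D.Θ 0 t) (D.Ξ 0 t w)).comp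
      ((fderiv ℂ f (D.Ξ 0 t w)).comp (fderiv ℂ (D.Ξ 0 t) w)) := by
    have e : D.conj t f = D.Θ 0 t ∘ (f ∘ D.Ξ 0 t) := rfl
    rw [e, fderiv_comp w (by exact d1) (DifferentiableAt.comp w d2 h1), fderiv_comp w d2 h1,
      comp_apply, hfix]
  have e2 := fderiv_Ξ_comp_fderiv_Θ (D := D) hΩ ht h2 h3
  rw [h4] at e2
  have e3 : (fderiv ℂ (D.Ξ 0 t) w : En (m + 1) →ₗ[ℂ] En (m + 1)) ∘ₗ
      (fderiv ℂ (D.Θ 0 t) (D.Ξ 0 t w) : En (m + 1) →ₗ[ℂ] En (m + 1)) = LinearMap.id := by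
    rw [← ContinuousLinearMap.toLinearMap_comp, e2]; rfl
  rw [e1, ContinuousLinearMap.toLinearMap_comp, ContinuousLinearMap.toLinearMap_comp,
    LinearMap.trace_comp_comm', LinearMap.comp_assoc, e3, LinearMap.comp_id]

/-- Passing from scale `t / 2` to scale `t` moves points near the center by less than `1 / 2`. -/
theorem norm_Θ_double_lt {t : ℝ} (ht : 0 < t) {z : En (m + 1)} (hz : z ∈ Ω) (hzη : ‖z‖ < D.η)
    (hc : ‖D.Θ 0 (t / 2) z‖ ≤ 1 / 1000) : ‖D.Θ 0 t z‖ < 1 / 2 := by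
  have ht2 : 0 < t / 2 := half_pos ht
  set c := D.Θ 0 (t / 2) z with hcdef
  set a := c0 c with ha
  have ha1 : ‖a‖ ≤ 1 / 1000 := (norm_c0_le c).trans hc
  have hne : 1 - a ≠ 0 := one_sub_c0_ne (by norm_num) hc
  have hw1 : D.W 0 (t / 2) z = cayInv c := (cayInv_Θ norm_zero_lt hzη hz ht2).symm
  have htc : (t : ℂ) ≠ 0 := by exact_mod_cast ht.ne'
  have hw2 : c0 (D.W 0 t z) = (1 + a) / (1 - a) / 2 := by
    have := congrArg c0 hw1
    rw [c0_cayInv, c0_W] at this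
    rw [← ha] at this
    rw [c0_W, ← this]
    push_cast
    field_simp
  have h3 : 3 - a ≠ 0 := by
    intro h
    rw [← sub_eq_zero.1 h] at ha1
    norm_num at ha1
  have hu0 : c0 (D.Θ 0 t z) = (-1 + 3 * a) / (3 - a) := by
    rw [Θ, c0_cay, hw2]
    have : (1 + a) / (1 - a) / 2 + 1 = (3 - a) / (2 * (1 - a)) := by field_simp; ring
    rw [this]
    field_simp
    ring
  have hn3 : 2.999 ≤ ‖3 - a‖ := by
    have := norm_sub_norm_le (3 : ℂ) a
    rw [Complex.norm_ofNat] at this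
    linarith
  have hb0 : ‖c0 (D.Θ 0 t z)‖ ≤ 0.34 := by
    rw [hu0, norm_div, div_le_iff₀ (by linarith)]
    have := norm_add_le (-1 : ℂ) (3 * a)
    rw [norm_neg, norm_one, norm_mul, Complex.norm_ofNat] at this
    linarith
  have e1 := D.tl_Θ hzη hz ht
  have e2 := D.tl_Θ hzη hz ht2
  rw [← hcdef, ← ha] at e2
  have hs : 0 < √t := Real.sqrt_pos.2 ht
  have hs2 : 0 < √(t / 2) := Real.sqrt_pos.2 ht2
  have hss : √(t / 2) ≤ √t := Real.sqrt_le_sqrt (by linarith)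
  have n1 : ‖tl (D.Θ 0 t z)‖ = ‖1 - c0 (D.Θ 0 t z)‖ * (‖tl z‖ / √t) := by
    rw [e1, norm_smul, norm_smul, norm_div, norm_one, norm_real, Real.norm_of_nonneg hs.le]; ring
  have n2 : ‖tl c‖ = ‖1 - a‖ * (‖tl z‖ / √(t / 2)) := by
    rw [e2, norm_smul, norm_smul, norm_div, norm_one, norm_real, Real.norm_of_nonneg hs2.le]; ring
  have n3 : ‖tl c‖ ≤ 1 / 1000 := (norm_tl_le c).trans hc
  have n4 : 0.9 ≤ ‖1 - a‖ := by
    have := norm_sub_norm_le (1 : ℂ) a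
    rw [norm_one] at this
    linarith
  have n5 : ‖1 - c0 (D.Θ 0 t z)‖ ≤ 2 := by
    have := norm_sub_le (1 : ℂ) (c0 (D.Θ 0 t z))
    rw [norm_one] at this
    linarith
  have n6 : ‖tl z‖ / √t ≤ ‖tl z‖ / √(t / 2) := by gcongr
  have n7 : 0 ≤ ‖tl z‖ / √t := by positivity
  have n8 : ‖tl z‖ / √t ≤ 1 / 900 := by
    have : 0.9 * (‖tl z‖ / √(t / 2)) ≤ 1 / 1000 := by
      refine le_trans ?_ (n2.symm.trans_le n3)
      gcongr
    linarith
  have n9 : ‖tl (D.Θ 0 t z)‖ ≤ 2 * (1 / 900) := by rw [n1]; gcongr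
  have hsq := norm_sq_eq (D.Θ 0 t z)
  refine lt_of_pow_lt_pow_left₀ 2 (by norm_num) ?_
  rw [hsq]
  have i1 : ‖c0 (D.Θ 0 t z)‖ ^ 2 ≤ 0.34 ^ 2 := by gcongr
  have i2 : ‖tl (D.Θ 0 t z)‖ ^ 2 ≤ (2 * (1 / 900)) ^ 2 := by gcongr
  norm_num at i1 i2 ⊢
  linarith

theorem Sys.nearIso (S : Sys D η₁ F G) {ε t : ℝ} (ht : 0 < t)
    (h : ∀ k, ∃ U : En (m + 1) →ₗᵢ[ℂ] En (m + 1), ∀ w ∈ closedBall (0 : En (m + 1)) (3 / 4),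
      D.Good t (F^[k]) w ∧ ‖D.conj t (F^[k]) w - U w‖ ≤ ε) :
    NearIso ε (fun k => D.conj t (F^[k])) := by
  have hη := D.η_pos
  have hgood : ∀ k, ∀ w ∈ ball (0 : En (m + 1)) (3 / 4), D.Good t (F^[k]) w := fun k w hw => by
    obtain ⟨U, hU⟩ := h k
    exact (hU w (ball_subset_closedBall hw)).1
  refine ⟨fun k w hw => ?_, fun k => ?_, fun u hu => ?_, fun k u hu => ?_⟩
  · exact (differentiableAt_conj S.isOpen (differentiableOn_iterate S.tangent.maps S.tangent.diff k)
      (S.tangent.maps.iterate k) ht (hgood k w hw)).differentiableWithinAt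
  · obtain ⟨U, hU⟩ := h k
    exact ⟨U, fun u hu => (hU u (ball_subset_closedBall hu)).2⟩
  · exact (hgood 0 u hu).2.2.2.1
  · obtain ⟨-, h2, -, -, h5⟩ := hgood 1 u (ball_subset_ball (by norm_num) hu)
    have e : D.Ξ 0 t (D.conj t (F^[1]) u) = F^[1] (D.Ξ 0 t u) :=
      Ξ_Θ norm_zero_lt (by linarith) (S.tangent.maps.iterate 1 h2) ht
    have e1 : D.conj t (F^[k]) (D.conj t (F^[1]) u) =
      D.Θ 0 t (F^[k] (D.Ξ 0 t (D.conj t (F^[1]) u))) := rfl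
    have e2 : D.conj t (F^[k + 1]) u = D.Θ 0 t (F^[k + 1] (D.Ξ 0 t u)) := rfl
    rw [e1, e2, e, iterate_succ_apply, iterate_one]

theorem Sys.fixed_of_conj (S : Sys D η₁ F G) {t : ℝ} (ht : 0 < t) {w : En (m + 1)}
    (h : D.Good t (F^[1]) w) (hc : D.conj t (F^[1]) w = w) : F (D.Ξ 0 t w) = D.Ξ 0 t w := by
  have hη := D.η_pos
  obtain ⟨-, h2, -, -, h5⟩ := h
  have e : D.Ξ 0 t (D.conj t (F^[1]) w) = F^[1] (D.Ξ 0 t w) :=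
    Ξ_Θ norm_zero_lt (by linarith) (S.tangent.maps.iterate 1 h2) ht
  rw [hc] at e
  exact e.symm

/-- The system admits only the identity. -/
theorem Sys.eq_id (S : Sys D η₁ F G) : ∀ z ∈ Ω, F z = z := by
  have hη := D.η_pos
  obtain ⟨ε, hε0, hε1, hε2⟩ : ∃ ε : ℝ, 0 < ε ∧ ε ≤ 1 / 1000 ∧
      ((m + 1 : ℕ) : ℝ) * √(2 * (((m + 1 : ℕ) : ℝ) * (8 * ε))) ≤ 1 / 4 := by
    have hcont : Tendsto (fun ε : ℝ => ((m + 1 : ℕ) : ℝ) * √(2 * (((m + 1 : ℕ) : ℝ) * (8 * ε))))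
        (𝓝[>] 0) (𝓝 0) := by
      have : Continuous (fun ε : ℝ => ((m + 1 : ℕ) : ℝ) * √(2 * (((m + 1 : ℕ) : ℝ) * (8 * ε)))) := by
        fun_prop
      have h := (this.tendsto 0).mono_left (nhdsWithin_le_nhds (s := Ioi 0))
      simpa using h
    have h1 := hcont.eventually_le_const (show (0 : ℝ) < 1 / 4 by norm_num)
    have h2 : ∀ᶠ ε : ℝ in 𝓝[>] 0, ε ≤ 1 / 1000 :=
      nhdsWithin_le_nhds (Iic_mem_nhds (by norm_num))
    obtain ⟨ε, a1, a2, a3⟩ := (h1.and (h2.and self_mem_nhdsWithin)).exists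
    exact ⟨ε, a3, a2, a1⟩
  obtain ⟨σ, hσ, hgood⟩ := S.exists_good hε0
  have hN : ∀ t, 0 < t → t < σ → NearIso ε (fun k => D.conj t (F^[k])) :=
    fun t ht htσ => S.nearIso ht (hgood t ht htσ)
  have hG : ∀ t, 0 < t → t < σ → ∀ k, ∀ w ∈ ball (0 : En (m + 1)) (3 / 4),
      D.Good t (F^[k]) w := fun t ht htσ k w hw => by
    obtain ⟨U, hU⟩ := hgood t ht htσ k
    exact (hU w (ball_subset_closedBall hw)).1
  choose! c hc hcfix using fun t (ht : 0 < t ∧ t < σ) =>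
    (hN t ht.1 ht.2).exists_fixed hε0.le hε1
  have hc2 : ∀ t, 0 < t ∧ t < σ → c t ∈ ball (0 : En (m + 1)) (1 / 2) := fun t ht => by
    rw [mem_ball_zero_iff]; linarith [hc t ht]
  have hsub : ball (0 : En (m + 1)) (1 / 2) ⊆ ball 0 (3 / 4) := ball_subset_ball (by norm_num)
  set τ : ℕ → ℝ → ℂ := fun k t =>
    LinearMap.trace ℂ (En (m + 1)) (fderiv ℂ (D.conj t (F^[k])) (c t)) with hτ
  have hhalf : ∀ k t, 0 < t ∧ t < σ → τ k t = τ k (t / 2) := by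
    intro k t ht
    have ht2 : 0 < t / 2 ∧ t / 2 < σ := ⟨by linarith [ht.1], by linarith [ht.1, ht.2]⟩
    have g2 := fun k => hG _ ht2.1 ht2.2 k _ (hsub (hc2 _ ht2))
    obtain ⟨-, hzΩ, hzη, hzc, -⟩ := g2 1
    set z := D.Ξ 0 (t / 2) (c (t / 2)) with hz
    have hfz : F z = z := S.fixed_of_conj ht2.1 (g2 1) (hcfix _ ht2)
    have hfzk : ∀ k, F^[k] z = z := fun k => Function.iterate_fixed hfz k
    set u := D.Θ 0 t z with hu
    have hun : u ∈ ball (0 : En (m + 1)) (1 / 2) := by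
      rw [mem_ball_zero_iff]
      refine norm_Θ_double_lt ht.1 hzΩ (by linarith) ?_
      rw [hzc]
      exact (hc _ ht2).trans hε1
    have hΞu : D.Ξ 0 t u = z := Ξ_Θ norm_zero_lt (by linarith) hzΩ ht.1
    have hufix : D.conj t (F^[1]) u = u := by
      have e : D.conj t (F^[1]) u = D.Θ 0 t (F^[1] (D.Ξ 0 t u)) := rfl
      rw [e, hΞu, hfzk]
    have hd := fun k => differentiableOn_iterate S.tangent.maps S.tangent.diff k
    have t1 := (hN t ht.1 ht.2).trace_eq (by linarith) (hc2 t ht) hun (hcfix t ht) hufix k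
    have t2 := trace_fderiv_conj S.isOpen (hd k) ht.1 (hG t ht.1 ht.2 k u (hsub hun))
      (by rw [hΞu]; exact hfzk k)
    have t3 := trace_fderiv_conj S.isOpen (hd k) ht2.1 (g2 k) (hfzk k)
    rw [hΞu] at t2
    simp only [hτ]
    rw [t3]
    exact t1.trans t2
  have hpow : ∀ k t, 0 < t ∧ t < σ → ∀ i : ℕ, τ k t = τ k (t / 2 ^ i) := by
    intro k t ht i
    induction i with
    | zero => simp
    | succ i ih =>
      rw [ih, hhalf k]
      · rw [pow_succ, div_div]
      · exact ⟨by have := ht.1; positivity,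
          (div_le_self ht.1.le (one_le_pow₀ (by norm_num))).trans_lt ht.2⟩
  have hlim : ∀ k, ∀ δ > 0, ∃ σ' > 0, ∀ t, 0 < t → t < σ' → t < σ →
      ‖τ k t - ((m + 1 : ℕ) : ℂ)‖ ≤ ((m + 1 : ℕ) : ℝ) * (8 * δ) := by
    intro k δ hδ
    obtain ⟨σ', hσ', h⟩ := S.exists_near_id k hδ
    refine ⟨σ', hσ', fun t ht0 ht1 ht2 => ?_⟩
    have h1 := NearIso.norm_fderiv_sub_le (U := LinearIsometry.id) ((hN t ht0 ht2).diff k)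
      (fun u hu => h t ht0 ht1 u (ball_subset_closedBall hu)) (hc2 t ⟨ht0, ht2⟩)
    have h2 := (norm_trace_le _).trans (mul_le_mul_of_nonneg_left h1 (Nat.cast_nonneg (m + 1)))
    refine le_of_eq_of_le (congrArg norm ?_) h2
    have e : ((fderiv ℂ (D.conj t (F^[k])) (c t) -
        (LinearIsometry.id (R := ℂ) (E := En (m + 1))).toContinuousLinearMap :
          En (m + 1) →L[ℂ] En (m + 1)) : En (m + 1) →ₗ[ℂ] En (m + 1)) =
        (fderiv ℂ (D.conj t (F^[k])) (c t) : En (m + 1) →ₗ[ℂ] En (m + 1)) - LinearMap.id := rfl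
    rw [e, map_sub, LinearMap.trace_id]
    simp [hτ]
  have hone : ∀ k t, 0 < t ∧ t < σ → τ k t = ((m + 1 : ℕ) : ℂ) := by
    intro k t ht
    by_contra hne
    have hpos : 0 < ‖τ k t - ((m + 1 : ℕ) : ℂ)‖ := norm_pos_iff.2 (sub_ne_zero.2 hne)
    set x := ‖τ k t - ((m + 1 : ℕ) : ℂ)‖ with hx
    have hm : (0 : ℝ) < ((m + 1 : ℕ) : ℝ) := by positivity
    obtain ⟨σ', hσ', h⟩ := hlim k (x / (16 * ((m + 1 : ℕ) : ℝ))) (by positivity)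
    have h3 : Tendsto (fun i : ℕ => t / 2 ^ i) atTop (𝓝 0) :=
      tendsto_const_nhds.div_atTop (tendsto_pow_atTop_atTop_of_one_lt (by norm_num))
    obtain ⟨i, hi⟩ := (h3.eventually_lt_const hσ').exists
    have h4 := h (t / 2 ^ i) (by have := ht.1; positivity) hi
      ((div_le_self ht.1.le (one_le_pow₀ (by norm_num))).trans_lt ht.2)
    rw [← hpow k t ht i, ← hx] at h4
    have : ((m + 1 : ℕ) : ℝ) * (8 * (x / (16 * ((m + 1 : ℕ) : ℝ)))) = x / 2 := by
      field_simp; norm_num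
    linarith
  have ht : 0 < σ / 2 ∧ σ / 2 < σ := ⟨by linarith, by linarith⟩
  set t := σ / 2
  have hid := (hN t ht.1 ht.2).eq_id (by linarith) hε2 (hc2 t ht) (fun k => hone k t ht)
  have h0 : (0 : En (m + 1)) ∈ ball (0 : En (m + 1)) (3 / 4) := mem_ball_self (by norm_num)
  obtain ⟨-, hzΩ, hzη, hz0, -⟩ := hG t ht.1 ht.2 1 0 h0
  refine eqOn_of_eventuallyEq S.isOpen S.preconn S.tangent.diff differentiableOn_id hzΩ ?_
  have hcont : ContinuousAt (D.Θ 0 t) (D.Ξ 0 t 0) :=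
    (differentiableAt_Θ norm_zero_lt (by linarith) hzΩ ht.1).continuousAt
  have hball : ∀ᶠ z in 𝓝 (D.Ξ 0 t 0), D.Θ 0 t z ∈ ball (0 : En (m + 1)) (1 / 4) := by
    refine hcont.eventually_mem ?_
    rw [hz0]
    exact ball_mem_nhds _ (by norm_num)
  filter_upwards [hball, S.isOpen.mem_nhds hzΩ,
    (isOpen_lt continuous_norm continuous_const).mem_nhds hzη] with z b1 b2 b3
  have b4 : ‖z‖ < D.η / 6 := b3
  have e := Ξ_Θ (D := D) norm_zero_lt (by linarith) b2 ht.1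
  have := S.fixed_of_conj ht.1 (hG t ht.1 ht.2 1 _ (ball_subset_ball (by norm_num) b1)) (hid _ b1)
  rw [e] at this
  exact this

end NormData

/-- A positive definite Hermitian form is the pullback of the standard one. -/
theorem exists_linearEquiv_of_core {V : Type*} [AddCommGroup V] [Module ℂ V]
    [FiniteDimensional ℂ V] (core : InnerProductSpace.Core ℂ V) {n : ℕ}
    (hn : Module.finrank ℂ V = n) :
    ∃ S : V ≃ₗ[ℂ] En n, ∀ v, ‖S v‖ ^ 2 = (core.inner v v).re := by
  let : NormedAddCommGroup V := core.toNormedAddCommGroup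
  let : InnerProductSpace ℂ V := InnerProductSpace.ofCore core.toCore
  let b := (stdOrthonormalBasis ℂ V).reindex (finCongr hn)
  refine ⟨b.repr.toLinearEquiv, fun v => ?_⟩
  have h1 : ‖b.repr v‖ ^ 2 = ‖v‖ ^ 2 := by rw [b.repr.norm_map]
  have h2 : ‖v‖ ^ 2 = (inner ℂ v v).re := norm_sq_eq_re_inner (𝕜 := ℂ) v
  exact h1.trans h2

/-- A nonzero functional is, up to a unitary map, a multiple of the first coordinate. -/
theorem exists_unitary_of_functional {m : ℕ} (ℓ : En (m + 1) →L[ℂ] ℂ) (hℓ : ℓ ≠ 0) :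
    ∃ (U : En (m + 1) ≃ₗᵢ[ℂ] En (m + 1)) (κ : ℝ), 0 < κ ∧ ∀ x, ℓ x = κ * c0 (U x) := by
  set w := (InnerProductSpace.toDual ℂ (En (m + 1))).symm ℓ with hw
  have hℓw : ∀ x, ℓ x = inner ℂ w x := fun x => by
    rw [hw, InnerProductSpace.toDual_symm_apply]
  have hw0 : w ≠ 0 := by
    intro h
    apply hℓ
    ext x
    rw [hℓw, h]; simp
  have hwn : 0 < ‖w‖ := norm_pos_iff.2 hw0
  have hwc : (‖w‖ : ℂ) ≠ 0 := by exact_mod_cast hwn.ne'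
  have hon : Orthonormal ℂ (({0} : Set (Fin (m + 1))).domRestrict
      (fun _ => ((‖w‖ : ℂ)⁻¹) • w)) := by
    constructor
    · intro i
      rw [Set.domRestrict_apply, norm_smul, norm_inv, norm_real, norm_norm,
        inv_mul_cancel₀ hwn.ne']
    · intro i j hij
      exact absurd (Subsingleton.elim i j) hij
  obtain ⟨b, hb⟩ := hon.exists_orthonormalBasis_extension_of_card_eq (by simp)
  refine ⟨b.repr, ‖w‖, hwn, fun x => ?_⟩
  have : c0 (b.repr x) = inner ℂ (b 0) x := b.repr_apply_apply x 0
  rw [this, hb 0 rfl, inner_smul_left, hℓw]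
  simp only [map_inv₀, conj_ofReal]
  rw [mul_inv_cancel_left₀ hwc]

section Forms

variable {n : ℕ}

theorem smul_eq_re_add_im (c : ℂ) (v : En n) : c • v = c.re • v + c.im • (I • v) := by
  conv_lhs => rw [← re_add_im c, add_smul, mul_smul]
  rfl

/-- The Levi form of a real symmetric bilinear form, as a sesquilinear form. -/
def leviSesq (H : En n →L[ℝ] En n →L[ℝ] ℝ) (v w : En n) : ℂ :=
  ⟨(1 / 4) * (H v w + H (I • v) (I • w)), (1 / 4) * (H (I • v) w - H v (I • w))⟩

theorem I_smul_I_smul (v : En n) : I • I • v = -v := by rw [smul_smul, I_mul_I]; simp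

theorem leviSesq_smul_left (H : En n →L[ℝ] En n →L[ℝ] ℝ) (v w : En n) (c : ℂ) :
    leviSesq H (c • v) w = (starRingEnd ℂ) c * leviSesq H v w := by
  have h1 : I • c • v = c.re • (I • v) + c.im • (-v) := by
    rw [smul_comm, smul_eq_re_add_im c (I • v), I_smul_I_smul]
  apply Complex.ext
  · simp only [leviSesq, h1, mul_re, conj_re, conj_im]
    rw [smul_eq_re_add_im c v]
    simp only [map_add, map_smul, map_neg, add_apply, smul_apply, neg_apply, smul_eq_mul]
    ring
  · simp only [leviSesq, h1, mul_im, conj_re, conj_im]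
    rw [smul_eq_re_add_im c v]
    simp only [map_add, map_smul, map_neg, add_apply, smul_apply, neg_apply, smul_eq_mul]
    ring

/-- The inner product structure given by a positive definite Levi form. -/
abbrev leviCore (H : En n →L[ℝ] En n →L[ℝ] ℝ) (hs : ∀ v w, H v w = H w v)
    (hpos : ∀ v, v ≠ 0 → 0 < (1 / 4) * (H v v + H (I • v) (I • v))) :
    InnerProductSpace.Core ℂ (En n) where
  inner := leviSesq H
  conj_inner_symm v w := by
    apply Complex.ext
    · simp only [leviSesq, conj_re]
      rw [hs w v, hs (I • w)]
    · simp only [leviSesq, conj_im]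
      rw [hs (I • w), hs w]
      ring
  re_inner_nonneg v := by
    show 0 ≤ (1 / 4) * (H v v + H (I • v) (I • v))
    by_cases h : v = 0
    · simp [h]
    · exact (hpos v h).le
  add_left u v w := by
    apply Complex.ext
    · simp only [leviSesq, add_re, map_add, smul_add, add_apply]; ring
    · simp only [leviSesq, add_im, map_add, smul_add, add_apply]; ring
  smul_left v w c := leviSesq_smul_left H v w c
  definite v h := by
    by_contra hv
    exact (hpos v hv).ne' (congrArg Complex.re h)

/-- Minus the complex bilinear part of a real symmetric bilinear form. -/
def bilPart (H : En n →L[ℝ] En n →L[ℝ] ℝ) (v w : En n) : ℂ :=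
  ⟨-((1 / 4) * (H v w - H (I • v) (I • w))), (1 / 4) * (H (I • v) w + H v (I • w))⟩

theorem bilPart_smul_left (H : En n →L[ℝ] En n →L[ℝ] ℝ) (v w : En n) (c : ℂ) :
    bilPart H (c • v) w = c * bilPart H v w := by
  have h1 : I • c • v = c.re • (I • v) + c.im • (-v) := by
    rw [smul_comm, smul_eq_re_add_im c (I • v), I_smul_I_smul]
  apply Complex.ext
  · simp only [bilPart, h1, mul_re]
    rw [smul_eq_re_add_im c v]
    simp only [map_add, map_smul, map_neg, add_apply, smul_apply, neg_apply, smul_eq_mul]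
    ring
  · simp only [bilPart, h1, mul_im]
    rw [smul_eq_re_add_im c v]
    simp only [map_add, map_smul, map_neg, add_apply, smul_apply, neg_apply, smul_eq_mul]
    ring

theorem bilPart_add_left (H : En n →L[ℝ] En n →L[ℝ] ℝ) (u v w : En n) :
    bilPart H (u + v) w = bilPart H u w + bilPart H v w := by
  apply Complex.ext
  · simp only [bilPart, add_re, map_add, smul_add, add_apply]; ring
  · simp only [bilPart, add_im, map_add, smul_add, add_apply]; ring

theorem bilPart_comm (H : En n →L[ℝ] En n →L[ℝ] ℝ) (hs : ∀ v w, H v w = H w v) (v w : En n) :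
    bilPart H v w = bilPart H w v := by
  apply Complex.ext
  · simp only [bilPart]; rw [hs w v, hs (I • w)]
  · simp only [bilPart]; rw [hs (I • w), hs w]; ring

theorem exists_bilinear (H : En n →L[ℝ] En n →L[ℝ] ℝ) (hs : ∀ v w, H v w = H w v) :
    ∃ B : En n →L[ℂ] En n →L[ℂ] ℂ, ∀ v w, B v w = bilPart H v w := by
  let B₀ : En n →ₗ[ℂ] En n →ₗ[ℂ] ℂ := LinearMap.mk₂ ℂ (bilPart H) (bilPart_add_left H)
    (fun c v w => bilPart_smul_left H v w c)
    (fun u v w => by rw [bilPart_comm H hs, bilPart_add_left, bilPart_comm H hs v,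
      bilPart_comm H hs w])
    (fun c v w => by rw [bilPart_comm H hs, bilPart_smul_left, bilPart_comm H hs w, smul_eq_mul])
  exact ⟨LinearMap.toContinuousLinearMap
    ((LinearMap.toContinuousLinearMap : (En n →ₗ[ℂ] ℂ) ≃ₗ[ℂ] En n →L[ℂ] ℂ).toLinearMap ∘ₗ B₀),
    fun v w => rfl⟩

/-- The complex linear functional whose real part is `-ℓ`. -/
def cplxPart (ℓ : En n →L[ℝ] ℝ) : En n →L[ℂ] ℂ := -(StrongDual.extendRCLike ℓ)

theorem cplxPart_apply (ℓ : En n →L[ℝ] ℝ) (v : En n) :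
    cplxPart ℓ v = -((ℓ v : ℂ) - I * (ℓ (I • v) : ℂ)) := by
  rw [cplxPart, neg_apply]
  rfl

theorem cplxPart_re (ℓ : En n →L[ℝ] ℝ) (v : En n) : (cplxPart ℓ v).re = -ℓ v := by
  rw [cplxPart_apply]; simp

theorem norm_cplxPart_sub_le (ℓ ℓ' : En n →L[ℝ] ℝ) (v : En n) :
    ‖cplxPart ℓ v - cplxPart ℓ' v‖ ≤ 2 * ‖ℓ - ℓ'‖ * ‖v‖ := by
  have e : cplxPart ℓ v - cplxPart ℓ' v =
      -(((ℓ - ℓ') v : ℝ) : ℂ) + I * (((ℓ - ℓ') (I • v) : ℝ) : ℂ) := by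
    rw [cplxPart_apply, cplxPart_apply, sub_apply, sub_apply]
    push_cast
    ring
  rw [e]
  refine (norm_add_le _ _).trans ?_
  rw [norm_neg, norm_mul, norm_I, one_mul, norm_real, norm_real]
  have h1 := (ℓ - ℓ').le_opNorm v
  have h2 := (ℓ - ℓ').le_opNorm (I • v)
  rw [norm_smul, norm_I, one_mul] at h2
  linarith

end Forms

section Taylor

variable {E : Type*} [NormedAddCommGroup E]

theorem exists_ball_norm_sub_le {V : Type*} [NormedAddCommGroup V] {f : E → V} (hc : Continuous f)
    (p : E) {ε : ℝ} (hε : 0 < ε) : ∃ δ > 0, ∀ w ∈ ball p δ, ‖f w - f p‖ ≤ ε := by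
  obtain ⟨δ, hδ, h⟩ := Metric.continuousAt_iff.1 (hc.continuousAt (x := p)) ε hε
  exact ⟨δ, hδ, fun w hw => by rw [← dist_eq_norm]; exact (h hw).le⟩

variable [NormedSpace ℝ E] {r : E → ℝ}

/-- Second order Taylor expansion with the Hessian at `p`, uniformly near `p`. -/
theorem exists_taylor_two (hr : ContDiff ℝ 2 r) (p : E) {ε : ℝ} (hε : 0 < ε) :
    ∃ η > 0, ∀ q v, ‖q - p‖ < η → ‖v‖ < η →
      |r (q + v) - r q - fderiv ℝ r q v - 1 / 2 * fderiv ℝ (fderiv ℝ r) p v v| ≤ ε * ‖v‖ ^ 2 := by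
  set H := fderiv ℝ (fderiv ℝ r) p with hH
  have hd1 : Differentiable ℝ r := hr.differentiable (by norm_num)
  have hr1 : ContDiff ℝ 1 (fderiv ℝ r) := hr.fderiv_right (by norm_num)
  have hd2 : Differentiable ℝ (fderiv ℝ r) := hr1.differentiable (by norm_num)
  have hc : Continuous (fderiv ℝ (fderiv ℝ r)) := hr1.continuous_fderiv (by norm_num)
  have hsymm : ∀ v w, H v w = H w v := fun v w =>
    (hr.contDiffAt (x := p)).isSymmSndFDerivAt (by simp) v w
  obtain ⟨δ, hδ, hball⟩ := exists_ball_norm_sub_le (V := E →L[ℝ] E →L[ℝ] ℝ)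
    (f := fderiv ℝ (fderiv ℝ r)) hc p hε
  refine ⟨δ / 2, half_pos hδ, fun q v hq hv => ?_⟩
  have hin : ∀ x : E, ‖x‖ ≤ ‖v‖ → q + x ∈ ball p δ := fun x hx => by
    rw [mem_ball, dist_eq_norm, show q + x - p = (q - p) + x by abel]
    have := norm_add_le (q - p) x
    linarith
  have hgrad : ∀ x : E, ‖x‖ ≤ ‖v‖ → ‖fderiv ℝ r (q + x) - fderiv ℝ r q - H x‖ ≤ ε * ‖v‖ := by
    intro x hx
    have := (convex_ball p δ).norm_image_sub_le_of_norm_hasFDerivWithin_le' (f := fderiv ℝ r)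
      (f' := fderiv ℝ (fderiv ℝ r)) (φ := H) (C := ε) (x := q) (y := q + x)
      (fun w _ => (hd2 w).hasFDerivAt.hasFDerivWithinAt)
      (fun w hw => hball w hw)
      (by simpa using hin 0 (by simp)) (hin x hx)
    rw [add_sub_cancel_left] at this
    exact this.trans (by gcongr)
  have hf : ∀ x : E, HasFDerivAt
      (fun x => r (q + x) - r q - fderiv ℝ r q x - 1 / 2 * H x x)
      (fderiv ℝ r (q + x) - fderiv ℝ r q - H x) x := by
    intro x
    have a1 : HasFDerivAt (fun x => r (q + x)) (fderiv ℝ r (q + x)) x := by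
      have := (hd1 (q + x)).hasFDerivAt.comp x ((hasFDerivAt_id x).const_add q)
      rw [ContinuousLinearMap.comp_id] at this
      exact this
    have a2 : HasFDerivAt (fun x => H x x) (H x + H.flip x) x := by
      have := H.hasFDerivAt.clm_apply (hasFDerivAt_id x) (x := x)
      simpa [add_comm] using this
    have a3 : H.flip x = H x := by ext w; exact hsymm w x
    rw [a3] at a2
    have := ((a1.sub_const (r q)).sub (fderiv ℝ r q).hasFDerivAt).sub (a2.const_mul (1 / 2))
    refine this.congr_fderiv ?_
    ext w
    simp only [sub_apply, smul_apply, add_apply, smul_eq_mul]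
    ring
  have := (convex_closedBall (0 : E) ‖v‖).norm_image_sub_le_of_norm_hasFDerivWithin_le
    (f := fun x => r (q + x) - r q - fderiv ℝ r q x - 1 / 2 * H x x)
    (f' := fun x => fderiv ℝ r (q + x) - fderiv ℝ r q - H x) (C := ε * ‖v‖) (x := 0) (y := v)
    (fun w _ => (hf w).hasFDerivWithinAt)
    (fun w hw => hgrad w (by simpa using hw)) (by simp) (by simp)
  simp only [add_zero, sub_self, map_zero, mul_zero, sub_zero] at this
  rw [← Real.norm_eq_abs]
  refine this.trans_eq ?_
  ring

end Taylor

theorem leviForm_eq {n : ℕ} (r : En n → ℝ) (q v : En n) :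
    LeviForm r q v = (1 / 4) * (fderiv ℝ (fderiv ℝ r) q v v +
      fderiv ℝ (fderiv ℝ r) q (I • v) (I • v)) := by
  rw [LeviForm, iteratedFDeriv_two_apply, iteratedFDeriv_two_apply]
  rfl

/-- At a boundary point where a `C²` local defining function has positive definite Levi form, the
domain can be put in normalized position by an affine change of coordinates. -/
theorem exists_normData {m : ℕ} {Ω : Set (En (m + 1))} {r : En (m + 1) → ℝ} (hr : ContDiff ℝ 2 r)
    {p : En (m + 1)} (hp : r p = 0) (hd : fderiv ℝ r p ≠ 0)
    (hL : ∀ v, v ≠ 0 → 0 < LeviForm r p v) (hΩ : ∀ᶠ z in 𝓝 p, (z ∈ Ω ↔ r z < 0)) :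
    ∃ A : En (m + 1) ≃L[ℂ] En (m + 1), Nonempty (NormData {x | p + A.symm x ∈ Ω}) := by
  set H := fderiv ℝ (fderiv ℝ r) p with hH
  have hsymm : ∀ v w, H v w = H w v := fun v w =>
    (hr.contDiffAt (x := p)).isSymmSndFDerivAt (by simp) v w
  have hpos : ∀ v, v ≠ 0 → 0 < (1 / 4) * (H v v + H (I • v) (I • v)) := fun v hv => by
    rw [hH, ← leviForm_eq]; exact hL v hv
  obtain ⟨S, hS⟩ := exists_linearEquiv_of_core (leviCore H hsymm hpos) (n := m + 1) (by simp)
  have hS' : ∀ v, ‖S v‖ ^ 2 = (1 / 4) * (H v v + H (I • v) (I • v)) := hS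
  have ha0 : cplxPart (fderiv ℝ r p) ≠ 0 := by
    intro h
    apply hd
    ext v
    have := cplxPart_re (fderiv ℝ r p) v
    rw [h] at this
    simpa using this
  set S' := S.toContinuousLinearEquiv
  obtain ⟨U, κ, hκ, hU⟩ := exists_unitary_of_functional
    ((cplxPart (fderiv ℝ r p)).comp (S'.symm : En (m + 1) →L[ℂ] En (m + 1))) (by
      intro h
      apply ha0
      ext v
      have := congrArg (fun f : En (m + 1) →L[ℂ] ℂ => f (S' v)) h
      simpa using this)
  have hκc : (κ : ℂ) ≠ 0 := by exact_mod_cast hκ.ne'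
  have hU' : ∀ v, cplxPart (fderiv ℝ r p) v = κ * c0 (U (S v)) := fun v => by
    rw [← show S' v = S v from rfl, ← hU (S' v)]
    simp
  let A : En (m + 1) ≃L[ℂ] En (m + 1) := (S'.trans U.toContinuousLinearEquiv).trans
    (ContinuousLinearEquiv.smulLeft (Units.mk0 ((κ : ℂ)⁻¹) (inv_ne_zero hκc)))
  have hA : ∀ v, A v = ((κ : ℂ)⁻¹) • U (S v) := fun v => rfl
  have hAn : ∀ v, ‖A v‖ ^ 2 = (κ ^ 2)⁻¹ * ((1 / 4) * (H v v + H (I • v) (I • v))) := fun v => by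
    rw [hA, norm_smul, U.norm_map, mul_pow, hS', norm_inv, norm_real, Real.norm_of_nonneg hκ.le,
      inv_pow]
  have hA0 : ∀ v, c0 (A v) = ((κ : ℂ) ^ 2)⁻¹ * cplxPart (fderiv ℝ r p) v := fun v => by
    rw [hA, hU', map_smul, smul_eq_mul]
    field_simp
  obtain ⟨B, hB⟩ := exists_bilinear H hsymm
  have hk2 : 0 < (κ ^ 2)⁻¹ := by positivity
  obtain ⟨C, hC, hCb⟩ : ∃ C : ℝ, 0 < C ∧ ∀ x, ‖A.symm x‖ ≤ C * ‖x‖ := by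
    refine ⟨‖(A.symm : En (m + 1) →L[ℂ] En (m + 1))‖ + 1, by positivity, fun x => ?_⟩
    refine ((A.symm : En (m + 1) →L[ℂ] En (m + 1)).le_opNorm x).trans ?_
    gcongr
    linarith
  obtain ⟨δ, hδ, hmem⟩ := Metric.eventually_nhds_iff.1 hΩ
  set T : En (m + 1) →L[ℂ] En (m + 1) := (A.symm : En (m + 1) →L[ℂ] En (m + 1)) with hT
  have hTx : ∀ x, T x = A.symm x := fun _ => rfl
  refine ⟨A, ⟨{
    r := fun x => (κ ^ 2)⁻¹ * r (p + A.symm x)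
    a := fun x => (((κ : ℂ) ^ 2)⁻¹) • (cplxPart (fderiv ℝ r (p + A.symm x))).comp T
    B := (((κ : ℂ) ^ 2)⁻¹) • ((B.comp T).flip.comp T).flip
    η₀ := δ / C
    η₀_pos := by positivity
    r_zero := by simp [hp]
    mem_iff := ?_
    a_zero := ?_
    taylor := ?_
    a_near := ?_ }⟩⟩
  · intro z hz
    have : dist (p + A.symm z) p < δ := by
      rw [dist_eq_norm, add_sub_cancel_left]
      refine (hCb z).trans_lt ?_
      rwa [lt_div_iff₀ hC, mul_comm] at hz
    show p + A.symm z ∈ Ω ↔ _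
    rw [hmem this]
    exact ⟨fun h => mul_neg_of_pos_of_neg hk2 h, fun h => (pos_iff_neg_of_mul_neg h).1 hk2⟩
  · ext x
    rw [map_zero, add_zero, smul_apply, ContinuousLinearMap.comp_apply, smul_eq_mul, ← hA0, hTx,
      A.apply_symm_apply]
  · intro ε hε
    obtain ⟨η, hη, h⟩ := exists_taylor_two hr p (ε := ε * κ ^ 2 / C ^ 2) (by positivity)
    refine ⟨η / C, by positivity, fun q v hq hv => ?_⟩
    rw [lt_div_iff₀ hC, mul_comm] at hq hv
    have hv2 := hCb v
    have h1 := h (p + A.symm q) (A.symm v) (by rw [add_sub_cancel_left]; exact (hCb q).trans_lt hq)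
      (hv2.trans_lt hv)
    have e1 : (((((κ : ℂ) ^ 2)⁻¹) • (cplxPart (fderiv ℝ r (p + A.symm q))).comp T) v +
        ((((κ : ℂ) ^ 2)⁻¹) • ((B.comp T).flip.comp T).flip) v v).re =
        (κ ^ 2)⁻¹ * (-fderiv ℝ r (p + A.symm q) (A.symm v) - (1 / 4) *
          (H (A.symm v) (A.symm v) - H (I • A.symm v) (I • A.symm v))) := by
      have : (((κ : ℂ) ^ 2)⁻¹) = (((κ ^ 2)⁻¹ : ℝ) : ℂ) := by push_cast; rfl
      simp only [this, smul_apply, smul_eq_mul, ContinuousLinearMap.comp_apply,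
        ContinuousLinearMap.flip_apply, hTx, add_re, re_ofReal_mul, cplxPart_re, hB, bilPart]
      ring
    have e2 : ‖v‖ ^ 2 = (κ ^ 2)⁻¹ * ((1 / 4) * (H (A.symm v) (A.symm v) +
        H (I • A.symm v) (I • A.symm v))) := by
      rw [← hAn, A.apply_symm_apply]
    have e3 : (κ ^ 2)⁻¹ * r (p + A.symm (q + v)) - (κ ^ 2)⁻¹ * r (p + A.symm q) +
        (κ ^ 2)⁻¹ * (-fderiv ℝ r (p + A.symm q) (A.symm v) - (1 / 4) *
          (H (A.symm v) (A.symm v) - H (I • A.symm v) (I • A.symm v))) -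
        (κ ^ 2)⁻¹ * ((1 / 4) * (H (A.symm v) (A.symm v) + H (I • A.symm v) (I • A.symm v))) =
        (κ ^ 2)⁻¹ * (r (p + A.symm q + A.symm v) - r (p + A.symm q) -
          fderiv ℝ r (p + A.symm q) (A.symm v) - 1 / 2 * H (A.symm v) (A.symm v)) := by
      rw [map_add, add_assoc]
      ring
    have e4 : |(κ ^ 2)⁻¹ * r (p + A.symm (q + v)) - (κ ^ 2)⁻¹ * r (p + A.symm q) +
        (κ ^ 2)⁻¹ * (-fderiv ℝ r (p + A.symm q) (A.symm v) - (1 / 4) *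
          (H (A.symm v) (A.symm v) - H (I • A.symm v) (I • A.symm v))) -
        (κ ^ 2)⁻¹ * ((1 / 4) * (H (A.symm v) (A.symm v) + H (I • A.symm v) (I • A.symm v)))| ≤
        ε * ‖v‖ ^ 2 := by
      rw [e3, abs_mul, abs_of_pos hk2]
      calc _ ≤ (κ ^ 2)⁻¹ * (ε * κ ^ 2 / C ^ 2 * ‖A.symm v‖ ^ 2) := by gcongr
        _ ≤ (κ ^ 2)⁻¹ * (ε * κ ^ 2 / C ^ 2 * (C * ‖v‖) ^ 2) := by gcongr
        _ = ε * ‖v‖ ^ 2 := by field_simp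
    rw [← e2, ← e1] at e4
    exact e4
  · intro ε hε
    have hc : Continuous (fderiv ℝ r) := hr.continuous_fderiv (by norm_num)
    obtain ⟨η, hη, h⟩ := Metric.continuousAt_iff.1 (hc.continuousAt (x := p))
      (ε * κ ^ 2 / (2 * C)) (by positivity)
    refine ⟨η / C, by positivity, fun q hq v => ?_⟩
    rw [lt_div_iff₀ hC, mul_comm] at hq
    have h1 := h (x := p + A.symm q)
      (by rw [dist_eq_norm, add_sub_cancel_left]; exact (hCb q).trans_lt hq)
    rw [dist_eq_norm] at h1
    have e : ((((κ : ℂ) ^ 2)⁻¹) • (cplxPart (fderiv ℝ r (p + A.symm q))).comp T) v - c0 v =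
        (((κ : ℂ) ^ 2)⁻¹) * (cplxPart (fderiv ℝ r (p + A.symm q)) (A.symm v) -
          cplxPart (fderiv ℝ r p) (A.symm v)) := by
      rw [mul_sub, ← hA0, A.apply_symm_apply, smul_apply, ContinuousLinearMap.comp_apply,
        smul_eq_mul, hTx]
    rw [e, norm_mul, norm_inv, norm_pow, norm_real, Real.norm_of_nonneg hκ.le]
    calc _ ≤ (κ ^ 2)⁻¹ * (2 * ‖fderiv ℝ r (p + A.symm q) - fderiv ℝ r p‖ * ‖A.symm v‖) := by
          gcongr; exact norm_cplxPart_sub_le _ _ _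
      _ ≤ (κ ^ 2)⁻¹ * (2 * (ε * κ ^ 2 / (2 * C)) * (C * ‖v‖)) := by
          gcongr
          exact hCb v
      _ = ε * ‖v‖ := by field_simp

section ConvexifiedDefiningFunction

variable {E : Type*} [NormedAddCommGroup E] [NormedSpace ℝ E] {ρ : E → ℝ}

theorem contDiff_add_sq (hρ : ContDiff ℝ 2 ρ) (K : ℝ) :
    ContDiff ℝ 2 (fun z => ρ z + K * ρ z ^ 2) := by fun_prop

theorem fderiv_add_sq (hρ : ContDiff ℝ 2 ρ) (K : ℝ) :
    fderiv ℝ (fun z => ρ z + K * ρ z ^ 2) = fun z => (1 + 2 * K * ρ z) • fderiv ℝ ρ z := by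
  funext z
  have h1 : HasFDerivAt ρ (fderiv ℝ ρ z) z := (hρ.differentiable (by norm_num) z).hasFDerivAt
  have h2 := h1.add ((h1.pow 2).const_mul K)
  refine h2.fderiv.trans ?_
  ext v
  simp only [add_apply, smul_apply, smul_eq_mul]
  simp
  ring

theorem fderiv_fderiv_add_sq (hρ : ContDiff ℝ 2 ρ) (K : ℝ) {p : E} (hp : ρ p = 0) (v w : E) :
    fderiv ℝ (fderiv ℝ (fun z => ρ z + K * ρ z ^ 2)) p v w =
      fderiv ℝ (fderiv ℝ ρ) p v w + 2 * K * (fderiv ℝ ρ p v * fderiv ℝ ρ p w) := by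
  rw [fderiv_add_sq hρ]
  have hr1 : ContDiff ℝ 1 (fderiv ℝ ρ) := hρ.fderiv_right (by norm_num)
  have h1 : HasFDerivAt ρ (fderiv ℝ ρ p) p := (hρ.differentiable (by norm_num) p).hasFDerivAt
  have h2 : HasFDerivAt (fderiv ℝ ρ) (fderiv ℝ (fderiv ℝ ρ) p) p :=
    (hr1.differentiable (by norm_num) p).hasFDerivAt
  have h3 := ((h1.const_mul (2 * K)).const_add 1).smul h2
  have h4 := h3.fderiv
  have h5 : fderiv ℝ (fun z => (1 + 2 * K * ρ z) • fderiv ℝ ρ z) p = _ := h4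
  rw [h5, hp]
  simp only [add_apply, smul_apply, smul_eq_mul, ContinuousLinearMap.smulRight_apply]
  ring

end ConvexifiedDefiningFunction

section Levi

variable {n : ℕ}

theorem leviForm_smul (r : En n → ℝ) (q v : En n) (c : ℝ) :
    LeviForm r q (c • v) = c ^ 2 * LeviForm r q v := by
  rw [leviForm_eq, leviForm_eq, smul_comm I c v]
  simp only [map_smul, smul_apply, smul_eq_mul]
  ring

theorem leviForm_pos_of_sphere {r : En n → ℝ} {q : En n}
    (h : ∀ v ∈ sphere (0 : En n) 1, 0 < LeviForm r q v) (v : En n) (hv : v ≠ 0) :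
    0 < LeviForm r q v := by
  have hn : 0 < ‖v‖ := norm_pos_iff.2 hv
  have := h (‖v‖⁻¹ • v) (by simp [norm_smul, hn.ne'])
  rw [leviForm_smul] at this
  exact pos_of_mul_pos_right this (by positivity)

theorem continuous_leviForm {r : En n → ℝ} (hr : ContDiff ℝ 2 r) :
    Continuous (fun x : En n × En n => LeviForm r x.1 x.2) := by
  simp only [leviForm_eq]
  have hr1 : ContDiff ℝ 1 (fderiv ℝ r) := hr.fderiv_right (by norm_num)
  have hc : Continuous (fderiv ℝ (fderiv ℝ r)) := hr1.continuous_fderiv (by norm_num)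
  have h1 : Continuous (fun x : En n × En n => fderiv ℝ (fderiv ℝ r) x.1) := hc.comp continuous_fst
  have h2 : Continuous (fun x : En n × En n => I • x.2) := continuous_snd.const_smul I
  have h3 := (h1.clm_apply continuous_snd).clm_apply continuous_snd
  have h4 := (h1.clm_apply h2).clm_apply h2
  exact (h3.add h4).const_mul (1 / 4)

theorem eventually_leviForm_pos {r : En n → ℝ} (hr : ContDiff ℝ 2 r) {p : En n}
    (h : ∀ v, v ≠ 0 → 0 < LeviForm r p v) :
    ∀ᶠ q in 𝓝 p, ∀ v, v ≠ 0 → 0 < LeviForm r q v := by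
  have : ∀ᶠ q in 𝓝 p, ∀ v ∈ sphere (0 : En n) 1, 0 < LeviForm r q v := by
    refine (isCompact_sphere _ _).eventually_forall_of_forall_eventually fun v hv => ?_
    exact ((continuous_leviForm hr).tendsto (p, v)).eventually_const_lt
      (h v (ne_zero_of_mem_unit_sphere ⟨v, hv⟩))
  filter_upwards [this] with q hq
  exact leviForm_pos_of_sphere hq

/-- Adding a multiple of the square makes the Levi form positive definite. -/
theorem exists_leviForm_pos {ρ : En n → ℝ} (hρ : ContDiff ℝ 2 ρ) {p : En n} (hp : ρ p = 0)
    (h : StronglyPcxAt ρ p) :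
    ∃ K : ℝ, ∀ v, v ≠ 0 → 0 < LeviForm (fun z => ρ z + K * ρ z ^ 2) p v := by
  set g : En n → ℝ := fun v => (1 / 2) * (fderiv ℝ ρ p v ^ 2 + fderiv ℝ ρ p (I • v) ^ 2) with hg
  have hgc : Continuous g := by
    have h2 : Continuous (fun x : En n => I • x) := continuous_id.const_smul I
    have h3 := (fderiv ℝ ρ p).continuous
    have h4 := h3.comp h2
    exact ((h3.pow 2).add (h4.pow 2)).const_mul _
  have hLc : Continuous (fun v => LeviForm ρ p v) :=
    (continuous_leviForm hρ).comp (Continuous.prodMk_right p)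
  have hg0 : ∀ v, 0 ≤ g v := fun v => by positivity
  have hform : ∀ K v, LeviForm (fun z => ρ z + K * ρ z ^ 2) p v = LeviForm ρ p v + K * g v := by
    intro K v
    rw [leviForm_eq, leviForm_eq, fderiv_fderiv_add_sq hρ K hp, fderiv_fderiv_add_sq hρ K hp]
    simp only [hg]
    ring
  have hev : ∀ᶠ K : ℝ in atTop, ∀ v ∈ sphere (0 : En n) 1, 0 < LeviForm ρ p v + K * g v := by
    refine eventually_forall_of_isCompact (isCompact_sphere _ _) fun v hv => ?_
    have hv0 : v ≠ 0 := ne_zero_of_mem_unit_sphere ⟨v, hv⟩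
    rcases (hg0 v).eq_or_lt with h0 | h0
    · have ht : InCplxTangent ρ p v := by
        simp only [hg] at h0
        have a := sq_nonneg (fderiv ℝ ρ p v)
        have b := sq_nonneg (fderiv ℝ ρ p (I • v))
        exact ⟨pow_eq_zero_iff two_ne_zero |>.1 (by linarith),
          pow_eq_zero_iff two_ne_zero |>.1 (by linarith)⟩
      obtain ⟨ε, hε, hb⟩ := Metric.eventually_nhds_iff_ball.1
        ((hLc.tendsto v).eventually_const_lt (h v hv0 ht))
      refine ⟨ε, hε, ?_⟩
      filter_upwards [eventually_ge_atTop 0] with K hK w hw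
      exact add_pos_of_pos_of_nonneg (hb w hw) (mul_nonneg hK (hg0 w))
    · obtain ⟨ε, hε, hb⟩ := Metric.eventually_nhds_iff_ball.1
        (((hLc.tendsto v).eventually_const_lt (show LeviForm ρ p v - 1 < LeviForm ρ p v by
          linarith)).and ((hgc.tendsto v).eventually_const_lt (half_lt_self h0)))
      refine ⟨ε, hε, ?_⟩
      have h1 : Tendsto (fun K : ℝ => K * (g v / 2)) atTop atTop :=
        tendsto_id.atTop_mul_const (half_pos h0)
      filter_upwards [eventually_ge_atTop 0, h1.eventually_gt_atTop (1 - LeviForm ρ p v)]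
        with K hK hK2 w hw
      have := mul_le_mul_of_nonneg_left (hb w hw).2.le hK
      linarith [(hb w hw).1]
  obtain ⟨K, hK⟩ := hev.exists
  refine ⟨K, leviForm_pos_of_sphere fun v hv => ?_⟩
  rw [hform]
  exact hK v hv

end Levi

/-- Near a strongly pseudoconvex point every boundary point can be normalized. -/
theorem eventually_exists_normData {m : ℕ} {Ω : Set (En (m + 1))} {ρ : En (m + 1) → ℝ}
    (hρ : IsDefiningFunction Ω ⊤ ρ) {p : En (m + 1)} (hp : p ∈ frontier Ω)
    (h : StronglyPcxAt ρ p) : ∀ᶠ q in 𝓝 p, q ∈ frontier Ω →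
      ∃ A : En (m + 1) ≃L[ℂ] En (m + 1), Nonempty (NormData {x | q + A.symm x ∈ Ω}) := by
  obtain ⟨hρs, hΩ, hfr, hd⟩ := hρ
  have hρ2 : ContDiff ℝ 2 ρ := hρs.of_le (by norm_cast)
  have hz : ∀ q ∈ frontier Ω, ρ q = 0 := fun q hq => by rw [hfr] at hq; exact hq
  obtain ⟨K, hK⟩ := exists_leviForm_pos hρ2 (hz p hp) h
  have hmem : ∀ᶠ z in 𝓝 p, (z ∈ Ω ↔ ρ z + K * ρ z ^ 2 < 0) := by
    have hc : Continuous (fun z => 1 + K * ρ z) := by have := hρ2.continuous; fun_prop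
    have h0 := (hc.tendsto p).eventually_const_lt (show 0 < 1 + K * ρ p by simp [hz p hp])
    filter_upwards [h0] with z hz
    rw [hΩ, show ρ z + K * ρ z ^ 2 = ρ z * (1 + K * ρ z) by ring]
    exact ⟨fun h => mul_neg_of_neg_of_pos h hz, fun h => (neg_iff_pos_of_mul_neg h).2 hz⟩
  filter_upwards [eventually_leviForm_pos (contDiff_add_sq hρ2 K) hK, eventually_eventually_nhds.2 hmem]
    with q h1 h2 hq
  refine exists_normData (contDiff_add_sq hρ2 K) (by simp [hz q hq]) ?_ h1 h2
  rw [fderiv_add_sq hρ2]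
  simpa [hz q hq] using hd q hq

section AffineConjugation

variable {E : Type*} [NormedAddCommGroup E] [NormedSpace ℂ E] (A : E ≃L[ℂ] E) (q : E)

/-- The affine homeomorphism `x ↦ q + A⁻¹ x`. -/
def affHomeo : E ≃ₜ E := A.symm.toHomeomorph.trans (Homeomorph.addLeft q)

theorem affHomeo_apply (x : E) : affHomeo A q x = q + A.symm x := rfl

theorem affHomeo_symm_apply (z : E) : (affHomeo A q).symm z = A (z - q) := by
  rw [Homeomorph.symm_apply_eq, affHomeo_apply]; simp

theorem differentiable_affHomeo : Differentiable ℂ (affHomeo A q) :=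
  (differentiable_const q).add A.symm.differentiable

theorem differentiable_affHomeo_symm : Differentiable ℂ (affHomeo A q).symm := by
  have h : ⇑(affHomeo A q).symm = fun z => A (z - q) := funext (affHomeo_symm_apply A q)
  rw [h]
  exact A.differentiable.comp (differentiable_id.sub_const q)

/-- The map `F` in the affine coordinate `A (z - q)`. -/
def affConj (F : E → E) (x : E) : E := (affHomeo A q).symm (F (affHomeo A q x))

variable {A q} {F G : E → E} {Ω : Set E}

theorem affHomeo_affConj (x : E) : affHomeo A q (affConj A q F x) = F (affHomeo A q x) :=
  (affHomeo A q).apply_symm_apply _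

theorem affConj_iterate (k : ℕ) : (affConj A q F)^[k] = affConj A q F^[k] := by
  funext x
  refine (affHomeo A q).injective ?_
  rw [affHomeo_affConj]
  exact (Function.Semiconj.iterate_right (f := affHomeo A q) (fun y => affHomeo_affConj y) k) x

theorem differentiableOn_affConj (h : DifferentiableOn ℂ F Ω) :
    DifferentiableOn ℂ (affConj A q F) (affHomeo A q ⁻¹' Ω) :=
  (differentiable_affHomeo_symm A q).comp_differentiableOn
    (h.comp (differentiable_affHomeo A q).differentiableOn fun _ hx => hx)

theorem mapsTo_affConj (h : MapsTo F Ω Ω) :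
    MapsTo (affConj A q F) (affHomeo A q ⁻¹' Ω) (affHomeo A q ⁻¹' Ω) := fun x hx => by
  rw [mem_preimage, affHomeo_affConj]; exact h hx

theorem affConj_left_inv (h : ∀ z ∈ Ω, G (F z) = z) :
    ∀ x ∈ affHomeo A q ⁻¹' Ω, affConj A q G (affConj A q F x) = x := fun x hx => by
  refine (affHomeo A q).injective ?_
  rw [affHomeo_affConj, affHomeo_affConj]; exact h _ hx

theorem isBounded_affHomeo_preimage (h : Bornology.IsBounded Ω) :
    Bornology.IsBounded (affHomeo A q ⁻¹' Ω) := by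
  rw [isBounded_iff_forall_norm_le] at h ⊢
  obtain ⟨C, hC⟩ := h
  refine ⟨‖(A : E →L[ℂ] E)‖ * (C + ‖q‖), fun x hx => ?_⟩
  have hx' : x = A (affHomeo A q x - q) := by
    rw [← affHomeo_symm_apply, Homeomorph.symm_apply_apply]
  calc ‖x‖ = ‖(A : E →L[ℂ] E) (affHomeo A q x - q)‖ := congrArg norm hx'
    _ ≤ ‖(A : E →L[ℂ] E)‖ * ‖affHomeo A q x - q‖ := ContinuousLinearMap.le_opNorm _ _
    _ ≤ _ := by gcongr; exact (norm_sub_le _ _).trans (add_le_add_left (hC _ hx) _)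

theorem interior_closure_affHomeo_preimage (h : interior (closure Ω) ⊆ Ω) :
    interior (closure (affHomeo A q ⁻¹' Ω)) ⊆ affHomeo A q ⁻¹' Ω := by
  rw [← Homeomorph.preimage_closure, ← Homeomorph.preimage_interior]
  exact preimage_mono h

end AffineConjugation

/-- A domain with a regular defining function is the interior of its closure. -/
theorem IsDefiningFunction.interior_closure_subset {n : ℕ} {Ω : Set (En n)} {ρ : En n → ℝ} {k : ℕ∞}
    (h : IsDefiningFunction Ω k ρ) : interior (closure Ω) ⊆ Ω := by
  obtain ⟨-, hΩ, hfr, hd⟩ := h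
  intro z hz
  by_contra hzΩ
  have hle : ∀ w ∈ closure Ω, ρ w ≤ 0 := fun w hw => by
    by_cases hw' : w ∈ Ω
    · rw [hΩ] at hw'; exact le_of_lt hw'
    · have : w ∈ frontier Ω := ⟨hw, fun h => hw' (interior_subset h)⟩
      rw [hfr] at this; exact le_of_eq this
  have hzf : z ∈ frontier Ω := ⟨interior_subset hz, fun h => hzΩ (interior_subset h)⟩
  have hz0 : ρ z = 0 := by have := hzf; rw [hfr] at this; exact this
  refine hd z hzf (IsLocalMax.fderiv_eq_zero ?_)
  filter_upwards [mem_interior_iff_mem_nhds.1 hz] with w hw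
  rw [hz0]; exact hle w hw

section Transfer

variable {m : ℕ} {Ω : Set (En (m + 1))}

/-- The Wong–Rosay theorem at a boundary point which can be normalized. -/
theorem exists_ball_equiv_of_tendsto {q : En (m + 1)} {A : En (m + 1) ≃L[ℂ] En (m + 1)}
    (D : NormData {x | q + A.symm x ∈ Ω}) (hΩo : IsOpen Ω) (hΩc : IsPreconnected Ω)
    (hbd : Bornology.IsBounded Ω) (hreg : interior (closure Ω) ⊆ Ω) {ι : Type*}
    {l : Ultrafilter ι} {φ χ : ι → En (m + 1) → En (m + 1)}
    (hφ : ∀ j, DifferentiableOn ℂ (φ j) Ω) (hφm : ∀ j, MapsTo (φ j) Ω Ω)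
    (hχ : ∀ j, DifferentiableOn ℂ (χ j) Ω) (hχm : ∀ j, MapsTo (χ j) Ω Ω)
    (hχφ : ∀ j, ∀ z ∈ Ω, χ j (φ j z) = z) (hφχ : ∀ j, ∀ z ∈ Ω, φ j (χ j z) = z)
    {o : En (m + 1)} (ho : o ∈ Ω) (h0 : Tendsto (fun j => φ j o) l (𝓝 q)) :
    ∃ Φ Ψ : En (m + 1) → En (m + 1),
      DifferentiableOn ℂ Φ Ω ∧ MapsTo Φ Ω (ball 0 1) ∧
      DifferentiableOn ℂ Ψ (ball 0 1) ∧ MapsTo Ψ (ball 0 1) Ω ∧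
      (∀ z ∈ Ω, Ψ (Φ z) = z) ∧ (∀ w ∈ ball (0 : En (m + 1)) 1, Φ (Ψ w) = w) := by
  set e := affHomeo A q with he
  have ho' : e.symm o ∈ e ⁻¹' Ω := by rw [mem_preimage, e.apply_symm_apply]; exact ho
  have ht : Tendsto (fun j => affConj A q (φ j) (e.symm o)) l (𝓝 0) := by
    have h1 := (e.symm.continuous.tendsto q).comp h0
    have h2 : e.symm q = 0 := by rw [he, affHomeo_symm_apply]; simp
    rw [h2] at h1
    refine h1.congr fun j => ?_
    simp [affConj, ← he]
  obtain ⟨Φ, Ψ, h1, h2, h3, h4, h5, h6⟩ := D.wong_rosay (hΩo.preimage e.continuous)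
    (e.isPreconnected_preimage.2 hΩc) (isBounded_affHomeo_preimage hbd)
    (interior_closure_affHomeo_preimage hreg) (fun j => differentiableOn_affConj (hφ j))
    (fun j => mapsTo_affConj (hφm j)) (fun j => differentiableOn_affConj (hχ j))
    (fun j => mapsTo_affConj (hχm j)) (fun j => affConj_left_inv (hχφ j))
    (fun j => affConj_left_inv (hφχ j)) ho' ht
  have hm : MapsTo e.symm Ω (e ⁻¹' Ω) := fun z hz => by
    rw [mem_preimage, e.apply_symm_apply]; exact hz
  refine ⟨Φ ∘ e.symm, e ∘ Ψ, h1.comp (differentiable_affHomeo_symm A q).differentiableOn hm,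
    h2.comp hm, (differentiable_affHomeo A q).comp_differentiableOn h3, fun w hw => h4 hw,
    fun z hz => ?_, fun w hw => ?_⟩
  · simp only [comp_apply]; rw [h5 _ (hm hz), e.apply_symm_apply]
  · simp only [comp_apply]; rw [e.symm_apply_apply, h6 w hw]

theorem isTangent_affConj {p : En (m + 1)} {A : En (m + 1) ≃L[ℂ] En (m + 1)}
    {F : En (m + 1) → En (m + 1)} (hF : DifferentiableOn ℂ F Ω) (hFm : MapsTo F Ω Ω)
    (hp : p ∉ Ω) (ho : LittleOh Ω F p 1) :
    NormData.IsTangent (affHomeo A p ⁻¹' Ω) (affConj A p F) := by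
  refine ⟨differentiableOn_affConj hF, mapsTo_affConj hFm, fun ε hε => ?_⟩
  set a := ‖(A : En (m + 1) →L[ℂ] En (m + 1))‖ with ha
  set b := ‖(A.symm : En (m + 1) →L[ℂ] En (m + 1))‖ with hb
  have hab : 0 < a * b + 1 := by positivity
  have h1 := (tendsto_order.1 ho).2 (ε / (a * b + 1)) (by positivity)
  obtain ⟨δ, hδ, hball⟩ := Metric.eventually_nhds_iff_ball.1 (eventually_nhdsWithin_iff.1 h1)
  refine ⟨δ / (b + 1), by positivity, fun x hx hxδ => ?_⟩
  have hx1 : ‖A.symm x‖ ≤ b * ‖x‖ :=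
    (A.symm : En (m + 1) →L[ℂ] En (m + 1)).le_opNorm x
  have hx2 : ‖A.symm x‖ < δ := by
    rw [lt_div_iff₀ (by positivity)] at hxδ
    nlinarith [norm_nonneg x]
  have hz : affHomeo A p x - p = A.symm x := by rw [affHomeo_apply]; simp
  have h2 := hball (affHomeo A p x) (by rw [mem_ball, dist_eq_norm, hz]; exact hx2) hx
  rw [hz, pow_one] at h2
  have hx0 : 0 < ‖A.symm x‖ := by
    rw [← hz]
    exact norm_sub_pos_iff.2 fun h => hp (h ▸ hx)
  rw [div_lt_iff₀ hx0] at h2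
  have h3 : affConj A p F x - x = A (F (affHomeo A p x) - affHomeo A p x) := by
    have h4 : x = A (affHomeo A p x - p) := by rw [hz]; simp
    conv_lhs => rw [affConj, affHomeo_symm_apply]; rhs; rw [h4]
    rw [← map_sub]; congr 1; abel
  calc ‖affConj A p F x - x‖
      = ‖(A : En (m + 1) →L[ℂ] En (m + 1)) (F (affHomeo A p x) - affHomeo A p x)‖ := by
        rw [h3]; rfl
    _ ≤ a * ‖F (affHomeo A p x) - affHomeo A p x‖ := ContinuousLinearMap.le_opNorm _ _
    _ ≤ a * (ε / (a * b + 1) * (b * ‖x‖)) := by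
        gcongr; exact h2.le.trans (by gcongr)
    _ = (a * b / (a * b + 1)) * (ε * ‖x‖) := by field_simp
    _ ≤ 1 * (ε * ‖x‖) := by
        gcongr; rw [div_le_one hab]; linarith
    _ = ε * ‖x‖ := one_mul _

end Transfer

theorem automorphism_rigidity_k_one
    {n : ℕ} (hn : 2 ≤ n) (Ω : Set (En n)) (ρ : En n → ℝ)
    (hΩ : IsDomain' Ω) (hbd : Bornology.IsBounded Ω)
    (hρ : IsPcxCinfBoundary Ω ρ)
    (p : En n) (hp : p ∈ frontier Ω) (hspc : StronglyPcxAt ρ p)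
    (F : En n → En n) (hF : IsAutomorphismOf F Ω)
    (ho : LittleOh Ω F p 1)
    (hnb : ¬ ∃ Φ Ψ : En n → En n,
      DifferentiableOn ℂ Φ Ω ∧ MapsTo Φ Ω (Metric.ball (0 : En n) 1) ∧
      DifferentiableOn ℂ Ψ (Metric.ball (0 : En n) 1) ∧
      MapsTo Ψ (Metric.ball (0 : En n) 1) Ω ∧
      (∀ z ∈ Ω, Ψ (Φ z) = z) ∧ (∀ w ∈ Metric.ball (0 : En n) 1, Φ (Ψ w) = w)) :
    ∀ z ∈ Ω, F z = z := by
  obtain ⟨m, rfl⟩ : ∃ m, n = m + 1 := ⟨n - 1, by omega⟩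
  obtain ⟨hΩo, hΩc⟩ := hΩ
  obtain ⟨hFd, hFm, G, hGd, hGm, hGF, hFG⟩ := hF
  have hreg := hρ.1.interior_closure_subset
  have hpΩ : p ∉ Ω := fun h => hp.2 (hΩo.interior_eq.symm ▸ h)
  have hev := eventually_exists_normData hρ.1 hp hspc
  obtain ⟨A, ⟨D⟩⟩ := hev.self_of_nhds hp
  set e := affHomeo A p with he
  have he0 : e 0 = p := by rw [he, affHomeo_apply]; simp
  have hev' := (e.continuous.tendsto 0).eventually (he0.symm ▸ hev)
  obtain ⟨δ, hδ, hball⟩ := Metric.eventually_nhds_iff_ball.1 hev'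
  have hη := D.η_pos
  have S : NormData.Sys D (min (δ / 2) (D.η / 2)) (affConj A p F) (affConj A p G) :=
    { isOpen := hΩo.preimage e.continuous
      preconn := e.isPreconnected_preimage.2 hΩc.isPreconnected
      bdd := isBounded_affHomeo_preimage hbd
      hreg := interior_closure_affHomeo_preimage hreg
      tangent := isTangent_affConj hFd hFm hpΩ ho
      diff := differentiableOn_affConj hGd
      maps := mapsTo_affConj hGm
      left_inv := affConj_left_inv hGF
      right_inv := affConj_left_inv hFG
      η₁_pos := by positivity
      η₁_le := by linarith [min_le_right (δ / 2) (D.η / 2)]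
      noEscape := by
        intro l o hoΩ q hq hqn ht
        have hqf : e q ∈ frontier Ω := by
          have : q ∈ frontier (e ⁻¹' Ω) := hq
          rwa [← Homeomorph.preimage_frontier] at this
        have hqb : q ∈ ball (0 : En (m + 1)) δ := by
          rw [mem_ball_zero_iff]
          linarith [min_le_left (δ / 2) (D.η / 2)]
        obtain ⟨B, ⟨D'⟩⟩ := hball q hqb hqf
        refine hnb (exists_ball_equiv_of_tendsto (l := l) (φ := fun k => F^[k])
          (χ := fun k => G^[k]) (o := e o) D' hΩo hΩc.isPreconnected hbd hreg
          (fun k => NormData.differentiableOn_iterate hFm hFd k) (fun k => hFm.iterate k)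
          (fun k => NormData.differentiableOn_iterate hGm hGd k) (fun k => hGm.iterate k)
          (fun k => NormData.iterate_left_inv hFm hGF k)
          (fun k => NormData.iterate_left_inv hGm hFG k) hoΩ ?_)
        refine ((e.continuous.tendsto q).comp ht).congr fun k => ?_
        rw [comp_apply, affConj_iterate, affHomeo_affConj] }
  intro z hz
  have h1 := S.eq_id (e.symm z) (by
    change e (e.symm z) ∈ Ω
    rwa [e.apply_symm_apply])
  have h2 := congrArg e h1
  rwa [affHomeo_affConj, e.apply_symm_apply] at h2
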